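/- Let (X, 𝒳, μ, T) be an invertible measure preserving system (not assumed ergodic), let p₁, …, p_k be rationally independent integer polynomials with p_i(0) = 0 for i = 1, …, k, and let A ∈ 𝒳. Then for every ε > 0, the set {n ∈ ℕ : μ(A ∩ T^{-p₁(n)}A ∩ ⋯ ∩ T^{-p_k(n)}A) ≥ μ(A)^{k+1} − ε} is syndetic. -/

import Mathlib

open MeasureTheory Filter Finset
open scoped ENNReal

/-- An integer polynomial: a function `ℤ → ℤ` given by a polynomial (with rational
coefficients) taking integer values on the integers. -/
def IsIntPoly (p : ℤ → ℤ) : Prop :=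
  ∃ q : Polynomial ℚ, ∀ n : ℤ, q.eval (n : ℚ) = (p n : ℚ)

/-- Rational independence: every nontrivial integer linear combination is nonconstant. -/
def RatIndep {k : ℕ} (p : Fin k → ℤ → ℤ) : Prop :=
  ∀ c : Fin k → ℤ, c ≠ 0 → ¬ ∃ C : ℤ, ∀ n : ℤ, (∑ i, c i * p i n) = C

/-- A set of natural numbers is syndetic if for some `M`, every interval of length
greater than `M` meets the set. -/
def Syndetic (S : Set ℕ) : Prop :=
  ∃ M : ℕ, ∀ a : ℕ, ∃ n ∈ S, a ≤ n ∧ n ≤ a + M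

namespace IndepPoly
open scoped BigOperators ComplexConjugate

section

/-- A shift-invariant mean on bounded complex sequences (extended linearly to all sequences). -/
structure InvMean where
  /-- the underlying linear functional -/
  m : (ℤ → ℂ) →ₗ[ℂ] ℂ
  one : m (fun _ => 1) = 1
  pos : ∀ (a : ℤ → ℂ) (C : ℝ), (∀ n, ‖a n‖ ≤ C) → (∀ n, 0 ≤ (a n).re) → 0 ≤ (m a).re
  norm_le : ∀ (a : ℤ → ℂ) (C : ℝ), (∀ n, ‖a n‖ ≤ C) → ‖m a‖ ≤ C
  shift : ∀ (a : ℤ → ℂ) (C : ℝ) (h : ℤ), (∀ n, ‖a n‖ ≤ C) → m (fun n => a (n + h)) = m a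

namespace InvMean

variable (M : InvMean)

lemma const (c : ℂ) : M.m (fun _ => c) = c := by
  have : (fun _ : ℤ => c) = c • (fun _ : ℤ => (1 : ℂ)) := by ext; simp
  rw [this, map_smul, M.one]; simp

lemma add' (a b : ℤ → ℂ) : M.m (fun n => a n + b n) = M.m a + M.m b := M.m.map_add a b

lemma sub' (a b : ℤ → ℂ) : M.m (fun n => a n - b n) = M.m a - M.m b := M.m.map_sub a b

lemma const_mul (c : ℂ) (a : ℤ → ℂ) : M.m (fun n => c * a n) = c * M.m a := M.m.map_smul c a

lemma sum {ι : Type*} (s : Finset ι) (a : ι → ℤ → ℂ) :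
    M.m (fun n => ∑ i ∈ s, a i n) = ∑ i ∈ s, M.m (a i) := by
  rw [← map_sum]; congr 1; ext n; simp

lemma expect {ι : Type*} (s : Finset ι) (a : ι → ℤ → ℂ) :
    M.m (fun n => 𝔼 i ∈ s, a i n) = 𝔼 i ∈ s, M.m (a i) := by
  simp only [Finset.expect_eq_sum_div_card, div_eq_inv_mul]
  rw [const_mul, sum]

lemma mono {a b : ℤ → ℂ} {C D : ℝ} (ha : ∀ n, ‖a n‖ ≤ C) (hb : ∀ n, ‖b n‖ ≤ D)
    (h : ∀ n, (a n).re ≤ (b n).re) : (M.m a).re ≤ (M.m b).re := by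
  have := M.pos (fun n => b n - a n) (D + C)
    (fun n => (norm_sub_le _ _).trans (add_le_add (hb n) (ha n))) (fun n => by simpa using h n)
  rw [sub'] at this
  simpa using this

lemma jensen {a : ℤ → ℂ} {C : ℝ} (ha : ∀ n, ‖a n‖ ≤ C) :
    ‖M.m a‖ ^ 2 ≤ (M.m (fun n => ((‖a n‖ ^ 2 : ℝ) : ℂ))).re := by
  set z := M.m a with hz
  have hzC : ‖z‖ ≤ C := M.norm_le a C ha
  have hC : 0 ≤ C := (norm_nonneg _).trans hzC
  have h0 := M.pos (fun n => ((‖a n‖ ^ 2 : ℝ) : ℂ) + ((-2 * conj z) * a n + ((‖z‖ ^ 2 : ℝ) : ℂ)))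
    (C ^ 2 + (2 * C * C + C ^ 2)) (fun n => by
      have h1 := ha n
      have hn := norm_nonneg (a n)
      have hzn := norm_nonneg z
      refine (norm_add_le _ _).trans (add_le_add ?_ ((norm_add_le _ _).trans (add_le_add ?_ ?_)))
      · rw [Complex.norm_real, Real.norm_of_nonneg (by positivity)]; gcongr
      · simp only [norm_mul, norm_neg, RCLike.norm_conj, Complex.norm_ofNat]
        gcongr
      · rw [Complex.norm_real, Real.norm_of_nonneg (by positivity)]; gcongr)
    (fun n => by
      have : 0 ≤ Complex.normSq (a n - z) := Complex.normSq_nonneg _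
      rw [Complex.normSq_sub] at this
      simp only [Complex.sq_norm, Complex.add_re, Complex.ofReal_re]
      have h2 : ((-2 * conj z) * a n).re = -2 * (a n * conj z).re := by simp; ring
      rw [h2]; linarith)
  rw [add', add', const_mul, const, ← hz] at h0
  have h3 : (-2 * conj z * z).re = -2 * ‖z‖ ^ 2 := by
    rw [mul_assoc, mul_comm (conj z) z, Complex.mul_conj, Complex.sq_norm]
    norm_cast
  simp only [Complex.add_re, h3, Complex.ofReal_re] at h0
  linarith

lemma jensen_pow (t : ℕ) : ∀ {a : ℤ → ℂ} {C : ℝ} (_ : ∀ n, ‖a n‖ ≤ C),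
    ‖M.m a‖ ^ 2 ^ t ≤ (M.m (fun n => ((‖a n‖ ^ 2 ^ t : ℝ) : ℂ))).re := by
  induction t with
  | zero =>
    intro a C ha
    have hp := M.pos
    simp only [pow_zero, pow_one]
    -- compare with a unimodular multiple
    obtain ⟨w, hw1, hw2⟩ : ∃ w : ℂ, ‖w‖ ≤ 1 ∧ w * M.m a = ‖M.m a‖ := by
      by_cases h : M.m a = 0
      · exact ⟨0, by simp, by simp [h]⟩
      · refine ⟨‖M.m a‖ / M.m a, by simp [h], by field_simp⟩
    rw [← const_mul] at hw2
    have : ‖M.m a‖ = (M.m (fun n => w * a n)).re := by rw [hw2]; simp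
    rw [this]
    refine M.mono (C := C) (D := C) (fun n => ?_) (fun n => ?_) (fun n => ?_)
    · rw [norm_mul]; nlinarith [ha n, norm_nonneg (a n)]
    · simpa using ha n
    · refine (Complex.re_le_norm _).trans ?_
      rw [norm_mul]; simp; nlinarith [ha n, norm_nonneg (a n)]
  | succ t ih =>
    intro a C ha
    have hC : 0 ≤ C := (norm_nonneg _).trans (ha 0)
    calc ‖M.m a‖ ^ 2 ^ (t + 1) = (‖M.m a‖ ^ 2 ^ t) ^ 2 := by rw [← pow_mul, pow_succ]
      _ ≤ ((M.m (fun n => ((‖a n‖ ^ 2 ^ t : ℝ) : ℂ))).re) ^ 2 := by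
          gcongr; exact ih ha
      _ ≤ ‖M.m (fun n => ((‖a n‖ ^ 2 ^ t : ℝ) : ℂ))‖ ^ 2 := by
          rw [sq_le_sq]; simpa using Complex.abs_re_le_norm _
      _ ≤ _ := by
          refine (M.jensen (C := C ^ 2 ^ t) (fun n => ?_)).trans_eq ?_
          · rw [Complex.norm_real, Real.norm_of_nonneg (by positivity)]
            gcongr; exact ha n
          · congr 2; ext n
            rw [Complex.norm_real, Real.norm_of_nonneg (by positivity), ← pow_mul, pow_succ]

end InvMean

lemma norm_expect_le {ι : Type*} (s : Finset ι) (f : ι → ℂ) : ‖𝔼 i ∈ s, f i‖ ≤ 𝔼 i ∈ s, ‖f i‖ := by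
  rw [Finset.expect_eq_sum_div_card, Finset.expect_eq_sum_div_card, norm_div]
  simp only [RCLike.norm_natCast]
  gcongr
  exact norm_sum_le _ _

lemma norm_expect_le_of_le {ι : Type*} {s : Finset ι} {f : ι → ℂ} {C : ℝ} (hC : 0 ≤ C)
    (h : ∀ i ∈ s, ‖f i‖ ≤ C) : ‖𝔼 i ∈ s, f i‖ ≤ C := by
  rw [Finset.expect_eq_sum_div_card, norm_div]
  simp only [RCLike.norm_natCast]
  rcases s.eq_empty_or_nonempty with rfl | hs
  · simpa using hC
  · rw [div_le_iff₀ (by exact_mod_cast hs.card_pos)]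
    calc ‖∑ i ∈ s, f i‖ ≤ ∑ i ∈ s, ‖f i‖ := norm_sum_le _ _
      _ ≤ ∑ i ∈ s, C := Finset.sum_le_sum h
      _ = C * s.card := by simp [mul_comm]

/-- Averages over a sequence of intervals with length tending to infinity. -/
noncomputable def iavg (a : ℕ → ℤ) (L : ℕ → ℕ) (N : ℕ) (u : ℤ → ℂ) : ℂ :=
  𝔼 n ∈ Finset.range (L N), u (a N + n)

lemma iavg_shift (a : ℕ → ℤ) (L : ℕ → ℕ) (N : ℕ) (u : ℤ → ℂ) (C : ℝ) (hu : ∀ n, ‖u n‖ ≤ C) :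
    ‖iavg a L N (fun n => u (n + 1)) - iavg a L N u‖ ≤ 2 * C / L N := by
  rw [iavg, iavg, Finset.expect_eq_sum_div_card, Finset.expect_eq_sum_div_card, ← sub_div,
    norm_div, ← Finset.sum_sub_distrib]
  have := Finset.sum_range_sub (fun n : ℕ => u (a N + n)) (L N)
  simp only [Nat.cast_add, Nat.cast_one, ← add_assoc] at this
  simp only [this, card_range, RCLike.norm_natCast]
  gcongr
  exact (norm_sub_le _ _).trans (by linarith [hu (a N + (L N)), hu (a N + ((0 : ℕ) : ℤ))])

lemma exists_invMean (a : ℕ → ℤ) (L : ℕ → ℕ) (hL : Tendsto L atTop atTop) (𝒰 : Ultrafilter ℕ)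
    (h𝒰 : (𝒰 : Filter ℕ) ≤ atTop) :
    ∃ M : InvMean, ∀ (u : ℤ → ℂ) (C : ℝ), (∀ n, ‖u n‖ ≤ C) →
      Tendsto (fun N => iavg a L N u) 𝒰 (nhds (M.m u)) := by
  have hbd : ∀ (u : ℤ → ℂ) (C : ℝ), (∀ n, ‖u n‖ ≤ C) → ∀ N, ‖iavg a L N u‖ ≤ C :=
    fun u C hu N => norm_expect_le_of_le ((norm_nonneg _).trans (hu 0)) (fun i _ => hu _)
  have hlim : ∀ u : ℤ → ℂ, (∃ C : ℝ, ∀ n, ‖u n‖ ≤ C) →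
      ∃ z, Tendsto (fun N => iavg a L N u) 𝒰 (nhds z) := by
    rintro u ⟨C, hu⟩
    obtain ⟨z, -, hz⟩ := (isCompact_closedBall (0 : ℂ) C).ultrafilter_le_nhds
      (𝒰.map (fun N => iavg a L N u)) (by
        rw [le_principal_iff]
        refine Filter.mem_map.2 (Filter.univ_mem' fun N => ?_)
        simpa using hbd u C hu N)
    exact ⟨z, hz⟩
  let V : Submodule ℂ (ℤ → ℂ) :=
    { carrier := {u | ∃ C : ℝ, ∀ n, ‖u n‖ ≤ C}
      add_mem' := by
        rintro u v ⟨C, hu⟩ ⟨D, hv⟩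
        exact ⟨C + D, fun n => (norm_add_le _ _).trans (add_le_add (hu n) (hv n))⟩
      zero_mem' := ⟨0, by simp⟩
      smul_mem' := by
        rintro c u ⟨C, hu⟩
        refine ⟨‖c‖ * C, fun n => ?_⟩
        simp only [Pi.smul_apply, smul_eq_mul, norm_mul]
        exact mul_le_mul_of_nonneg_left (hu n) (norm_nonneg _) }
  choose l hl using hlim
  let φ : V →ₗ[ℂ] ℂ :=
    { toFun := fun u => l u.1 u.2
      map_add' := by
        intro u v
        refine tendsto_nhds_unique (hl _ (u + v).2) ?_
        have := (hl _ u.2).add (hl _ v.2)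
        refine this.congr fun N => ?_
        simp [iavg, Finset.expect_add_distrib]
      map_smul' := by
        intro c u
        refine tendsto_nhds_unique (hl _ (c • u).2) ?_
        have := (hl _ u.2).const_mul c
        refine this.congr fun N => ?_
        simp [iavg, Finset.mul_expect] }
  obtain ⟨ψ, hψ⟩ := φ.exists_extend
  have key : ∀ (u : ℤ → ℂ) (C : ℝ), (∀ n, ‖u n‖ ≤ C) →
      Tendsto (fun N => iavg a L N u) 𝒰 (nhds (ψ u)) := by
    intro u C hu
    have h1 := hl u ⟨C, hu⟩
    have : ψ u = l u ⟨C, hu⟩ := by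
      exact LinearMap.congr_fun hψ (⟨u, C, hu⟩ : V)
    rw [this]; exact h1
  have hL0 : ∀ᶠ N in (𝒰 : Filter ℕ), 0 < L N :=
    h𝒰 (hL.eventually (eventually_gt_atTop 0))
  have hs1 : ∀ (u : ℤ → ℂ) (C : ℝ), (∀ n, ‖u n‖ ≤ C) → ψ (fun n => u (n + 1)) = ψ u := by
    intro u C hu
    have h1 := (key _ C (fun n => hu (n + 1))).sub (key u C hu)
    have h2 : Tendsto (fun N => iavg a L N (fun n => u (n + 1)) - iavg a L N u) 𝒰 (nhds 0) := by
      refine squeeze_zero_norm (fun N => iavg_shift a L N u C hu) ?_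
      have : Tendsto (fun N => ((L N : ℕ) : ℝ)) 𝒰 atTop :=
        tendsto_natCast_atTop_atTop.comp (hL.mono_left h𝒰)
      exact this.const_div_atTop _
    exact sub_eq_zero.1 (tendsto_nhds_unique h1 h2)
  refine ⟨⟨ψ, ?_, ?_, ?_, ?_⟩, key⟩
  · refine tendsto_nhds_unique (key (fun _ => 1) 1 (by simp)) ?_
    refine tendsto_const_nhds.congr' ?_
    filter_upwards [hL0] with N hN
    rw [iavg, Finset.expect_const (by simpa using hN.ne')]
  · intro u C hu h0
    refine ge_of_tendsto ((Complex.continuous_re.tendsto _).comp (key u C hu))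
      (Filter.Eventually.of_forall fun N => ?_)
    simp only [Function.comp, iavg, Finset.expect_eq_sum_div_card]
    rw [← Complex.ofReal_natCast, Complex.div_ofReal_re, Complex.re_sum]
    exact div_nonneg (Finset.sum_nonneg fun i _ => h0 _) (by positivity)
  · intro u C hu
    exact le_of_tendsto (key u C hu).norm (Filter.Eventually.of_forall (hbd u C hu))
  · intro u C h hu
    induction h using Int.induction_on generalizing u with
    | zero => simp
    | succ i ih =>
      rw [← ih u hu, ← hs1 (fun n => u (n + i)) C (fun n => hu _)]
      congr 1; ext n; congr 1; ring
    | pred i ih =>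
      rw [← ih u hu, ← hs1 (fun n => u (n + (-(i : ℤ) - 1))) C (fun n => hu _)]
      congr 1; ext n; congr 1; ring

end

section Basic
variable {X : Type*} [MeasurableSpace X]

/-- Measurable functions bounded by one everywhere. -/
def B1 (f : X → ℂ) : Prop := Measurable f ∧ ∀ x, ‖f x‖ ≤ 1

namespace B1
variable {f g : X → ℂ}

lemma mul (hf : B1 f) (hg : B1 g) : B1 (fun x => f x * g x) :=
  ⟨hf.1.mul hg.1, fun x => by
    rw [norm_mul]; exact mul_le_one₀ (hf.2 x) (norm_nonneg _) (hg.2 x)⟩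

lemma star (hf : B1 f) : B1 (fun x => conj (f x)) :=
  ⟨(Complex.continuous_conj.measurable).comp hf.1, fun x => by
    rw [RCLike.norm_conj]; exact hf.2 x⟩

lemma const {c : ℂ} (hc : ‖c‖ ≤ 1) : B1 (fun _ : X => c) := ⟨measurable_const, fun _ => hc⟩

lemma one : B1 (fun _ : X => (1 : ℂ)) := const (by simp)

lemma const_mul (hf : B1 f) {c : ℂ} (hc : ‖c‖ ≤ 1) : B1 (fun x => c * f x) := (const hc).mul hf

lemma comp {Y : Type*} [MeasurableSpace Y] (hf : B1 f) {φ : Y → X} (hφ : Measurable φ) :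
    B1 (fun y => f (φ y)) := ⟨hf.1.comp hφ, fun _ => hf.2 _⟩

lemma prod {ι : Type*} (s : Finset ι) {f : ι → X → ℂ} (hf : ∀ i ∈ s, B1 (f i)) :
    B1 (fun x => ∏ i ∈ s, f i x) := by
  classical
  induction s using Finset.induction_on with
  | empty => simpa using one
  | insert a s ha ih =>
    simp only [Finset.prod_insert ha]
    exact (hf a (by simp)).mul (ih fun i hi => hf i (by simp [hi]))

lemma expect {ι : Type*} (s : Finset ι) {f : ι → X → ℂ} (hf : ∀ i ∈ s, B1 (f i)) :
    B1 (fun x => 𝔼 i ∈ s, f i x) := by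
  refine ⟨?_, fun x => norm_expect_le_of_le zero_le_one fun i hi => (hf i hi).2 x⟩
  simp only [Finset.expect_eq_sum_div_card]
  exact (Finset.measurable_sum _ fun i hi => (hf i hi).1).div_const _

lemma integrable (hf : B1 f) (μ : Measure X) [IsFiniteMeasure μ] : Integrable f μ :=
  Integrable.of_bound hf.1.aestronglyMeasurable 1 (Filter.Eventually.of_forall hf.2)

lemma norm_integral_le (hf : B1 f) (μ : Measure X) [IsProbabilityMeasure μ] :
    ‖∫ x, f x ∂μ‖ ≤ 1 := by
  simpa using norm_integral_le_of_norm_le_const (μ := μ) (Filter.Eventually.of_forall hf.2)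

end B1

/-- Cauchy-Schwarz against a bounded function. -/
lemma norm_integral_mul_sq_le (μ : Measure X) [IsProbabilityMeasure μ] {f g : X → ℂ} (hf : B1 f)
    (hg : Measurable g) {C : ℝ} (hC : ∀ x, ‖g x‖ ≤ C) :
    ‖∫ x, f x * g x ∂μ‖ ^ 2 ≤ ∫ x, ‖g x‖ ^ 2 ∂μ := by
  have hgi : Integrable (fun x => ‖g x‖) μ :=
    (Integrable.of_bound hg.aestronglyMeasurable C (Filter.Eventually.of_forall hC)).norm
  have hgi2 : Integrable (fun x => ‖g x‖ ^ 2) μ := by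
    refine Integrable.of_bound (hg.norm.pow_const 2).aestronglyMeasurable (C ^ 2)
      (Filter.Eventually.of_forall fun x => ?_)
    rw [Real.norm_of_nonneg (by positivity)]
    have := hC x
    gcongr
  have h1 : ‖∫ x, f x * g x ∂μ‖ ≤ ∫ x, ‖g x‖ ∂μ := by
    refine (norm_integral_le_integral_norm _).trans
      (integral_mono_of_nonneg (Filter.Eventually.of_forall fun x => norm_nonneg _) hgi
        (Filter.Eventually.of_forall fun x => ?_))
    simp only [norm_mul]
    nlinarith [hf.2 x, norm_nonneg (g x)]
  set c := ∫ x, ‖g x‖ ∂μ with hc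
  have h2 : 0 ≤ ∫ x, (‖g x‖ - c) ^ 2 ∂μ := integral_nonneg fun x => by positivity
  have h3 : ∫ x, (‖g x‖ - c) ^ 2 ∂μ = ∫ x, ‖g x‖ ^ 2 ∂μ - c ^ 2 := by
    have : ∀ x, (‖g x‖ - c) ^ 2 = ‖g x‖ ^ 2 - (2 * c) * ‖g x‖ + c ^ 2 := fun x => by ring
    simp only [this]
    have h5 : Integrable (fun x => ‖g x‖ ^ 2 - (2 * c) * ‖g x‖) μ := hgi2.sub (hgi.const_mul _)
    rw [integral_add h5 (integrable_const _),
      integral_sub hgi2 (hgi.const_mul _), integral_const_mul, ← hc]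
    simp; ring
  have h4 : ‖∫ x, f x * g x ∂μ‖ ^ 2 ≤ c ^ 2 := by gcongr
  linarith

lemma integral_expect {ι : Type*} (μ : Measure X) [IsFiniteMeasure μ] (s : Finset ι)
    {f : ι → X → ℂ} (hf : ∀ i ∈ s, Integrable (f i) μ) :
    ∫ x, 𝔼 i ∈ s, f i x ∂μ = 𝔼 i ∈ s, ∫ x, f i x ∂μ := by
  simp only [Finset.expect_eq_sum_div_card]
  rw [integral_div, integral_finsetSum _ hf]

/-- weak averages of a bounded sequence of functions. -/
lemma exists_weakAvg (μ : Measure X) [IsProbabilityMeasure μ] (M : InvMean) (F : ℤ → X → ℂ)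
    (hF : ∀ n, B1 (F n)) :
    ∃ D : X → ℂ, B1 D ∧ ∀ g : X → ℂ, B1 g →
      ∫ x, D x * g x ∂μ = M.m (fun n => ∫ x, F n x * g x ∂μ) := by
  have hmem : ∀ {g : X → ℂ}, B1 g → MemLp g 2 μ := fun hg =>
    MemLp.of_bound hg.1.aestronglyMeasurable 1 (Filter.Eventually.of_forall hg.2)
  have hnorm : ∀ {g : X → ℂ} (hg : B1 g), ‖(hmem hg).toLp g‖ ≤ 1 := fun {g} hg => by
    have := Lp.norm_le_of_ae_bound (p := 2) (μ := μ) (f := (hmem hg).toLp g) (C := 1) zero_le_one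
      (by filter_upwards [(hmem hg).coeFn_toLp] with x hx; rw [hx]; exact hg.2 x)
    simpa [measureUnivNNReal] using this
  have hin : ∀ {a b : X → ℂ} (ha : B1 a) (hb : B1 b),
      inner ℂ ((hmem ha).toLp a) ((hmem hb).toLp b) = ∫ x, conj (a x) * b x ∂μ := by
    intro a b ha hb
    rw [L2.inner_def]
    refine integral_congr_ae ?_
    filter_upwards [(hmem ha).coeFn_toLp, (hmem hb).coeFn_toLp] with x h1 h2
    rw [h1, h2]; simp [mul_comm]
  let c : ℤ → Lp ℂ 2 μ := fun n => (hmem (hF n).star).toLp _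
  have hcb : ∀ g : Lp ℂ 2 μ, ∀ n, ‖(inner ℂ (c n) g : ℂ)‖ ≤ 1 * ‖g‖ := fun g n =>
    (norm_inner_le_norm _ _).trans
      (mul_le_mul_of_nonneg_right (hnorm (hF n).star) (norm_nonneg _))
  let φ : Lp ℂ 2 μ →ₗ[ℂ] ℂ :=
    { toFun := fun g => M.m (fun n => inner ℂ (c n) g)
      map_add' := fun g h => by simp only [inner_add_right]; exact M.add' _ _
      map_smul' := fun r g => by simp only [inner_smul_right]; exact M.const_mul _ _ }
  let Φ : Lp ℂ 2 μ →L[ℂ] ℂ := φ.mkContinuous 1 fun g => M.norm_le _ _ (hcb g)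
  obtain ⟨d, hd⟩ := (InnerProductSpace.toDual ℂ (Lp ℂ 2 μ)).surjective Φ
  have hd' : ∀ {g : X → ℂ} (hg : B1 g),
      ∫ x, conj (d x) * g x ∂μ = M.m (fun n => ∫ x, F n x * g x ∂μ) := by
    intro g hg
    have h1 : inner ℂ d ((hmem hg).toLp g) = Φ ((hmem hg).toLp g) := by
      rw [← hd]; rfl
    have h2 : Φ ((hmem hg).toLp g) = M.m (fun n => ∫ x, F n x * g x ∂μ) := by
      change M.m (fun n => inner ℂ (c n) _) = _
      congr 1; ext n
      rw [hin (hF n).star hg]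
      simp
    rw [← h2, ← h1, L2.inner_def]
    refine integral_congr_ae ?_
    filter_upwards [(hmem hg).coeFn_toLp] with x h2
    rw [h2]; simp [mul_comm]
  have hdm : Measurable (d : X → ℂ) := (Lp.stronglyMeasurable d).measurable
  have hdi : Integrable (d : X → ℂ) μ := (Lp.memLp d).integrable (by norm_num)
  -- almost everywhere bound
  set E : Set X := {x | 1 < ‖d x‖} with hE
  have hEm : MeasurableSet E := measurableSet_lt measurable_const hdm.norm
  have hae : ∀ᵐ x ∂μ, ‖d x‖ ≤ 1 := by
    let g : X → ℂ := E.indicator (fun x => d x / ‖d x‖)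
    have hg : B1 g := by
      refine ⟨(hdm.div (Complex.measurable_ofReal.comp hdm.norm)).indicator hEm, fun x => ?_⟩
      by_cases hx : x ∈ E
      · simp only [g, Set.indicator_of_mem hx, norm_div, Complex.norm_real, norm_norm]
        exact div_self_le_one _
      · simp [g, Set.indicator_of_notMem hx]
    have hgE : ∀ x, ‖g x‖ ≤ E.indicator (fun _ => (1 : ℝ)) x := by
      intro x
      by_cases hx : x ∈ E
      · rw [Set.indicator_of_mem hx]; exact hg.2 x
      · simp [g, Set.indicator_of_notMem hx]
    have h1 : ∀ x, conj (d x) * g x = ((E.indicator (fun x => ‖d x‖) x : ℝ) : ℂ) := by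
      intro x
      by_cases hx : x ∈ E
      · have h0 : (‖d x‖ : ℂ) ≠ 0 := by
          have : (1 : ℝ) < ‖d x‖ := hx
          exact_mod_cast (by linarith : ‖d x‖ ≠ 0)
        simp only [g, Set.indicator_of_mem hx]
        rw [mul_div_assoc', div_eq_iff h0, mul_comm, Complex.mul_conj, Complex.normSq_eq_norm_sq]
        push_cast; ring
      · simp [g, Set.indicator_of_notMem hx]
    have h2 := hd' hg
    simp only [h1, integral_complex_ofReal] at h2
    have h3 : ‖M.m (fun n => ∫ x, F n x * g x ∂μ)‖ ≤ ∫ x, E.indicator (fun _ => (1 : ℝ)) x ∂μ := by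
      refine M.norm_le _ _ fun n => ?_
      refine norm_integral_le_of_norm_le ((integrable_const _).indicator hEm)
        (Filter.Eventually.of_forall fun x => ?_)
      rw [norm_mul]
      have := (hF n).2 x
      nlinarith [hgE x, norm_nonneg (g x)]
    rw [← h2, Complex.norm_real] at h3
    have h4 : ∫ x, E.indicator (fun x => ‖d x‖) x ∂μ ≤ ∫ x, E.indicator (fun _ => (1 : ℝ)) x ∂μ :=
      (le_abs_self _).trans h3
    have hi1 : Integrable (E.indicator (fun x => ‖d x‖)) μ := hdi.norm.indicator hEm
    have hi2 : Integrable (E.indicator (fun _ => (1 : ℝ))) μ := (integrable_const _).indicator hEm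
    have h5 : ∫ x, (E.indicator (fun x => ‖d x‖) x - E.indicator (fun _ => (1 : ℝ)) x) ∂μ = 0 := by
      refine le_antisymm ?_ (integral_nonneg fun x => ?_)
      · rw [integral_sub hi1 hi2]; linarith
      · by_cases hx : x ∈ E
        · have : (1 : ℝ) < ‖d x‖ := hx
          simp [Set.indicator_of_mem hx]; linarith
        · simp [Set.indicator_of_notMem hx]
    have h6 := (integral_eq_zero_iff_of_nonneg (fun x => by
      by_cases hx : x ∈ E
      · have : (1 : ℝ) < ‖d x‖ := hx
        simp [Set.indicator_of_mem hx]; linarith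
      · simp [Set.indicator_of_notMem hx]) (hi1.sub hi2)).1 h5
    filter_upwards [h6] with x hx
    by_contra hlt
    have hx' : x ∈ E := not_le.1 hlt
    simp [Set.indicator_of_mem hx'] at hx
    linarith
  refine ⟨Eᶜ.indicator (fun x => conj (d x)), ⟨?_, fun x => ?_⟩, fun g hg => ?_⟩
  · exact (Complex.continuous_conj.measurable.comp hdm).indicator hEm.compl
  · by_cases hx : x ∈ Eᶜ
    · rw [Set.indicator_of_mem hx, RCLike.norm_conj]
      exact not_lt.1 hx
    · rw [Set.indicator_of_notMem hx]; simp
  · rw [← hd' hg]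
    refine integral_congr_ae ?_
    filter_upwards [hae] with x hx
    rw [Set.indicator_of_mem]
    exact not_lt.2 hx

/-- An invertible measure preserving system. -/
structure Sys (μ : Measure X) (T : Equiv.Perm X) : Prop where
  mp : MeasurePreserving T μ μ
  mp' : MeasurePreserving T.symm μ μ

/-- the shift of a function by a power of the transformation. -/
def sh {X Z : Type*} (T : Equiv.Perm X) (n : ℤ) (f : X → Z) : X → Z := fun x => f ((T ^ n) x)

variable {μ : Measure X} {T : Equiv.Perm X}

@[simp] lemma sh_zero {X Z : Type*} {T : Equiv.Perm X} (f : X → Z) : sh T 0 f = f := by ext; simp [sh]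

lemma sh_sh {X Z : Type*} {T : Equiv.Perm X} (m n : ℤ) (f : X → Z) : sh T m (sh T n f) = sh T (n + m) f := by
  ext x; simp [sh, zpow_add]

namespace Sys
lemma zpow (hT : Sys μ T) (n : ℤ) : MeasurePreserving (⇑(T ^ n)) μ μ := by
  induction n using Int.induction_on with
  | zero => simpa using MeasurePreserving.id μ
  | succ i ih =>
    have : ⇑(T ^ ((i : ℤ) + 1)) = ⇑(T ^ (i : ℤ)) ∘ ⇑T := by
      rw [zpow_add, zpow_one]; rfl
    rw [this]; exact ih.comp hT.mp
  | pred i ih =>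
    have : ⇑(T ^ (-(i : ℤ) - 1)) = ⇑(T ^ (-(i : ℤ))) ∘ ⇑T.symm := by
      rw [zpow_sub, zpow_one]; rfl
    rw [this]; exact ih.comp hT.mp'

lemma integral_sh (hT : Sys μ T) {E : Type*} [NormedAddCommGroup E] [NormedSpace ℝ E] (n : ℤ) (f : X → E) :
    ∫ x, sh T n f x ∂μ = ∫ x, f x ∂μ := by
  let e : X ≃ᵐ X := ⟨T ^ n, (hT.zpow n).measurable, by
    have := (hT.zpow (-n)).measurable
    rw [zpow_neg] at this; exact this⟩
  exact (hT.zpow n).integral_comp e.measurableEmbedding f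

lemma b1_sh (hT : Sys μ T) {f : X → ℂ} (hf : B1 f) (n : ℤ) : B1 (sh T n f) := hf.comp (hT.zpow n).measurable

lemma integral_sh' (hT : Sys μ T) {E : Type*} [NormedAddCommGroup E] [NormedSpace ℝ E] (n : ℤ) (f : X → E) :
    ∫ x, f ((T ^ n) x) ∂μ = ∫ x, f x ∂μ := hT.integral_sh n f

end Sys

end Basic

section

section VdC
variable {X : Type*} [MeasurableSpace X] {μ : Measure X} [IsProbabilityMeasure μ]

lemma expect_mul_star {ι : Type*} (s : Finset ι) (a : ι → ℂ) :
    ((‖𝔼 i ∈ s, a i‖ ^ 2 : ℝ) : ℂ) = 𝔼 i ∈ s, 𝔼 j ∈ s, a i * conj (a j) := by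
  rw [← Complex.normSq_eq_norm_sq, ← Complex.mul_conj]
  simp only [Finset.expect_eq_sum_div_card, map_div₀, map_sum, map_natCast]
  rw [div_mul_div_comm, Finset.sum_mul_sum, ← Finset.sum_div, div_div]

lemma re_expect {ι : Type*} (s : Finset ι) (a : ι → ℂ) :
    (𝔼 i ∈ s, a i).re = 𝔼 i ∈ s, (a i).re := by
  rw [Finset.expect_eq_sum_div_card, Finset.expect_eq_sum_div_card, ← Complex.re_sum]
  exact Complex.div_natCast_re _ _

/-- The van der Corput inequality. -/
lemma vdC (M : InvMean) {f₀ : X → ℂ} (hf₀ : B1 f₀) {v : ℤ → X → ℂ} (hv : ∀ n, B1 (v n))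
    {B : Finset ℤ} (hB : B.Nonempty) :
    ‖M.m (fun n => ∫ x, f₀ x * v n x ∂μ)‖ ^ 2 ≤
      𝔼 h ∈ B, 𝔼 h' ∈ B, ‖M.m (fun n => ∫ x, v (n + h) x * conj (v (n + h') x) ∂μ)‖ := by
  have hb : ∀ n, ‖∫ x, f₀ x * v n x ∂μ‖ ≤ 1 := fun n => (hf₀.mul (hv n)).norm_integral_le μ
  let V : ℤ → X → ℂ := fun n x => 𝔼 h ∈ B, v (n + h) x
  have hV : ∀ n, B1 (V n) := fun n => B1.expect B fun h _ => hv _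
  have h1 : M.m (fun n => ∫ x, f₀ x * v n x ∂μ) = M.m (fun n => ∫ x, f₀ x * V n x ∂μ) := by
    have e1 : ∀ n, ∫ x, f₀ x * V n x ∂μ = 𝔼 h ∈ B, ∫ x, f₀ x * v (n + h) x ∂μ := by
      intro n
      simp only [V, Finset.mul_expect]
      exact integral_expect μ B fun h _ => (hf₀.mul (hv _)).integrable μ
    simp only [e1]
    rw [M.expect]
    have e2 : ∀ h ∈ B, M.m (fun n => ∫ x, f₀ x * v (n + h) x ∂μ)
        = M.m (fun n => ∫ x, f₀ x * v n x ∂μ) := fun h _ => M.shift _ 1 h hb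
    rw [Finset.expect_congr rfl e2, Finset.expect_const hB]
  rw [h1]
  have hb' : ∀ n, ‖∫ x, f₀ x * V n x ∂μ‖ ≤ 1 := fun n => (hf₀.mul (hV n)).norm_integral_le μ
  have e3 : ∀ n, ((∫ x, ‖V n x‖ ^ 2 ∂μ : ℝ) : ℂ) =
      𝔼 h ∈ B, 𝔼 h' ∈ B, ∫ x, v (n + h) x * conj (v (n + h') x) ∂μ := by
    intro n
    rw [← integral_complex_ofReal]
    simp only [V, expect_mul_star]
    rw [integral_expect]
    · refine Finset.expect_congr rfl fun h _ => integral_expect μ B fun h' _ => ?_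
      exact ((hv _).mul (hv _).star).integrable μ
    · intro h _
      exact (B1.expect B fun h' _ => (hv _).mul (hv _).star).integrable μ
  calc _ ≤ (M.m (fun n => ((‖∫ x, f₀ x * V n x ∂μ‖ ^ 2 : ℝ) : ℂ))).re := M.jensen hb'
    _ ≤ (M.m (fun n => 𝔼 h ∈ B, 𝔼 h' ∈ B, ∫ x, v (n + h) x * conj (v (n + h') x) ∂μ)).re := by
        refine M.mono (C := 1) (D := 1) (fun n => ?_) (fun n => ?_) (fun n => ?_)
        · rw [Complex.norm_real, Real.norm_of_nonneg (by positivity)]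
          exact pow_le_one₀ (norm_nonneg _) (hb' n)
        · refine norm_expect_le_of_le zero_le_one fun h _ => norm_expect_le_of_le zero_le_one
            fun h' _ => ((hv _).mul (hv _).star).norm_integral_le μ
        · rw [← e3]
          exact norm_integral_mul_sq_le μ hf₀ (hV n).1 (hV n).2
    _ ≤ _ := by
        refine (Complex.re_le_norm _).trans ?_
        rw [M.expect]
        refine (norm_expect_le _ _).trans (Finset.expect_le_expect fun h _ => ?_)
        rw [M.expect]
        exact norm_expect_le _ _

end VdC

/-- `t`-tuples. -/
@[reducible] def Par (α : Type) : ℕ → Type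
  | 0 => Unit
  | t + 1 => α × Par α t

/-- symmetric integer intervals. -/
noncomputable def J (H : ℕ) : Finset ℤ := Finset.Icc (-(H : ℤ)) H

lemma J_nonempty (H : ℕ) : (J H).Nonempty := ⟨0, by simp [J]⟩

lemma card_J (H : ℕ) : (J H).card = 2 * H + 1 := by simp [J]; omega

section Box
variable {X : Type*} [MeasurableSpace X]

/-- Box norms of a function along a transformation, at given scales. -/
noncomputable def G (μ : Measure X) (T : Equiv.Perm X) : (t : ℕ) → Par ℕ t → (X → ℂ) → ℝ
  | 0, _, F => ‖∫ x, F x ∂μ‖ ^ 2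
  | t + 1, H, F => 𝔼 h ∈ J H.1, 𝔼 k ∈ J H.1, G μ T t H.2 (fun x => sh T h F x * conj (sh T k F x))

variable {μ : Measure X} {T : Equiv.Perm X}

lemma G_nonneg (t : ℕ) (H : Par ℕ t) (F : X → ℂ) : 0 ≤ G μ T t H F := by
  induction t generalizing F with
  | zero => simp only [G]; positivity
  | succ t ih =>
    exact Finset.expect_nonneg fun _ _ => Finset.expect_nonneg fun _ _ => ih _ _

lemma G_sh (hT : Sys μ T) (t : ℕ) (H : Par ℕ t) (n : ℤ) (F : X → ℂ) :
    G μ T t H (sh T n F) = G μ T t H F := by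
  induction t generalizing F with
  | zero => simp only [G, hT.integral_sh]
  | succ t ih =>
    simp only [G]
    refine Finset.expect_congr rfl fun h _ => Finset.expect_congr rfl fun k _ => ?_
    rw [← ih H.2 (fun x => sh T h F x * conj (sh T k F x))]
    congr 1
    ext x
    simp only [sh, ← Equiv.Perm.mul_apply, ← zpow_add, add_comm]

/-- `F` is controlled from below by a box norm of order at most `N`, with parameter `1/(N+1)`. -/
def Ctl (μ : Measure X) (T : Equiv.Perm X) (N : ℕ) (F : X → ℂ) : Prop :=
  ∃ t ≤ N, ∀ H : Par ℕ t, 1 / ((N : ℝ) + 1) ≤ G μ T t H F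

lemma Ctl.mono {N N' : ℕ} (h : N ≤ N') {F : X → ℂ} (hF : Ctl μ T N F) : Ctl μ T N' F := by
  obtain ⟨t, ht, hH⟩ := hF
  refine ⟨t, ht.trans h, fun H => le_trans ?_ (hH H)⟩
  gcongr

lemma Ctl.sh (hT : Sys μ T) {N : ℕ} {n : ℤ} {F : X → ℂ} (hF : Ctl μ T N (sh T n F)) :
    Ctl μ T N F := by
  obtain ⟨t, ht, hH⟩ := hF
  exact ⟨t, ht, fun H => by rw [← G_sh hT]; exact hH H⟩

lemma exists_ctl {t : ℕ} {c : ℝ} (hc : 0 < c) : ∃ N : ℕ, ∀ F : X → ℂ,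
    (∀ H : Par ℕ t, c ≤ G μ T t H F) → Ctl μ T N F := by
  obtain ⟨N, hN⟩ := exists_nat_one_div_lt hc
  refine ⟨max N t, fun F hF => ⟨t, le_max_right _ _, fun H => le_trans ?_ (hF H)⟩⟩
  refine le_trans ?_ hN.le
  gcongr
  exact le_max_left _ _

/-- Comparison of averages over dilated intervals. -/
lemma expect_dilate_le (g : ℤ → ℤ → ℝ) (hg : ∀ h k, 0 ≤ g h k) {β : ℤ} (hβ : β ≠ 0) (H : ℕ) :
    𝔼 h ∈ J (H / β.natAbs), 𝔼 k ∈ J (H / β.natAbs), g (β * h) (β * k) ≤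
      (2 * β.natAbs) ^ 2 * 𝔼 h ∈ J H, 𝔼 k ∈ J H, g h k := by
  have one : ∀ f : ℤ → ℝ, (∀ h, 0 ≤ f h) → 𝔼 h ∈ J (H / β.natAbs), f (β * h) ≤
      (2 * β.natAbs) * 𝔼 h ∈ J H, f h := by
    intro f hf
    have hβ' : 0 < β.natAbs := Int.natAbs_pos.2 hβ
    set L := H / β.natAbs with hL
    have h1 : ∑ h ∈ J L, f (β * h) ≤ ∑ h ∈ J H, f h := by
      rw [← Finset.sum_image (s := J L) (g := fun h => β * h) (f := f)
        (fun a _ b _ hab => mul_left_cancel₀ hβ hab)]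
      refine Finset.sum_le_sum_of_subset_of_nonneg ?_ fun i _ _ => hf i
      intro y hy
      obtain ⟨h, hh, rfl⟩ := Finset.mem_image.1 hy
      simp only [J, Finset.mem_Icc] at hh ⊢
      rw [← abs_le] at hh ⊢
      rw [abs_mul, Int.abs_eq_natAbs β]
      have : (β.natAbs * L : ℕ) ≤ H := Nat.mul_div_le H _
      calc (β.natAbs : ℤ) * |h| ≤ β.natAbs * L := by gcongr
        _ ≤ H := by exact_mod_cast this
    have h2 : ((2 * H + 1 : ℕ) : ℝ) ≤ 2 * β.natAbs * ((2 * L + 1 : ℕ) : ℝ) := by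
      have : H < β.natAbs * (L + 1) := by
        rw [hL]; exact Nat.lt_mul_div_succ H hβ'
      have h3 : 2 * H + 1 ≤ 2 * β.natAbs * (2 * L + 1) := by nlinarith [Nat.zero_le (β.natAbs * L)]
      exact_mod_cast h3
    rw [Finset.expect_eq_sum_div_card, Finset.expect_eq_sum_div_card, card_J, card_J,
      mul_div_assoc', div_le_div_iff₀ (by positivity) (by positivity)]
    have h4 : 0 ≤ ∑ h ∈ J H, f h := Finset.sum_nonneg fun i _ => hf i
    calc (∑ h ∈ J L, f (β * h)) * ((2 * H + 1 : ℕ) : ℝ)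
        ≤ (∑ h ∈ J H, f h) * (2 * β.natAbs * ((2 * L + 1 : ℕ) : ℝ)) := by gcongr
      _ = _ := by ring
  have hn : (0 : ℝ) ≤ 2 * β.natAbs := by positivity
  calc _ ≤ 𝔼 h ∈ J (H / β.natAbs), ((2 * β.natAbs) * 𝔼 k ∈ J H, g (β * h) k) :=
        Finset.expect_le_expect fun h _ => one _ fun k => hg _ _
    _ = (2 * β.natAbs) * 𝔼 h ∈ J (H / β.natAbs), 𝔼 k ∈ J H, g (β * h) k := by
        rw [Finset.mul_expect]
    _ ≤ (2 * β.natAbs) * ((2 * β.natAbs) * 𝔼 h ∈ J H, 𝔼 k ∈ J H, g h k) := by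
        gcongr
        exact one (fun h => 𝔼 k ∈ J H, g h k) fun h => Finset.expect_nonneg fun k _ => hg _ _
    _ = _ := by ring

variable [IsProbabilityMeasure μ]

lemma linear_ctl (hT : Sys μ T) {ι : Type*} (s : Finset ι) : ∀ (a : ℤ) (b : ι → ℤ),
    (∀ i ∈ s, b i ≠ a) → ∀ c > (0 : ℝ), ∃ t : ℕ, ∃ c' > (0 : ℝ), ∀ (M : InvMean) (w : ℤ → ℂ)
    (F : X → ℂ) (f : ι → X → ℂ), (∀ n, ‖w n‖ ≤ 1) → B1 F → (∀ i, B1 (f i)) →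
    c ≤ ‖M.m (fun n => ∫ x, w n * sh T (a * n) F x * ∏ i ∈ s, sh T (b i * n) (f i) x ∂μ)‖ →
    ∀ H : Par ℕ t, c' ≤ G μ T t H F := by
  classical
  induction s using Finset.induction_on with
  | empty =>
    intro a b _ c hc
    refine ⟨0, c ^ 2, by positivity, fun M w F f hw hF hf h H => ?_⟩
    have hb : ∀ n, ‖w n * ∫ x, F x ∂μ‖ ≤ ‖∫ x, F x ∂μ‖ := fun n => by
      rw [norm_mul]; nlinarith [hw n, norm_nonneg (∫ x, F x ∂μ)]
    have e : ∀ n : ℤ, ∫ x, w n * sh T (a * n) F x * ∏ i ∈ (∅ : Finset ι), sh T (b i * n) (f i) x ∂μ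
        = w n * ∫ x, F x ∂μ := fun n => by
      simp only [Finset.prod_empty, mul_one]
      rw [integral_const_mul, hT.integral_sh]
    simp only [e] at h
    simp only [G]
    have := h.trans (M.norm_le _ _ hb)
    gcongr
  | insert j s hj ih =>
    intro a b hab c hc
    set β := a - b j with hβd
    have hβ : β ≠ 0 := sub_ne_zero.2 (hab j (by simp)).symm
    obtain ⟨t, c₁, hc₁, key⟩ := ih β (fun i => b i - b j)
      (fun i hi he => hab i (by simp [hi]) (by simp only [hβd] at he; omega)) (c ^ 2 / 2)
      (by positivity)
    have hβ' : 0 < β.natAbs := Int.natAbs_pos.2 hβ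
    refine ⟨t + 1, c ^ 2 / 2 * c₁ / (2 * β.natAbs) ^ 2, by positivity,
      fun M w F f hw hF hf h H => ?_⟩
    let v : ℤ → X → ℂ := fun n x => w n * sh T (β * n) F x * ∏ i ∈ s, sh T ((b i - b j) * n) (f i) x
    have hv : ∀ n, B1 (v n) := fun n =>
      ((B1.const (hw n)).mul (hT.b1_sh hF _)).mul (B1.prod s fun i _ => hT.b1_sh (hf i) _)
    have e1 : ∀ n : ℤ, ∫ x, w n * sh T (a * n) F x *
        ∏ i ∈ insert j s, sh T (b i * n) (f i) x ∂μ = ∫ x, f j x * v n x ∂μ := by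
      intro n
      rw [← hT.integral_sh (b j * n) (fun x => f j x * v n x)]
      congr 1; ext x
      simp only [sh, v, Finset.prod_insert hj, ← Equiv.Perm.mul_apply, ← zpow_add, hβd]
      have e2 : ∀ y : ℤ, (y - b j) * n + b j * n = y * n := fun y => by ring
      simp only [e2]
      ring
    simp only [e1] at h
    have h2 := vdC (μ := μ) M (hf j) hv (J_nonempty (H.1 / β.natAbs))
    set g : ℤ → ℤ → ℝ := fun h k => G μ T t H.2 (fun x => sh T h F x * conj (sh T k F x)) with hg
    have h3 : ∀ h h' : ℤ, ‖M.m (fun n => ∫ x, v (n + h) x * conj (v (n + h') x) ∂μ)‖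
        ≤ c ^ 2 / 2 + g (β * h) (β * h') / c₁ := by
      intro h h'
      by_contra hcon
      push Not at hcon
      have hg0 : 0 ≤ g (β * h) (β * h') / c₁ := div_nonneg (G_nonneg _ _ _) hc₁.le
      have hk := key M (fun n => w (n + h) * conj (w (n + h')))
        (fun x => sh T (β * h) F x * conj (sh T (β * h') F x))
        (fun i x => sh T ((b i - b j) * h) (f i) x * conj (sh T ((b i - b j) * h') (f i) x))
        (fun n => by
          rw [norm_mul, RCLike.norm_conj]
          exact mul_le_one₀ (hw _) (norm_nonneg _) (hw _))
        ((hT.b1_sh hF _).mul (hT.b1_sh hF _).star)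
        (fun i => (hT.b1_sh (hf i) _).mul (hT.b1_sh (hf i) _).star)
        (by
          have e4 : ∀ n : ℤ, ∫ x, v (n + h) x * conj (v (n + h') x) ∂μ =
            ∫ x, w (n + h) * conj (w (n + h')) *
              sh T (β * n) (fun x => sh T (β * h) F x * conj (sh T (β * h') F x)) x *
              ∏ i ∈ s, sh T ((b i - b j) * n) (fun x => sh T ((b i - b j) * h) (f i) x *
                conj (sh T ((b i - b j) * h') (f i) x)) x ∂μ := by
            intro n
            congr 1; ext x
            have e5 : ∀ y z : ℤ, y * z + y * n = y * (n + z) := fun y z => by ring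
            simp only [v, sh, map_mul, map_prod, Finset.prod_mul_distrib, ← Equiv.Perm.mul_apply,
              ← zpow_add, e5]
            ring
          simp only [e4] at hcon
          linarith)
        H.2
      have : 1 ≤ g (β * h) (β * h') / c₁ := by
        rw [le_div_iff₀ hc₁, one_mul]; exact hk
      have hle : ‖M.m (fun n => ∫ x, v (n + h) x * conj (v (n + h') x) ∂μ)‖ ≤ 1 :=
        M.norm_le _ _ fun n => ((hv _).mul (hv _).star).norm_integral_le μ
      nlinarith [sq_nonneg c]
    have h4 : c ^ 2 ≤ c ^ 2 / 2 + (𝔼 h ∈ J (H.1 / β.natAbs), 𝔼 h' ∈ J (H.1 / β.natAbs),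
        g (β * h) (β * h')) / c₁ := by
      calc c ^ 2 ≤ ‖M.m (fun n => ∫ x, f j x * v n x ∂μ)‖ ^ 2 := by gcongr
        _ ≤ _ := h2
        _ ≤ 𝔼 h ∈ J (H.1 / β.natAbs), 𝔼 h' ∈ J (H.1 / β.natAbs),
            (c ^ 2 / 2 + g (β * h) (β * h') / c₁) :=
          Finset.expect_le_expect fun h _ => Finset.expect_le_expect fun h' _ => h3 h h'
        _ = _ := by
          simp only [Finset.expect_add_distrib, Finset.expect_const (J_nonempty _),
            Finset.expect_div]
    have h5 := expect_dilate_le g (fun _ _ => G_nonneg _ _ _) hβ H.1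
    have h6 : c ^ 2 / 2 * c₁ ≤ 𝔼 h ∈ J (H.1 / β.natAbs), 𝔼 h' ∈ J (H.1 / β.natAbs),
        g (β * h) (β * h') := by
      rw [← le_div_iff₀ hc₁]; linarith
    rw [div_le_iff₀ (by positivity), mul_comm (G μ T (t + 1) H F)]
    exact h6.trans h5

end Box

end

section

open Polynomial

/-- `P` is the restriction to the integers of the rational polynomial `q`. -/
def Rep (q : ℚ[X]) (P : ℤ → ℤ) : Prop := ∀ n : ℤ, q.eval (n : ℚ) = P n

lemma Rep.taylor_sub {q r : ℚ[X]} {P R : ℤ → ℤ} (hq : Rep q P) (hr : Rep r R) (h k : ℤ) :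
    Rep (taylor (h : ℚ) q - taylor (k : ℚ) r) (fun n => P (n + h) - R (n + k)) := by
  intro n
  have h1 := hq (n + h)
  have h2 := hr (n + k)
  push_cast at h1 h2 ⊢
  rw [eval_sub, taylor_eval, taylor_eval, h1, h2]

lemma Rep.const_of_natDegree_eq_zero {q : ℚ[X]} {P : ℤ → ℤ} (hq : Rep q P) (h : q.natDegree = 0)
    (n : ℤ) : P n = P 0 := by
  have h1 := hq n
  have h2 := hq 0
  rw [eq_C_of_natDegree_eq_zero h, eval_C] at h1 h2
  exact_mod_cast h1.symm.trans h2

lemma coeff_taylor_pred {q : ℚ[X]} {d : ℕ} (hd : q.natDegree = d + 1) (r : ℚ) :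
    (taylor r q).coeff d = q.coeff d + (d + 1) * q.leadingCoeff * r := by
  rw [taylor_coeff]
  have h1 : (hasseDeriv d q).natDegree ≤ 1 := (natDegree_hasseDeriv_le q d).trans (by omega)
  rw [eq_X_add_C_of_natDegree_le_one h1]
  simp only [eval_add, eval_mul, eval_C, eval_X, hasseDeriv_coeff, leadingCoeff, hd]
  have h2 : (1 + d).choose d = d + 1 := by rw [add_comm, Nat.choose_succ_self_right]
  rw [h2, zero_add, Nat.choose_self, add_comm 1 d]
  push_cast
  ring

lemma natDegree_taylor_sub_taylor {q : ℚ[X]} {d : ℕ} (hd : q.natDegree = d + 1) {h k : ℚ}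
    (hk : h ≠ k) : d ≤ (taylor h q - taylor k q).natDegree := by
  apply le_natDegree_of_ne_zero
  rw [coeff_sub, coeff_taylor_pred hd, coeff_taylor_pred hd]
  have hl : q.leadingCoeff ≠ 0 := by
    rw [Ne, leadingCoeff_eq_zero]; rintro rfl; simp at hd
  have : q.coeff d + (d + 1) * q.leadingCoeff * h - (q.coeff d + (d + 1) * q.leadingCoeff * k)
      = (d + 1) * q.leadingCoeff * (h - k) := by ring
  rw [this]
  exact mul_ne_zero (mul_ne_zero (by positivity) hl) (sub_ne_zero.2 hk)

lemma lead_sub_of_lt {p r : ℚ[X]} (h : r.natDegree < p.natDegree) :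
    (p - r).natDegree = p.natDegree ∧ (p - r).leadingCoeff = p.leadingCoeff :=
  ⟨natDegree_sub_eq_left_of_natDegree_lt h,
    leadingCoeff_sub_of_degree_lt (degree_lt_degree h)⟩

lemma lead_sub_of_ne {p r : ℚ[X]} (h : r.natDegree = p.natDegree)
    (hl : p.leadingCoeff ≠ r.leadingCoeff) :
    (p - r).natDegree = p.natDegree ∧ (p - r).leadingCoeff = p.leadingCoeff - r.leadingCoeff := by
  have hc : (p - r).coeff p.natDegree = p.leadingCoeff - r.leadingCoeff := by
    rw [coeff_sub, leadingCoeff, leadingCoeff, h]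
  have hd : (p - r).natDegree = p.natDegree := by
    refine le_antisymm ((natDegree_sub_le _ _).trans (by simp [h])) (le_natDegree_of_ne_zero ?_)
    rw [hc]; exact sub_ne_zero.2 hl
  exact ⟨hd, by rw [leadingCoeff, hd, hc]⟩

lemma natDegree_sub_lt_of_eq {p r : ℚ[X]} (h : r.natDegree = p.natDegree) (h0 : 0 < p.natDegree)
    (hl : p.leadingCoeff = r.leadingCoeff) : (p - r).natDegree < p.natDegree := by
  by_cases h1 : p - r = 0
  · simpa [h1] using h0
  · refine natDegree_lt_natDegree h1 (degree_sub_lt_left ?_ ?_ hl)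
    · rw [degree_eq_natDegree, degree_eq_natDegree, h] <;> rintro rfl <;> simp_all
    · rintro rfl; simp at h0

/-- the set of leading coefficients of the members of given degree. -/
noncomputable def leads {ι : Type} (s : Finset ι) (q : ι → ℚ[X]) (j : ℕ) : Finset ℚ :=
  (s.filter fun i => (q i).natDegree = j).image fun i => (q i).leadingCoeff

/-- the weight of a family of polynomials. -/
noncomputable def weight (D : ℕ) {ι : Type} (s : Finset ι) (q : ι → ℚ[X]) :
    Lex (Fin (D + 1) → ℕ) := toLex fun j => (leads s q (D - j)).card

lemma mem_leads {ι : Type} {s : Finset ι} {q : ι → ℚ[X]} {j : ℕ} {a : ℚ} :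
    a ∈ leads s q j ↔ ∃ i ∈ s, (q i).natDegree = j ∧ (q i).leadingCoeff = a := by
  simp [leads, and_assoc]

lemma weight_lt {D : ℕ} {ι κ : Type} {s : Finset ι} {q : ι → ℚ[X]} {s' : Finset κ} {q' : κ → ℚ[X]}
    {e : ℕ} (he : e ≤ D) (h1 : ∀ j, e < j → leads s' q' j = leads s q j)
    (h2 : (leads s' q' e).card < (leads s q e).card) : weight D s' q' < weight D s q := by
  refine ⟨⟨D - e, by omega⟩, fun j hj => ?_, ?_⟩
  · change (leads s' q' (D - j)).card = (leads s q (D - j)).card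
    rw [h1]
    have : (j : ℕ) < D - e := hj
    omega
  · change (leads s' q' (D - (D - e))).card < (leads s q (D - (D - e))).card
    rwa [Nat.sub_sub_self he]

section Pivot

variable {ι : Type} (s : Finset ι) (q : ι → ℚ[X])

/-- the van der Corput family associated to a pivot and two shifts. -/
noncomputable def vfam (i₀ : ι) (h k : ℤ) (p : ι × Bool) : ℚ[X] :=
  taylor (((if p.2 then k else h : ℤ)) : ℚ) (q p.1) - taylor (k : ℚ) (q i₀)

variable {s q} {i₀ : ι}

lemma vfam_of_lt {h k : ℤ} {p : ι × Bool} (hp : (q i₀).natDegree < (q p.1).natDegree) :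
    (vfam q i₀ h k p).natDegree = (q p.1).natDegree ∧
      (vfam q i₀ h k p).leadingCoeff = (q p.1).leadingCoeff := by
  have := lead_sub_of_lt (p := taylor (((if p.2 then k else h : ℤ)) : ℚ) (q p.1))
    (r := taylor (k : ℚ) (q i₀)) (by simpa using hp)
  simpa [vfam] using this

lemma vfam_of_ne {h k : ℤ} {p : ι × Bool} (hp : (q i₀).natDegree = (q p.1).natDegree)
    (hl : (q p.1).leadingCoeff ≠ (q i₀).leadingCoeff) :
    (vfam q i₀ h k p).natDegree = (q p.1).natDegree ∧
      (vfam q i₀ h k p).leadingCoeff = (q p.1).leadingCoeff - (q i₀).leadingCoeff := by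
  have := lead_sub_of_ne (p := taylor (((if p.2 then k else h : ℤ)) : ℚ) (q p.1))
    (r := taylor (k : ℚ) (q i₀)) (by simpa using hp) (by simpa using hl)
  simpa [vfam] using this

lemma vfam_of_eq {h k : ℤ} {p : ι × Bool} (hp : (q i₀).natDegree = (q p.1).natDegree)
    (hpos : 0 < (q i₀).natDegree)
    (hl : (q p.1).leadingCoeff = (q i₀).leadingCoeff) :
    (vfam q i₀ h k p).natDegree < (q p.1).natDegree := by
  have := natDegree_sub_lt_of_eq (p := taylor (((if p.2 then k else h : ℤ)) : ℚ) (q p.1))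
    (r := taylor (k : ℚ) (q i₀)) (by simpa using hp) (by simpa [← hp] using hpos)
    (by simpa using hl)
  simpa [vfam] using this

lemma vfam_le {h k : ℤ} {p : ι × Bool} (hp : (q i₀).natDegree ≤ (q p.1).natDegree)
    (hpos : 0 < (q i₀).natDegree) :
    (vfam q i₀ h k p).natDegree ≤ (q p.1).natDegree := by
  rcases hp.lt_or_eq with h1 | h1
  · exact (vfam_of_lt h1).1.le
  · by_cases hl : (q p.1).leadingCoeff = (q i₀).leadingCoeff
    · exact (vfam_of_eq h1 hpos hl).le
    · exact (vfam_of_ne h1 hl).1.le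

lemma weight_vfam_lt {D : ℕ} (hD : ∀ i ∈ s, (q i).natDegree ≤ D) (hi₀ : i₀ ∈ s)
    (hmin : ∀ i ∈ s, (q i₀).natDegree ≤ (q i).natDegree) (hpos : 0 < (q i₀).natDegree) (h k : ℤ) :
    weight D ((s ×ˢ (univ : Finset Bool)).filter fun p => 0 < (vfam q i₀ h k p).natDegree)
      (vfam q i₀ h k) < weight D s q := by
  refine weight_lt (hD i₀ hi₀) (fun j hj => ?_) ?_
  · ext a
    simp only [mem_leads, mem_filter, mem_product, mem_univ, and_true]
    constructor
    · rintro ⟨p, ⟨hp, -⟩, hd, ha⟩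
      have hlt : (q i₀).natDegree < (q p.1).natDegree :=
        (hj.trans_eq hd.symm).trans_le (vfam_le (hmin _ hp) hpos)
      obtain ⟨h1, h2⟩ := vfam_of_lt (h := h) (k := k) hlt
      exact ⟨p.1, hp, h1 ▸ hd, h2 ▸ ha⟩
    · rintro ⟨i, hi, hd, ha⟩
      obtain ⟨h1, h2⟩ := vfam_of_lt (q := q) (i₀ := i₀) (h := h) (k := k) (p := (i, false))
        (by simpa [hd] using hj)
      refine ⟨(i, false), ⟨hi, ?_⟩, h1.trans hd, h2.trans ha⟩
      rw [h1]; simp only [hd]; omega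
  · refine lt_of_le_of_lt (b := (((leads s q (q i₀).natDegree).erase (q i₀).leadingCoeff).image
      fun x => x - (q i₀).leadingCoeff).card) (Finset.card_le_card ?_)
      (lt_of_le_of_lt Finset.card_image_le (Finset.card_erase_lt_of_mem
        (mem_leads.2 ⟨i₀, hi₀, rfl, rfl⟩)))
    intro a ha
    simp only [mem_leads, mem_filter, mem_product, mem_univ, and_true] at ha
    obtain ⟨p, ⟨hp, -⟩, hd, ha⟩ := ha
    have heq : (q i₀).natDegree = (q p.1).natDegree := by
      refine le_antisymm (hmin _ hp) (not_lt.1 fun hlt => ?_)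
      have := (vfam_of_lt (h := h) (k := k) hlt).1
      omega
    have hne : (q p.1).leadingCoeff ≠ (q i₀).leadingCoeff := fun hl => by
      have := vfam_of_eq (h := h) (k := k) heq hpos hl
      omega
    obtain ⟨h1, h2⟩ := vfam_of_ne (h := h) (k := k) heq hne
    refine Finset.mem_image.2 ⟨(q p.1).leadingCoeff, Finset.mem_erase.2 ⟨hne, ?_⟩, ?_⟩
    · exact mem_leads.2 ⟨p.1, hp, heq.symm, rfl⟩
    · rw [← h2, ha]

/-- Existence of a pivot making the distinguished member of the new family of maximal degree. -/
lemma exists_pivot {i₁ : ι} (hi₁ : i₁ ∈ s) (hmax : ∀ i ∈ s, (q i).natDegree ≤ (q i₁).natDegree)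
    (hp0 : ∀ i ∈ s, 0 < (q i).natDegree) :
    ∃ i₀ ∈ s, (∀ i ∈ s, (q i₀).natDegree ≤ (q i).natDegree) ∧ ∀ h k : ℤ, h ≠ k →
      ∀ p : ι × Bool, p.1 ∈ s →
        (vfam q i₀ h k p).natDegree ≤ (vfam q i₀ h k (i₁, false)).natDegree := by
  obtain ⟨m, hm, hmin⟩ := Finset.exists_min_image s (fun i => (q i).natDegree) ⟨i₁, hi₁⟩
  by_cases hlt : (q m).natDegree < (q i₁).natDegree
  · refine ⟨m, hm, hmin, fun h k _ p hp => ?_⟩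
    rw [(vfam_of_lt (q := q) (p := (i₁, false)) hlt).1]
    exact (vfam_le (hmin _ hp) (hp0 _ hm)).trans (hmax _ hp)
  · have hall : ∀ i ∈ s, (q i).natDegree = (q i₁).natDegree := fun i hi =>
      le_antisymm (hmax i hi) ((not_lt.1 hlt).trans (hmin i hi))
    by_cases hl : ∃ i ∈ s, (q i₁).leadingCoeff ≠ (q i).leadingCoeff
    · obtain ⟨i, hi, hne⟩ := hl
      refine ⟨i, hi, fun i' hi' => by rw [hall i hi, hall i' hi'], fun h k _ p hp => ?_⟩
      rw [(vfam_of_ne (q := q) (p := (i₁, false)) (hall i hi) hne).1]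
      exact (vfam_le (by rw [hall i hi, hall _ hp]) (hp0 _ hi)).trans (hmax _ hp)
    · push Not at hl
      refine ⟨i₁, hi₁, fun i hi => by rw [hall i hi], fun h k hk p hp => ?_⟩
      obtain ⟨d, hd⟩ := Nat.exists_eq_succ_of_ne_zero (hp0 _ hi₁).ne'
      have h1 := natDegree_taylor_sub_taylor hd (h := h) (k := k) (by exact_mod_cast hk)
      have h2 := vfam_of_eq (q := q) (h := h) (k := k) (p := p) (hall _ hp).symm (hp0 _ hi₁)
        (hl _ hp).symm
      rw [hall _ hp, hd] at h2
      refine (Nat.lt_succ_iff.1 h2).trans ?_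
      simpa [vfam] using h1

end Pivot

end

section

open Polynomial

section PET
variable {X : Type*} [MeasurableSpace X] {μ : Measure X} [IsProbabilityMeasure μ]
  {T : Equiv.Perm X}

lemma exists_sup {ι : Type*} (s : Finset ι) (p : ι → ℕ → Prop)
    (hmono : ∀ i m n, m ≤ n → p i m → p i n) (h : ∀ i ∈ s, ∃ n, p i n) : ∃ n, ∀ i ∈ s, p i n := by
  choose! f hf using h
  exact ⟨s.sup f, fun i hi => hmono _ _ _ (Finset.le_sup hi) (hf i hi)⟩

lemma pet_linear (hT : Sys μ T) {ι : Type} (s : Finset ι) (q : ι → ℚ[X]) (P : ι → ℤ → ℤ) (i₁ : ι)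
    (hi₁ : i₁ ∈ s) (hrep : ∀ i ∈ s, Rep (q i) (P i)) (hpos : ∀ i ∈ s, 0 < (q i).natDegree)
    (hdeg : ∀ i ∈ s, (q i).natDegree ≤ 1)
    (hne : ∀ i ∈ s, i ≠ i₁ → 0 < (q i₁ - q i).natDegree) (c : ℝ) (hc : 0 < c) :
    ∃ N : ℕ, ∀ (M : InvMean) (w : ℤ → ℂ) (f₀ : X → ℂ) (f : ι → X → ℂ), (∀ n, ‖w n‖ ≤ 1) →
      B1 f₀ → (∀ i, B1 (f i)) →
      c ≤ ‖M.m (fun n => ∫ x, w n * f₀ x * ∏ i ∈ s, sh T (P i n) (f i) x ∂μ)‖ →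
      Ctl μ T N (f i₁) := by
  classical
  set b : ι → ℤ := fun i => P i 1 - P i 0 with hb
  have hlin : ∀ i ∈ s, ∃ u v : ℚ, q i = C u * Polynomial.X + C v := fun i hi =>
    exists_eq_X_add_C_of_natDegree_le_one (hdeg i hi)
  have hPb : ∀ i ∈ s, ∀ n : ℤ, P i n = b i * n + P i 0 := by
    intro i hi n
    obtain ⟨u, v, huv⟩ := hlin i hi
    have h0 := hrep i hi 0
    have h1 := hrep i hi 1
    have hn := hrep i hi n
    rw [huv] at h0 h1 hn
    simp at h0 h1 hn
    have : ((P i n : ℤ) : ℚ) = ((b i * n + P i 0 : ℤ) : ℚ) := by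
      rw [hb]; push_cast; rw [← hn, ← h1, ← h0]; ring
    exact_mod_cast this
  have hqb : ∀ i ∈ s, ∃ v : ℚ, q i = C (b i : ℚ) * Polynomial.X + C v := by
    intro i hi
    obtain ⟨u, v, huv⟩ := hlin i hi
    have h0 := hrep i hi 0
    have h1 := hrep i hi 1
    rw [huv] at h0 h1
    simp at h0 h1
    refine ⟨v, ?_⟩
    rw [huv, hb]; push_cast; rw [← h1, ← h0]; congr 3; ring
  have hb0 : b i₁ ≠ 0 := by
    intro h0
    obtain ⟨v, hv⟩ := hqb i₁ hi₁
    have := hpos i₁ hi₁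
    rw [hv, h0] at this
    simp at this
  have hbne : ∀ i ∈ s, i ≠ i₁ → b i ≠ b i₁ := by
    intro i hi hii h0
    obtain ⟨v, hv⟩ := hqb i₁ hi₁
    obtain ⟨v', hv'⟩ := hqb i hi
    have := hne i hi hii
    rw [hv, hv', h0, add_sub_add_left_eq_sub, ← C_sub] at this
    simp at this
  obtain ⟨t, c', hc', key⟩ := linear_ctl hT (Finset.insertNone (s.erase i₁)) (b i₁)
    (fun o => o.elim 0 b) (by
      intro o ho
      cases o with
      | none => exact hb0.symm
      | some i =>
        simp only [Finset.some_mem_insertNone, Finset.mem_erase] at ho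
        exact hbne i ho.2 ho.1) c hc
  obtain ⟨N, hN⟩ := exists_ctl (μ := μ) (T := T) (t := t) hc'
  refine ⟨N, fun M w f₀ f hw hf₀ hf h => ?_⟩
  refine Ctl.sh hT (n := P i₁ 0) (hN _ (key M w (sh T (P i₁ 0) (f i₁))
    (fun o => o.elim f₀ fun i => sh T (P i 0) (f i)) hw (hT.b1_sh (hf _) _) ?_ ?_))
  · intro o
    cases o with
    | none => exact hf₀
    | some i => exact hT.b1_sh (hf _) _
  · convert h using 4 with n
    congr 1; ext x
    rw [Finset.prod_insertNone]
    have e : ∀ i ∈ s, sh T (P i n) (f i) x = sh T (b i * n) (sh T (P i 0) (f i)) x := fun i hi => by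
      rw [sh_sh, hPb i hi, add_comm]
    rw [← Finset.mul_prod_erase s _ hi₁, e i₁ hi₁,
      Finset.prod_congr rfl fun i hi => e i (Finset.mem_of_mem_erase hi)]
    simp only [Option.elim, zero_mul, sh_zero]
    ring

lemma pet_aux (hT : Sys μ T) (D : ℕ) (W : Lex (Fin (D + 1) → ℕ)) : ∀ {ι : Type} (s : Finset ι)
    (q : ι → ℚ[X]) (P : ι → ℤ → ℤ) (i₁ : ι), weight D s q = W → i₁ ∈ s →
    (∀ i ∈ s, Rep (q i) (P i)) → (∀ i ∈ s, 0 < (q i).natDegree) → (∀ i ∈ s, (q i).natDegree ≤ D) →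
    (∀ i ∈ s, (q i).natDegree ≤ (q i₁).natDegree) →
    (∀ i ∈ s, i ≠ i₁ → 0 < (q i₁ - q i).natDegree) → ∀ c > (0 : ℝ),
    ∃ N : ℕ, ∀ (M : InvMean) (w : ℤ → ℂ) (f₀ : X → ℂ) (f : ι → X → ℂ), (∀ n, ‖w n‖ ≤ 1) →
      B1 f₀ → (∀ i, B1 (f i)) →
      c ≤ ‖M.m (fun n => ∫ x, w n * f₀ x * ∏ i ∈ s, sh T (P i n) (f i) x ∂μ)‖ →
      Ctl μ T N (f i₁) := by
  classical
  induction W using WellFoundedLT.induction with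
  | ind W ih =>
  intro ι s q P i₁ hW hi₁ hrep hpos hD hmax hne c hc
  by_cases hd1 : (q i₁).natDegree ≤ 1
  · exact pet_linear hT s q P i₁ hi₁ hrep hpos (fun i hi => (hmax i hi).trans hd1) hne c hc
  push Not at hd1
  obtain ⟨i₀, hi₀, hmin, hpiv⟩ := exists_pivot hi₁ hmax hpos
  obtain ⟨d, hd⟩ := Nat.exists_eq_succ_of_ne_zero (hpos _ hi₁).ne'
  obtain ⟨Good, hGood⟩ : ∃ Good : ℤ → ℤ → Prop, ∀ h k, Good h k ↔
    ∀ i ∈ s, 0 < (taylor (h : ℚ) (q i₁) - taylor (k : ℚ) (q i)).natDegree :=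
    ⟨_, fun _ _ => Iff.rfl⟩
  have hbad : ∀ (k : ℤ), ∀ i ∈ s, ∀ h h' : ℤ,
      (taylor (h : ℚ) (q i₁) - taylor (k : ℚ) (q i)).natDegree = 0 →
      (taylor (h' : ℚ) (q i₁) - taylor (k : ℚ) (q i)).natDegree = 0 → h = h' := by
    intro k i _ h h' h1 h2
    by_contra hcon
    have h3 := natDegree_taylor_sub_taylor hd (h := h) (k := h') (by exact_mod_cast hcon)
    have h4 := natDegree_sub_le (taylor (h : ℚ) (q i₁) - taylor (k : ℚ) (q i))
      (taylor (h' : ℚ) (q i₁) - taylor (k : ℚ) (q i))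
    rw [sub_sub_sub_cancel_right, h1, h2] at h4
    simp at h4
    omega
  have hbadcard : ∀ (k : ℤ) (B : Finset ℤ), (B.filter fun h => ¬ Good h k).card ≤ s.card := by
    intro k B
    have : (B.filter fun h => ¬ Good h k) ⊆ s.biUnion fun i => B.filter fun h =>
        (taylor (h : ℚ) (q i₁) - taylor (k : ℚ) (q i)).natDegree = 0 := by
      intro h hh
      simp only [hGood, Finset.mem_filter, not_forall] at hh
      obtain ⟨hB, i, hi, h0⟩ := hh
      simp only [Finset.mem_biUnion, Finset.mem_filter]
      exact ⟨i, hi, hB, by omega⟩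
    refine (Finset.card_le_card this).trans (Finset.card_biUnion_le.trans ?_)
    calc _ ≤ ∑ i ∈ s, 1 := Finset.sum_le_sum fun i hi => Finset.card_le_one.2 fun a ha b hb =>
          hbad k i hi a b (Finset.mem_filter.1 ha).2 (Finset.mem_filter.1 hb).2
      _ = s.card := by simp
  -- the inductive hypothesis for good pairs
  have hstep : ∀ h k : ℤ, Good h k → ∃ N : ℕ, ∀ (M : InvMean) (w : ℤ → ℂ) (f₀ : X → ℂ)
      (f : ι → X → ℂ), (∀ n, ‖w n‖ ≤ 1) → B1 f₀ → (∀ i, B1 (f i)) →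
      c ^ 2 / 2 ≤ ‖M.m (fun n => ∫ x, (w (n + h) * ∏ i ∈ s, sh T (P i (n + h)) (f i) x) *
        conj (w (n + k) * ∏ i ∈ s, sh T (P i (n + k)) (f i) x) ∂μ)‖ → Ctl μ T N (f i₁) := by
    intro h k hgood
    rw [hGood] at hgood
    set q' := vfam q i₀ h k with hq'
    set P' : ι × Bool → ℤ → ℤ := fun p n => P p.1 (n + (if p.2 then k else h)) - P i₀ (n + k) with hP'
    set s' := (s ×ˢ (univ : Finset Bool)).filter fun p => 0 < (q' p).natDegree with hs'
    have hrep' : ∀ p : ι × Bool, p.1 ∈ s → Rep (q' p) (P' p) := fun p hp =>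
      (hrep _ hp).taylor_sub (hrep _ hi₀) _ _
    have hmem : ∀ p ∈ s', p.1 ∈ s := fun p hp => by
      simp only [hs', Finset.mem_filter, Finset.mem_product] at hp; exact hp.1.1
    have hhk : h ≠ k := by
      rintro rfl
      have := hgood i₁ hi₁
      simp at this
    obtain ⟨N, hN⟩ := ih _ (hW ▸ weight_vfam_lt hD hi₀ hmin (hpos _ hi₀) h k) s' q' P' (i₁, false)
      rfl (by
        simp only [hs', Finset.mem_filter, Finset.mem_product, Finset.mem_univ, and_true, hi₁,
          true_and]
        simpa [hq', vfam] using hgood i₀ hi₀)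
      (fun p hp => hrep' p (hmem p hp))
      (fun p hp => (Finset.mem_filter.1 hp).2)
      (fun p hp => (vfam_le (hmin _ (hmem p hp)) (hpos _ hi₀)).trans (hD _ (hmem p hp)))
      (fun p hp => hpiv h k hhk p (hmem p hp))
      (by
        rintro ⟨i, b⟩ hp hpne
        have hi : i ∈ s := hmem _ hp
        have e : q' (i₁, false) - q' (i, b) =
            taylor (h : ℚ) (q i₁) - taylor ((if b then k else h : ℤ) : ℚ) (q i) := by
          simp [hq', vfam]
        rw [e]
        cases b with
        | true => simpa using hgood i hi
        | false =>
          have hii : i ≠ i₁ := fun hh => hpne (by rw [hh])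
          have := hne i hi hii
          simp only [Bool.false_eq_true, if_false]
          rw [← map_sub, natDegree_taylor]; exact this)
      (c ^ 2 / 2) (by positivity)
    refine ⟨N, fun M w f₀ f hw hf₀ hf hle => ?_⟩
    let f' : ι × Bool → X → ℂ := fun p => if p.2 then fun x => conj (f p.1 x) else f p.1
    have hf' : ∀ p, B1 (f' p) := by
      rintro ⟨i, b⟩
      cases b with
      | true => exact (hf i).star
      | false => exact hf i
    refine hN M (fun n => w (n + h) * conj (w (n + k)))
      (fun x => ∏ p ∈ (s ×ˢ (univ : Finset Bool)).filter fun p => ¬ 0 < (q' p).natDegree,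
        sh T (P' p 0) (f' p) x) f' (fun n => ?_) (B1.prod _ fun p _ => hT.b1_sh (hf' p) _) hf' ?_
    · rw [norm_mul, RCLike.norm_conj]
      exact mul_le_one₀ (hw _) (norm_nonneg _) (hw _)
    · refine hle.trans_eq ?_
      congr 2; ext n
      rw [← hT.integral_sh (-P i₀ (n + k))]
      congr 1; ext x
      have e1 : (∏ p ∈ (s ×ˢ (univ : Finset Bool)).filter (fun p => ¬ 0 < (q' p).natDegree),
          sh T (P' p 0) (f' p) x) = ∏ p ∈ (s ×ˢ (univ : Finset Bool)).filter
            (fun p => ¬ 0 < (q' p).natDegree), sh T (P' p n) (f' p) x := by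
        refine Finset.prod_congr rfl fun p hp => ?_
        simp only [Finset.mem_filter, Finset.mem_product, Finset.mem_univ, and_true, not_lt,
          nonpos_iff_eq_zero] at hp
        rw [(hrep' p hp.1).const_of_natDegree_eq_zero hp.2 n]
      rw [e1, mul_assoc, mul_comm (∏ p ∈ _, _), hs', Finset.prod_filter_mul_prod_filter_not,
        Finset.prod_product]
      simp only [Fintype.prod_bool, f', hP', sh, map_mul, map_prod, if_true, Bool.false_eq_true,
        if_false, ← Equiv.Perm.mul_apply, ← zpow_add, Finset.prod_mul_distrib, ← sub_eq_add_neg]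
      ring
  -- choose the shifts
  obtain ⟨H₀, hH₀⟩ := exists_nat_gt (2 * s.card / c ^ 2)
  set B : Finset ℤ := Finset.Icc 1 (H₀ : ℤ) with hB
  have hBc : B.card = H₀ := by simp [hB]
  have hH0pos : 0 < H₀ := by
    have : (0 : ℝ) < H₀ := lt_of_le_of_lt (by positivity) hH₀
    exact_mod_cast this
  have hBne : B.Nonempty := Finset.card_pos.1 (hBc ▸ hH0pos)
  obtain ⟨N, hN⟩ := exists_sup ((B ×ˢ B).filter fun p => Good p.1 p.2)
    (fun p N => ∀ (M : InvMean) (w : ℤ → ℂ) (f₀ : X → ℂ)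
      (f : ι → X → ℂ), (∀ n, ‖w n‖ ≤ 1) → B1 f₀ → (∀ i, B1 (f i)) →
      c ^ 2 / 2 ≤ ‖M.m (fun n => ∫ x, (w (n + p.1) * ∏ i ∈ s, sh T (P i (n + p.1)) (f i) x) *
        conj (w (n + p.2) * ∏ i ∈ s, sh T (P i (n + p.2)) (f i) x) ∂μ)‖ → Ctl μ T N (f i₁))
    (fun p m n hmn hm M w f₀ f h1 h2 h3 h4 => (hm M w f₀ f h1 h2 h3 h4).mono hmn)
    (fun p hp => by
      have hp' := (Finset.mem_filter.1 hp).2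
      exact hstep p.1 p.2 hp')
  refine ⟨N, fun M w f₀ f hw hf₀ hf hle => ?_⟩
  let v : ℤ → X → ℂ := fun n x => w n * ∏ i ∈ s, sh T (P i n) (f i) x
  have hv : ∀ n, B1 (v n) := fun n =>
    (B1.const (hw n)).mul (B1.prod s fun i _ => hT.b1_sh (hf i) _)
  have e2 : ∀ n, ∫ x, w n * f₀ x * ∏ i ∈ s, sh T (P i n) (f i) x ∂μ = ∫ x, f₀ x * v n x ∂μ := by
    intro n; congr 1; ext x; simp only [v]; ring
  simp only [e2] at hle
  have h1 := vdC (μ := μ) M hf₀ hv hBne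
  set a : ℤ → ℤ → ℝ := fun h k => ‖M.m (fun n => ∫ x, v (n + h) x * conj (v (n + k) x) ∂μ)‖ with ha
  have ha1 : ∀ h k, a h k ≤ 1 := fun h k =>
    M.norm_le _ _ fun n => ((hv _).mul (hv _).star).norm_integral_le μ
  by_contra hcon
  have hsmall : ∀ h ∈ B, ∀ k ∈ B, Good h k → a h k < c ^ 2 / 2 := by
    intro h hh k hk hg
    by_contra h2
    push Not at h2
    have h9 := hN (h, k) (Finset.mem_filter.2 ⟨Finset.mem_product.2 ⟨hh, hk⟩, hg⟩) M w f₀ f hw hf₀ hf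
    simp only [ha, v] at h2
    exact hcon (h9 h2)
  have h3 : ∀ k ∈ B, 𝔼 h ∈ B, a h k < c ^ 2 := by
    intro k hk
    rw [Finset.expect_eq_sum_div_card, div_lt_iff₀ (by exact_mod_cast hBc ▸ hH0pos),
      ← Finset.sum_filter_add_sum_filter_not B (fun h => Good h k)]
    have h4 : ∑ h ∈ B.filter (fun h => Good h k), a h k ≤ c ^ 2 / 2 * B.card := by
      calc _ ≤ ∑ h ∈ B.filter (fun h => Good h k), c ^ 2 / 2 := Finset.sum_le_sum fun h hh =>
            (hsmall h (Finset.mem_filter.1 hh).1 k hk (Finset.mem_filter.1 hh).2).le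
        _ = c ^ 2 / 2 * (B.filter (fun h => Good h k)).card := by simp [mul_comm]
        _ ≤ _ := by gcongr; exact Finset.filter_subset _ _
    have h5 : ∑ h ∈ B.filter (fun h => ¬ Good h k), a h k ≤ s.card := by
      calc _ ≤ ∑ h ∈ B.filter (fun h => ¬ Good h k), (1 : ℝ) :=
            Finset.sum_le_sum fun h _ => ha1 _ _
        _ = (B.filter (fun h => ¬ Good h k)).card := by simp
        _ ≤ _ := by exact_mod_cast hbadcard k B
    have h6 : (s.card : ℝ) < c ^ 2 / 2 * B.card := by
      rw [hBc]
      rw [div_lt_iff₀ (by positivity)] at hH₀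
      linarith
    linarith
  rw [Finset.expect_comm] at h1
  have h7 : 𝔼 k ∈ B, 𝔼 h ∈ B, a h k < c ^ 2 := by
    by_contra h10
    obtain ⟨k, hk, hlt⟩ := Finset.exists_le_of_le_expect hBne (not_lt.1 h10)
    exact (h3 k hk).not_ge hlt
  have h8 : c ^ 2 ≤ ‖M.m (fun n => ∫ x, f₀ x * v n x ∂μ)‖ ^ 2 := by gcongr
  linarith

/-- The PET bound: polynomial averages are controlled by a box norm of a function attached to a
polynomial of maximal degree. -/
lemma pet (hT : Sys μ T) {ι : Type} (s : Finset ι) (q : ι → ℚ[X]) (P : ι → ℤ → ℤ) (i₁ : ι)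
    (hi₁ : i₁ ∈ s) (hrep : ∀ i ∈ s, Rep (q i) (P i)) (hpos : ∀ i ∈ s, 0 < (q i).natDegree)
    (hmax : ∀ i ∈ s, (q i).natDegree ≤ (q i₁).natDegree)
    (hne : ∀ i ∈ s, i ≠ i₁ → 0 < (q i₁ - q i).natDegree) (c : ℝ) (hc : 0 < c) :
    ∃ N : ℕ, ∀ (M : InvMean) (w : ℤ → ℂ) (f₀ : X → ℂ) (f : ι → X → ℂ), (∀ n, ‖w n‖ ≤ 1) →
      B1 f₀ → (∀ i, B1 (f i)) →
      c ≤ ‖M.m (fun n => ∫ x, w n * f₀ x * ∏ i ∈ s, sh T (P i n) (f i) x ∂μ)‖ →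
      Ctl μ T N (f i₁) :=
  pet_aux hT (q i₁).natDegree _ s q P i₁ rfl hi₁ hrep hpos hmax hmax hne c hc

end PET

end

section

/-- Boxes of integer tuples. -/
noncomputable def bx : (t : ℕ) → Par ℕ t → Finset (Par ℤ t)
  | 0, _ => {()}
  | t + 1, H => (J H.1 ×ˢ bx t H.2 : Finset (ℤ × Par ℤ t))

/-- The sum of the coordinates of a tuple. -/
def su : (t : ℕ) → Par ℤ t → ℤ
  | 0, _ => 0
  | t + 1, u => u.1 + su t u.2

/-- Alternating products over the vertices of a cube. -/
noncomputable def cube : (t : ℕ) → (Par ℤ t → ℂ) → Par ℤ t → Par ℤ t → ℂ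
  | 0, a, _, _ => a ()
  | t + 1, a, h, k => cube t (fun u => a (h.1, u) * conj (a (k.1, u))) h.2 k.2

lemma bx_nonempty (t : ℕ) (H : Par ℕ t) : (bx t H).Nonempty := by
  induction t with
  | zero => exact ⟨(), Finset.mem_singleton_self _⟩
  | succ t ih => exact (J_nonempty H.1).product (ih H.2)

lemma expect_bx_zero {E : Type*} [AddCommMonoid E] [Module ℚ≥0 E] (H : Par ℕ 0)
    (f : Par ℤ 0 → E) : 𝔼 u ∈ bx 0 H, f u = f () := by
  change 𝔼 u ∈ ({()} : Finset (Par ℤ 0)), f u = f ()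
  exact Finset.expect_singleton _ _

lemma expect_bx_succ {E : Type*} [AddCommMonoid E] [Module ℚ≥0 E] (t : ℕ) (H : Par ℕ (t + 1))
    (f : Par ℤ (t + 1) → E) :
    𝔼 u ∈ bx (t + 1) H, f u = 𝔼 h ∈ J H.1, 𝔼 u ∈ bx t H.2, f ((h, u) : ℤ × Par ℤ t) := by
  change 𝔼 u ∈ (J H.1 ×ˢ bx t H.2 : Finset (ℤ × Par ℤ t)), f u = _
  exact Finset.expect_product (J H.1) (bx t H.2) (fun u : ℤ × Par ℤ t => f u)

lemma cube_mul (t : ℕ) (a b : Par ℤ t → ℂ) (h k : Par ℤ t) :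
    cube t (fun u => a u * b u) h k = cube t a h k * cube t b h k := by
  induction t with
  | zero => rfl
  | succ t ih =>
    simp only [cube, map_mul]
    rw [← ih]
    congr 1; ext u; ring

lemma cube_star (t : ℕ) (a : Par ℤ t → ℂ) (h k : Par ℤ t) :
    cube t (fun u => conj (a u)) h k = conj (cube t a h k) := by
  induction t with
  | zero => rfl
  | succ t ih => simp only [cube, ← ih, map_mul]

lemma cube_const (t : ℕ) {c : ℂ} (hc : ‖c‖ = 1) (h k : Par ℤ (t + 1)) :
    cube (t + 1) (fun _ => c) h k = 1 := by
  have : c * conj c = 1 := by rw [Complex.mul_conj, Complex.normSq_eq_norm_sq, hc]; simp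
  simp only [cube, this]
  have aux : ∀ (t : ℕ) (h k : Par ℤ t), cube t (fun _ => 1) h k = 1 := by
    intro t
    induction t with
    | zero => intros; rfl
    | succ t ih => intro h k; simp [cube, ih]
  exact aux _ _ _

lemma norm_cube_le (t : ℕ) (a : Par ℤ t → ℂ) (ha : ∀ u, ‖a u‖ ≤ 1) (h k : Par ℤ t) :
    ‖cube t a h k‖ ≤ 1 := by
  induction t with
  | zero => exact ha _
  | succ t ih =>
    refine ih _ (fun u => ?_) _ _
    rw [norm_mul, RCLike.norm_conj]
    exact mul_le_one₀ (ha _) (norm_nonneg _) (ha _)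

section Measurable
variable {X : Type*} [MeasurableSpace X]

lemma B1.cube {t : ℕ} {a : Par ℤ t → X → ℂ} (ha : ∀ u, B1 (a u)) (h k : Par ℤ t) :
    B1 (fun x => cube t (fun u => a u x) h k) := by
  induction t with
  | zero => exact ha _
  | succ t ih =>
    have := ih (a := fun u x => a (h.1, u) x * conj (a (k.1, u) x))
      (fun u => (ha (h.1, u)).mul (ha (k.1, u)).star) h.2 k.2
    exact this

/-- Products of functions of the base point and a tuple in which every factor is independent of some
coordinate. -/
def LO : (t : ℕ) → (Par ℤ t → X → ℂ) → Prop
  | 0, b => ∀ u x, b u x = 1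
  | t + 1, b => ∃ (b₀ : Par ℤ t → X → ℂ) (b' : ℤ → Par ℤ t → X → ℂ), (∀ u, B1 (b₀ u)) ∧
      (∀ h, LO t (b' h)) ∧ ∀ (h : ℤ) (u : Par ℤ t) (x : X),
        b ((h, u) : ℤ × Par ℤ t) x = b₀ u x * b' h u x

namespace LO

lemma b1 {t : ℕ} {b : Par ℤ t → X → ℂ} (hb : LO t b) (u : Par ℤ t) : B1 (b u) := by
  induction t with
  | zero =>
    have : b u = fun _ => 1 := by ext x; exact hb u x
    rw [this]; exact B1.one
  | succ t ih =>
    obtain ⟨b₀, b', h0, h1, h2⟩ := hb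
    have : b u = fun x => b₀ u.2 x * b' u.1 u.2 x := by ext x; exact h2 u.1 u.2 x
    rw [this]
    exact (h0 _).mul (ih (h1 _) _)

lemma mul {t : ℕ} {b d : Par ℤ t → X → ℂ} (hb : LO t b) (hd : LO t d) :
    LO t (fun u x => b u x * d u x) := by
  induction t with
  | zero => intro u x; simp [hb u x, hd u x]
  | succ t ih =>
    obtain ⟨b₀, b', h0, h1, h2⟩ := hb
    obtain ⟨d₀, d', g0, g1, g2⟩ := hd
    refine ⟨fun u x => b₀ u x * d₀ u x, fun h u x => b' h u x * d' h u x,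
      fun u => (h0 u).mul (g0 u), fun h => ih (h1 h) (g1 h), fun h u x => ?_⟩
    simp only []
    rw [show b (h, u) x = _ from h2 h u x, show d (h, u) x = _ from g2 h u x]; ring

lemma star {t : ℕ} {b : Par ℤ t → X → ℂ} (hb : LO t b) : LO t (fun u x => conj (b u x)) := by
  induction t with
  | zero => intro u x; simp [hb u x]
  | succ t ih =>
    obtain ⟨b₀, b', h0, h1, h2⟩ := hb
    refine ⟨fun u x => conj (b₀ u x), fun h u x => conj (b' h u x), fun u => (h0 u).star,
      fun h => ih (h1 h), fun h u x => ?_⟩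
    simp only []
    rw [show b (h, u) x = _ from h2 h u x, map_mul]

lemma mul_fixed {t : ℕ} {b : Par ℤ (t + 1) → X → ℂ} (hb : LO (t + 1) b) {f : X → ℂ} (hf : B1 f) :
    LO (t + 1) (fun u x => b u x * f x) := by
  obtain ⟨b₀, b', h0, h1, h2⟩ := hb
  refine ⟨fun u x => b₀ u x * f x, b', fun u => (h0 u).mul hf, h1, fun h u x => ?_⟩
  simp only []
  rw [show b (h, u) x = _ from h2 h u x]; ring

lemma comp {Y : Type*} [MeasurableSpace Y] {t : ℕ} {b : Par ℤ t → X → ℂ} (hb : LO t b) {φ : Y → X}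
    (hφ : Measurable φ) : LO t (fun u y => b u (φ y)) := by
  induction t with
  | zero => intro u y; exact hb u _
  | succ t ih =>
    obtain ⟨b₀, b', h0, h1, h2⟩ := hb
    exact ⟨fun u y => b₀ u (φ y), fun h u y => b' h u (φ y), fun u => (h0 u).comp hφ,
      fun h => ih (h1 h), fun h u y => h2 h u _⟩

end LO

lemma cube_eq_mul_LO {t : ℕ} {a : Par ℤ t → X → ℂ} (ha : ∀ u, B1 (a u)) (k : Par ℤ t) :
    ∃ l : Par ℤ t → X → ℂ, LO t l ∧ ∀ h x, cube t (fun u => a u x) h k = a h x * l h x := by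
  induction t with
  | zero => exact ⟨fun _ _ => 1, fun _ _ => rfl, fun h x => by simp [cube]⟩
  | succ t ih =>
    have := fun h : ℤ => ih (a := fun u x => a ((h, u) : ℤ × Par ℤ t) x *
      conj (a ((k.1, u) : ℤ × Par ℤ t) x)) (fun u => (ha _).mul (ha _).star) k.2
    choose l hl hl' using this
    refine ⟨fun u x => conj (a ((k.1, u.2) : ℤ × Par ℤ t) x) * l u.1 u.2 x,
      ⟨fun u x => conj (a ((k.1, u) : ℤ × Par ℤ t) x), l, fun u => (ha _).star, hl,
        fun h u x => rfl⟩, fun h x => ?_⟩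
    simp only [cube]
    rw [hl']
    rw [mul_assoc]

variable {ν : Measure X} [IsProbabilityMeasure ν]

lemma expect_pow_le {ι : Type*} (s : Finset ι) (hs : s.Nonempty) (f : ι → ℝ) (hf : ∀ i ∈ s, 0 ≤ f i)
    (n : ℕ) : (𝔼 i ∈ s, f i) ^ n ≤ 𝔼 i ∈ s, f i ^ n := by
  have hc : (0 : ℝ) < s.card := by exact_mod_cast hs.card_pos
  have h := (convexOn_pow n).map_sum_le (t := s) (w := fun _ => (s.card : ℝ)⁻¹) (p := f)
    (fun i _ => by positivity) (by simp [hc.ne']) (fun i hi => hf i hi)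
  simpa only [smul_eq_mul, ← Finset.mul_sum, Finset.expect_eq_sum_div_card, div_eq_inv_mul] using h

lemma gcs_step {ι κ : Type*} (A : Finset ι) (B : Finset κ) (hB : B.Nonempty) (a : ι → κ → X → ℂ)
    (b₀ : κ → X → ℂ) (ha : ∀ i j, B1 (a i j)) (hb₀ : ∀ j, B1 (b₀ j)) :
    ‖𝔼 i ∈ A, 𝔼 j ∈ B, ∫ x, b₀ j x * a i j x ∂ν‖ ^ 2 ≤
      (𝔼 i ∈ A, 𝔼 i' ∈ A, 𝔼 j ∈ B, ∫ x, a i j x * conj (a i' j x) ∂ν).re := by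
  have hV : ∀ j, B1 (fun x => 𝔼 i ∈ A, a i j x) := fun j => B1.expect A fun i _ => ha i j
  have e1 : 𝔼 i ∈ A, 𝔼 j ∈ B, ∫ x, b₀ j x * a i j x ∂ν =
      𝔼 j ∈ B, ∫ x, b₀ j x * 𝔼 i ∈ A, a i j x ∂ν := by
    rw [Finset.expect_comm]
    refine Finset.expect_congr rfl fun j _ => ?_
    simp only [Finset.mul_expect]
    exact (integral_expect ν A fun i _ => ((hb₀ j).mul (ha i j)).integrable ν).symm
  have e2 : ∀ j, 𝔼 i ∈ A, 𝔼 i' ∈ A, ∫ x, a i j x * conj (a i' j x) ∂ν =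
      ((∫ x, ‖𝔼 i ∈ A, a i j x‖ ^ 2 ∂ν : ℝ) : ℂ) := by
    intro j
    rw [← integral_complex_ofReal]
    simp only [expect_mul_star]
    rw [integral_expect]
    · refine Finset.expect_congr rfl fun h _ => (integral_expect ν A fun h' _ => ?_).symm
      exact ((ha _ _).mul (ha _ _).star).integrable ν
    · intro h _
      exact (B1.expect A fun h' _ => (ha _ _).mul (ha _ _).star).integrable ν
  have e3 : 𝔼 i ∈ A, 𝔼 i' ∈ A, 𝔼 j ∈ B, ∫ x, a i j x * conj (a i' j x) ∂ν =
      𝔼 j ∈ B, ((∫ x, ‖𝔼 i ∈ A, a i j x‖ ^ 2 ∂ν : ℝ) : ℂ) := by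
    simp only [← e2]
    rw [Finset.expect_comm (s := B)]
    refine Finset.expect_congr rfl fun i _ => ?_
    rw [Finset.expect_comm]
  rw [e1, e3, re_expect]
  calc _ ≤ (𝔼 j ∈ B, ‖∫ x, b₀ j x * 𝔼 i ∈ A, a i j x ∂ν‖) ^ 2 := by
        gcongr; exact norm_expect_le _ _
    _ ≤ 𝔼 j ∈ B, ‖∫ x, b₀ j x * 𝔼 i ∈ A, a i j x ∂ν‖ ^ 2 :=
        expect_pow_le B hB _ (fun _ _ => norm_nonneg _) 2
    _ ≤ _ := Finset.expect_le_expect fun j _ => by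
        rw [Complex.ofReal_re]
        exact norm_integral_mul_sq_le ν (hb₀ j) (hV j).1 (hV j).2

/-- Gowers-Cauchy-Schwarz: lower order factors can be removed. -/
lemma gcs (t : ℕ) : ∀ (H : Par ℕ (t + 1)) (a b : Par ℤ (t + 1) → X → ℂ), (∀ u, B1 (a u)) →
    LO (t + 1) b →
    ‖𝔼 u ∈ bx (t + 1) H, ∫ x, a u x * b u x ∂ν‖ ^ 2 ^ (t + 1) ≤
      (𝔼 h ∈ bx (t + 1) H, 𝔼 k ∈ bx (t + 1) H, ∫ x, cube (t + 1) (fun u => a u x) h k ∂ν).re := by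
  have key : ∀ (t : ℕ) (H : Par ℕ (t + 1)) (a b : Par ℤ (t + 1) → X → ℂ) (_ : ∀ u, B1 (a u))
      (b₀ : Par ℤ t → X → ℂ) (b' : ℤ → Par ℤ t → X → ℂ) (_ : ∀ u, B1 (b₀ u))
      (_ : ∀ h, LO t (b' h)) (_ : ∀ (h : ℤ) (u : Par ℤ t) (x : X),
        b ((h, u) : ℤ × Par ℤ t) x = b₀ u x * b' h u x),
      ‖𝔼 u ∈ bx (t + 1) H, ∫ x, a u x * b u x ∂ν‖ ^ 2 ≤ (𝔼 h ∈ J H.1, 𝔼 k ∈ J H.1,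
        𝔼 u ∈ bx t H.2, ∫ x, (a ((h, u) : ℤ × Par ℤ t) x * conj (a ((k, u) : ℤ × Par ℤ t) x)) *
          (b' h u x * conj (b' k u x)) ∂ν).re := by
    intro t H a b ha b₀ b' h0 h1 h2
    have := gcs_step (ν := ν) (J H.1) (bx t H.2) (bx_nonempty _ _)
      (fun h u x => a ((h, u) : ℤ × Par ℤ t) x * b' h u x) b₀
      (fun h u => (ha _).mul ((h1 h).b1 u)) h0
    rw [expect_bx_succ]
    simp only [h2]
    refine le_of_eq_of_le ?_ (this.trans_eq ?_)
    · congr 2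
      refine Finset.expect_congr rfl fun h _ => Finset.expect_congr rfl fun u _ => ?_
      congr 1; ext x; ring
    · congr 1
      refine Finset.expect_congr rfl fun h _ => Finset.expect_congr rfl fun k _ =>
        Finset.expect_congr rfl fun u _ => ?_
      congr 1; ext x; rw [map_mul]; ring
  have split : ∀ (t : ℕ) (H : Par ℕ (t + 1)) (a : Par ℤ (t + 1) → X → ℂ),
      𝔼 h ∈ bx (t + 1) H, 𝔼 k ∈ bx (t + 1) H, ∫ x, cube (t + 1) (fun u => a u x) h k ∂ν =
      𝔼 h ∈ J H.1, 𝔼 k ∈ J H.1, 𝔼 hs ∈ bx t H.2, 𝔼 ks ∈ bx t H.2,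
        ∫ x, cube t (fun u => a ((h, u) : ℤ × Par ℤ t) x * conj (a ((k, u) : ℤ × Par ℤ t) x))
          hs ks ∂ν := by
    intro t H a
    simp only [expect_bx_succ t H]
    refine Finset.expect_congr rfl fun h _ => ?_
    rw [Finset.expect_comm]
    rfl
  induction t with
  | zero =>
    intro H a b ha hb
    obtain ⟨b₀, b', h0, h1, h2⟩ := hb
    have := key 0 H a b ha b₀ b' h0 h1 h2
    rw [split]
    simp only [expect_bx_zero H.2] at this ⊢
    simpa [h1 _ _ _, cube] using this
  | succ t ih =>
    intro H a b ha hb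
    obtain ⟨b₀, b', h0, h1, h2⟩ := hb
    have h3 := key (t + 1) H a b ha b₀ b' h0 h1 h2
    rw [split, re_expect]
    simp only [re_expect (J H.1)]
    have hJ := J_nonempty H.1
    have h4 : ∀ h k : ℤ, ‖𝔼 u ∈ bx (t + 1) H.2, ∫ x, (a ((h, u) : ℤ × Par ℤ (t + 1)) x *
          conj (a ((k, u) : ℤ × Par ℤ (t + 1)) x)) * (b' h u x * conj (b' k u x)) ∂ν‖ ^ 2 ^ (t + 1)
        ≤ (𝔼 hs ∈ bx (t + 1) H.2, 𝔼 ks ∈ bx (t + 1) H.2,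
        ∫ x, cube (t + 1) (fun u => a ((h, u) : ℤ × Par ℤ (t + 1)) x *
          conj (a ((k, u) : ℤ × Par ℤ (t + 1)) x)) hs ks ∂ν).re := fun h k =>
      ih H.2 (fun u x => a ((h, u) : ℤ × Par ℤ (t + 1)) x *
          conj (a ((k, u) : ℤ × Par ℤ (t + 1)) x)) (fun u x => b' h u x * conj (b' k u x))
        (fun u => (ha _).mul (ha _).star) ((h1 h).mul (h1 k).star)
    set Z : ℤ → ℤ → ℂ := fun h k => 𝔼 u ∈ bx (t + 1) H.2, ∫ x, (a ((h, u) : ℤ × Par ℤ (t + 1)) x *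
          conj (a ((k, u) : ℤ × Par ℤ (t + 1)) x)) * (b' h u x * conj (b' k u x)) ∂ν with hZ
    have h5 : ‖𝔼 u ∈ bx (t + 1 + 1) H, ∫ x, a u x * b u x ∂ν‖ ^ 2 ≤
        𝔼 h ∈ J H.1, 𝔼 k ∈ J H.1, ‖Z h k‖ :=
      h3.trans ((Complex.re_le_norm _).trans ((norm_expect_le _ _).trans
        (Finset.expect_le_expect fun h _ => norm_expect_le _ _)))
    calc _ = (‖𝔼 u ∈ bx (t + 1 + 1) H, ∫ x, a u x * b u x ∂ν‖ ^ 2) ^ 2 ^ (t + 1) := by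
          rw [← pow_mul, ← pow_succ']
      _ ≤ (𝔼 h ∈ J H.1, 𝔼 k ∈ J H.1, ‖Z h k‖) ^ 2 ^ (t + 1) := by gcongr
      _ ≤ 𝔼 h ∈ J H.1, (𝔼 k ∈ J H.1, ‖Z h k‖) ^ 2 ^ (t + 1) :=
          expect_pow_le _ hJ _ (fun h _ => Finset.expect_nonneg fun k _ => norm_nonneg _) _
      _ ≤ 𝔼 h ∈ J H.1, 𝔼 k ∈ J H.1, ‖Z h k‖ ^ 2 ^ (t + 1) :=
          Finset.expect_le_expect fun h _ => expect_pow_le _ hJ _ (fun k _ => norm_nonneg _) _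
      _ ≤ _ := Finset.expect_le_expect fun h _ => Finset.expect_le_expect fun k _ => h4 h k

end Measurable

section Box
variable {X : Type*} [MeasurableSpace X] {μ : Measure X} {T : Equiv.Perm X}

lemma G_eq (t : ℕ) (H : Par ℕ t) (F : X → ℂ) :
    G μ T t H F = 𝔼 h ∈ bx t H, 𝔼 k ∈ bx t H,
      ‖∫ x, cube t (fun u => sh T (su t u) F x) h k ∂μ‖ ^ 2 := by
  induction t generalizing F with
  | zero =>
    simp only [expect_bx_zero H, cube, su, sh_zero, G]
  | succ t ih =>
    rw [G]
    simp only [expect_bx_succ t H]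
    refine Finset.expect_congr rfl fun h _ => ?_
    rw [Finset.expect_comm (s := bx t H.2)]
    refine Finset.expect_congr rfl fun k _ => ?_
    rw [ih]
    refine Finset.expect_congr rfl fun hs _ => Finset.expect_congr rfl fun ks _ => ?_
    simp only [cube, su, sh, ← Equiv.Perm.mul_apply, ← zpow_add]

lemma G_succ_eq (t : ℕ) (H' : ℕ) (H : Par ℕ t) (F : X → ℂ) :
    G μ T (t + 1) ((H', H) : ℕ × Par ℕ t) F = 𝔼 h ∈ bx t H, 𝔼 k ∈ bx t H,
      G μ T 1 ((H', ()) : ℕ × Par ℕ 0) (fun x => cube t (fun u => sh T (su t u) F x) h k) := by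
  have e : ∀ h' k' : ℤ, G μ T t H (fun x => sh T h' F x * conj (sh T k' F x)) =
      𝔼 h ∈ bx t H, 𝔼 k ∈ bx t H, ‖∫ x,
        sh T h' (fun x => cube t (fun u => sh T (su t u) F x) h k) x *
        conj (sh T k' (fun x => cube t (fun u => sh T (su t u) F x) h k) x) ∂μ‖ ^ 2 := by
    intro h' k'
    rw [G_eq]
    refine Finset.expect_congr rfl fun h _ => Finset.expect_congr rfl fun k _ => ?_
    congr 3; ext x
    simp only [sh, ← cube_star, ← cube_mul, ← Equiv.Perm.mul_apply, ← zpow_add, add_comm]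
  change 𝔼 h' ∈ J H', 𝔼 k' ∈ J H', G μ T t H (fun x => sh T h' F x * conj (sh T k' F x)) = _
  simp only [e, G]
  have sw : ∀ (f : ℤ → ℤ → Par ℤ t → Par ℤ t → ℝ),
      𝔼 h' ∈ J H', 𝔼 k' ∈ J H', 𝔼 h ∈ bx t H, 𝔼 k ∈ bx t H, f h' k' h k =
      𝔼 h ∈ bx t H, 𝔼 k ∈ bx t H, 𝔼 h' ∈ J H', 𝔼 k' ∈ J H', f h' k' h k := by
    intro f
    rw [Finset.expect_comm (s := bx t H)]
    have : ∀ h' ∈ J H', 𝔼 k' ∈ J H', 𝔼 h ∈ bx t H, 𝔼 k ∈ bx t H, f h' k' h k =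
      𝔼 k ∈ bx t H, 𝔼 h ∈ bx t H, 𝔼 k' ∈ J H', f h' k' h k := by
      intro h' _
      rw [Finset.expect_comm, Finset.expect_comm (s := bx t H) (t := bx t H)]
      refine Finset.expect_congr rfl fun k _ => ?_
      rw [Finset.expect_comm]
    rw [Finset.expect_congr rfl this, Finset.expect_comm]
    refine Finset.expect_congr rfl fun k _ => ?_
    rw [Finset.expect_comm]
  exact sw _

end Box

end

section

lemma ne_zero_of_norm_one {z : ℂ} (hz : ‖z‖ = 1) : z ≠ 0 := by
  rintro rfl; simp at hz

lemma conj_eq_inv {z : ℂ} (hz : ‖z‖ = 1) : conj z = z⁻¹ := by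
  rw [Complex.inv_def, Complex.normSq_eq_norm_sq, hz]; simp

/-- Finitely many characters detect integers in a bounded range. -/
lemma exists_roots (L : ℕ) : ∃ (M : ℕ) (ξ : ℂ), 0 < M ∧ ‖ξ‖ = 1 ∧
    ∀ n ∈ J L, 𝔼 j ∈ range M, (ξ ^ j) ^ n = if n = 0 then 1 else 0 := by
  have hM : (L + 1) ≠ 0 := by omega
  have hξ := Complex.isPrimitiveRoot_exp (L + 1) hM
  set ξ := Complex.exp (2 * Real.pi * Complex.I / (L + 1 : ℕ)) with hξd
  refine ⟨L + 1, ξ, by omega, hξ.norm'_eq_one hM, fun n hn => ?_⟩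
  split_ifs with h
  · subst h; simp
  · have h1 : ξ ^ n ≠ 1 := by
      rw [Ne, hξ.zpow_eq_one_iff_dvd]
      intro hd
      have := Int.le_of_dvd (abs_pos.mpr h) ((dvd_abs _ _).mpr hd)
      simp only [J, Finset.mem_Icc] at hn
      have h2 := abs_le.mpr hn
      push_cast at this; omega
    have h2 : ∀ j : ℕ, (ξ ^ j) ^ n = (ξ ^ n) ^ j := fun j => by
      rw [← zpow_natCast, ← zpow_natCast, ← zpow_mul, ← zpow_mul, mul_comm]
    rw [Finset.expect_eq_sum_div_card]
    simp only [h2]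
    rw [geom_sum_eq h1, ← h2, hξ.pow_eq_one]; simp

lemma exists_large_fourier (L : ℕ) (g : ℤ → ℂ) (hg : ∀ n, ‖g n‖ ≤ 1) (S : ℂ → ℝ)
    (hS0 : ∀ z, 0 ≤ S z) (hL : 0 < L)
    (hS : ∀ z, ‖z‖ = 1 → (S z : ℂ) = ∑ a ∈ range L, ∑ b ∈ range L, z ^ ((b : ℤ) - a) * g (b - a))
    {c : ℝ} (hc : 0 < c) (h : c * L ^ 2 ≤ ∑ a ∈ range L, ∑ b ∈ range L, ‖g ((b : ℤ) - a)‖ ^ 2) :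
    ∃ z, ‖z‖ = 1 ∧ c ^ 2 / 3 * L ^ 2 ≤ S z := by
  set P := range L ×ˢ range L
  set d : ℕ × ℕ → ℤ := fun p => (p.2 : ℤ) - p.1 with hd
  set R : ℤ → ℕ := fun n => (P.filter fun p => d p = n).card with hR
  have hdP : ∀ p ∈ P, d p ∈ J L := by
    intro p hp
    simp only [P, Finset.mem_product, Finset.mem_range] at hp
    simp only [J, hd, Finset.mem_Icc]; omega
  have fib : ∀ {E : Type} [AddCommMonoid E] (f : ℤ → E),
      ∑ a ∈ range L, ∑ b ∈ range L, f ((b : ℤ) - a) = ∑ n ∈ J L, R n • f n := by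
    intro E _ f
    rw [← Finset.sum_product' (f := fun a b : ℕ => f ((b : ℤ) - a)),
      ← Finset.sum_fiberwise_of_maps_to hdP]
    refine Finset.sum_congr rfl fun n _ => ?_
    rw [Finset.sum_congr rfl (g := fun _ => f n), Finset.sum_const]
    intro p hp
    rw [← (Finset.mem_filter.mp hp).2]
  have hR0 : R 0 = L := by
    have : (P.filter fun p => d p = 0) = (range L).image fun a => (a, a) := by
      ext ⟨a, b⟩; simp only [P, hd, Finset.mem_filter, Finset.mem_product, Finset.mem_range,
        Finset.mem_image, Prod.mk.injEq]
      constructor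
      · rintro ⟨⟨h1, h2⟩, h3⟩; exact ⟨a, h1, rfl, by omega⟩
      · rintro ⟨x, h1, rfl, rfl⟩; simp [h1]
    rw [hR]; simp only [this]
    rw [Finset.card_image_of_injective _ (fun a b h => (Prod.mk.inj h).1), Finset.card_range]
  have hS' : ∀ z, ‖z‖ = 1 → (S z : ℂ) = ∑ n ∈ J L, (R n * g n) * z ^ n := by
    intro z hz
    rw [hS z hz, fib (fun n => z ^ n * g n)]
    refine Finset.sum_congr rfl fun n _ => ?_
    rw [nsmul_eq_mul]; ring
  obtain ⟨M, ξ, hM, hξ, horth⟩ := exists_roots (2 * L)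
  have hξj : ∀ j : ℕ, ‖ξ ^ j‖ = 1 := fun j => by rw [norm_pow, hξ, one_pow]
  have hMn : (range M).Nonempty := ⟨0, by simpa using hM⟩
  have m1 : 𝔼 j ∈ range M, S (ξ ^ j) ≤ L := by
    have : (((𝔼 j ∈ range M, S (ξ ^ j) : ℝ)) : ℂ) = L * g 0 := by
      rw [Complex.ofReal_expect]
      simp only [hS' _ (hξj _)]
      rw [Finset.expect_sum_comm]
      simp only [← Finset.mul_expect]
      rw [Finset.sum_eq_single 0]
      · rw [horth 0 (by simp [J]), if_pos rfl, hR0, mul_one]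
      · intro n hn hn0
        rw [horth n (by simp only [J, Finset.mem_Icc] at hn ⊢; omega), if_neg hn0, mul_zero]
      · intro h0; exact absurd (by simp [J]) h0
    have h2 : 𝔼 j ∈ range M, S (ξ ^ j) = ‖(L : ℂ) * g 0‖ := by
      rw [← this, Complex.norm_real, Real.norm_eq_abs,
        abs_of_nonneg (Finset.expect_nonneg fun _ _ => hS0 _)]
    rw [h2, norm_mul, Complex.norm_natCast]
    exact mul_le_of_le_one_right (by positivity) (hg 0)
  have m2 : 𝔼 j ∈ range M, S (ξ ^ j) ^ 2 = ∑ n ∈ J L, (R n * ‖g n‖) ^ 2 := by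
    have : (((𝔼 j ∈ range M, S (ξ ^ j) ^ 2 : ℝ)) : ℂ) =
        ((∑ n ∈ J L, (R n * ‖g n‖) ^ 2 : ℝ) : ℂ) := by
      rw [Complex.ofReal_expect]
      have e1 : ∀ j, ((S (ξ ^ j) ^ 2 : ℝ) : ℂ) = ∑ n ∈ J L, ∑ k ∈ J L,
          ((R n * g n) * conj (R k * g k)) * (ξ ^ j) ^ (n - k) := by
        intro j
        have e2 : ((S (ξ ^ j) ^ 2 : ℝ) : ℂ) = (S (ξ ^ j) : ℂ) * conj (S (ξ ^ j) : ℂ) := by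
          rw [Complex.conj_ofReal]; push_cast; ring
        rw [e2, hS' _ (hξj j), map_sum, Finset.sum_mul_sum]
        refine Finset.sum_congr rfl fun n _ => Finset.sum_congr rfl fun k _ => ?_
        rw [map_mul, map_zpow₀, conj_eq_inv (hξj j), zpow_sub₀ (ne_zero_of_norm_one (hξj j)),
          inv_zpow]
        ring
      simp only [e1]
      rw [Finset.expect_sum_comm, Complex.ofReal_sum]
      refine Finset.sum_congr rfl fun n hn => ?_
      rw [Finset.expect_sum_comm]
      simp only [← Finset.mul_expect]
      rw [Finset.sum_eq_single n]
      · rw [horth (n - n) (by simp [J]), if_pos (by simp), mul_one, Complex.mul_conj,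
          Complex.normSq_eq_norm_sq, norm_mul, Complex.norm_natCast]
      · intro k hk hkn
        rw [horth (n - k) (by simp only [J, Finset.mem_Icc] at hn hk ⊢; omega),
          if_neg (by omega), mul_zero]
      · intro h0; exact absurd hn h0
    exact_mod_cast this
  have m3 : ∑ a ∈ range L, ∑ b ∈ range L, ‖g ((b : ℤ) - a)‖ ^ 2 =
      ∑ n ∈ J L, (R n * ‖g n‖) * ‖g n‖ := by
    rw [fib fun n => ‖g n‖ ^ 2]
    refine Finset.sum_congr rfl fun n _ => ?_
    rw [nsmul_eq_mul]; ring
  have hL' : (1 : ℝ) ≤ L := by exact_mod_cast hL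
  have m4 : (c * L ^ 2) ^ 2 ≤ (𝔼 j ∈ range M, S (ξ ^ j) ^ 2) * (3 * L) := by
    calc (c * L ^ 2) ^ 2 ≤ (∑ n ∈ J L, (R n * ‖g n‖) * ‖g n‖) ^ 2 := by
          rw [← m3]; gcongr
      _ ≤ (∑ n ∈ J L, (R n * ‖g n‖) ^ 2) * ∑ n ∈ J L, ‖g n‖ ^ 2 :=
          Finset.sum_mul_sq_le_sq_mul_sq _ _ _
      _ ≤ (𝔼 j ∈ range M, S (ξ ^ j) ^ 2) * (3 * L) := by
          rw [m2]
          refine mul_le_mul_of_nonneg_left ?_ (Finset.sum_nonneg fun n _ => sq_nonneg _)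
          calc ∑ n ∈ J L, ‖g n‖ ^ 2 ≤ ∑ n ∈ J L, (1 : ℝ) := by
                gcongr with n; exact pow_le_one₀ (norm_nonneg _) (hg n)
            _ ≤ 3 * L := by rw [Finset.sum_const, card_J]; simp; linarith
  by_contra hcon
  push Not at hcon
  have m5 : 𝔼 j ∈ range M, S (ξ ^ j) ^ 2 ≤ (c ^ 2 / 3 * L ^ 2) * 𝔼 j ∈ range M, S (ξ ^ j) := by
    rw [Finset.mul_expect]
    refine Finset.expect_le_expect fun j _ => ?_
    rw [pow_two]
    exact mul_le_mul_of_nonneg_right (hcon _ (hξj j)).le (hS0 _)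
  have m6 : ∃ j ∈ range M, 𝔼 j ∈ range M, S (ξ ^ j) ≤ S (ξ ^ j) :=
    Finset.exists_le_of_le_expect hMn le_rfl
  have m7 : 0 < 𝔼 j ∈ range M, S (ξ ^ j) := by
    by_contra h0
    have h1 : 𝔼 j ∈ range M, S (ξ ^ j) ^ 2 ≤ 0 :=
      m5.trans (mul_nonpos_of_nonneg_of_nonpos (by positivity) (not_lt.mp h0))
    have : 0 < (c * L ^ 2) ^ 2 := by positivity
    have h2 : (𝔼 j ∈ range M, S (ξ ^ j) ^ 2) * (3 * L) ≤ 0 :=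
      mul_nonpos_of_nonpos_of_nonneg h1 (by positivity)
    linarith
  have m5' : 𝔼 j ∈ range M, S (ξ ^ j) ^ 2 < (c ^ 2 / 3 * L ^ 2) * 𝔼 j ∈ range M, S (ξ ^ j) := by
    rw [Finset.mul_expect]
    obtain ⟨j, hj, hj'⟩ := m6
    refine Finset.expect_lt_expect (fun j _ => ?_) ⟨j, hj, ?_⟩
    · rw [pow_two]
      exact mul_le_mul_of_nonneg_right (hcon _ (hξj j)).le (hS0 _)
    · rw [pow_two]
      exact mul_lt_mul_of_pos_right (hcon _ (hξj j)) (m7.trans_le hj')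
  have : (c * L ^ 2) ^ 2 < (c * L ^ 2) ^ 2 := by
    calc (c * (L : ℝ) ^ 2) ^ 2 ≤ _ := m4
      _ < ((c ^ 2 / 3 * L ^ 2) * L) * (3 * L) := by
          have : (c ^ 2 / 3 * (L : ℝ) ^ 2) * 𝔼 j ∈ range M, S (ξ ^ j) ≤ (c ^ 2 / 3 * L ^ 2) * L := by
            gcongr
          have h3 : (0 : ℝ) < 3 * L := by positivity
          exact mul_lt_mul_of_pos_right (m5'.trans_le this) h3
      _ = _ := by ring
  exact lt_irrefl _ this

lemma hilbert_eigenvector {E : Type*} [NormedAddCommGroup E] [InnerProductSpace ℂ E]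
    [CompleteSpace E] (U : E →ₗᵢ[ℂ] E) (v : E) (hv : ‖v‖ ≤ 1) {c : ℝ} (hc : 0 < c)
    (h : ∃ᶠ L : ℕ in atTop, c * L ^ 2 ≤ ∑ a ∈ range L, ∑ b ∈ range L,
      ‖inner ℂ (U^[a] v) (U^[b] v)‖ ^ 2) :
    ∃ (ζ : ℂ) (g : E), ‖ζ‖ = 1 ∧ U g = ζ • g ∧ inner ℂ g v = (‖g‖ : ℂ) ^ 2 ∧
      c ^ 2 / 3 ≤ ‖g‖ ^ 2 := by
  set A : ℂ → ℕ → E := fun z n => ∑ a ∈ range n, z ^ a • U^[a] v with hA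
  have hUn : ∀ (n : ℕ) (x y : E), inner ℂ (U^[n] x) (U^[n] y) = (inner ℂ x y : ℂ) := by
    intro n
    induction n with
    | zero => simp
    | succ n ih => intro x y; rw [Function.iterate_succ_apply, Function.iterate_succ_apply, ih,
        U.inner_map_map]
  have hUnorm : ∀ (n : ℕ) (x : E), ‖U^[n] x‖ = ‖x‖ := by
    intro n
    induction n with
    | zero => simp
    | succ n ih => intro x; rw [Function.iterate_succ_apply, ih, U.norm_map]
  have hUA : ∀ (n m : ℕ) z, U^[n] (A z m) = ∑ a ∈ range m, z ^ a • U^[n + a] v := by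
    intro n
    induction n with
    | zero => intro m z; simp [hA]
    | succ n ih =>
      intro m z
      rw [Function.iterate_succ_apply', ih, map_sum]
      refine Finset.sum_congr rfl fun a _ => ?_
      rw [map_smul, ← Function.iterate_succ_apply' U]
      congr 2; omega
  have hsub : ∀ z, ‖z‖ = 1 → ∀ m n, ‖A z (m + n)‖ ≤ ‖A z m‖ + ‖A z n‖ := by
    intro z hz m n
    have : A z (m + n) = A z m + z ^ m • U^[m] (A z n) := by
      rw [hUA, Finset.smul_sum]
      simp only [hA, Finset.sum_range_add, smul_smul, pow_add]
    rw [this]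
    refine (norm_add_le _ _).trans ?_
    rw [norm_smul, norm_pow, hz, one_pow, one_mul, hUnorm]
  have hone : ∀ z, ‖z‖ = 1 → ∀ n : ℕ, ‖A z n‖ ≤ n := by
    intro z hz n
    refine (norm_sum_le _ _).trans ?_
    calc _ ≤ ∑ a ∈ range n, (1 : ℝ) := by
          refine Finset.sum_le_sum fun a _ => ?_
          rw [norm_smul, norm_pow, hz, one_pow, one_mul, hUnorm]; exact hv
      _ = n := by simp
  have hmul : ∀ z, ‖z‖ = 1 → ∀ N q, ‖A z (N * q)‖ ≤ q * ‖A z N‖ := by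
    intro z hz N q
    induction q with
    | zero => simp [hA]
    | succ q ih =>
      rw [Nat.mul_succ]
      refine (hsub z hz _ _).trans ?_
      push_cast; linarith
  have hscale : ∀ z, ‖z‖ = 1 → ∀ N L : ℕ, 0 < N → ‖A z L‖ ≤ L / N * ‖A z N‖ + N := by
    intro z hz N L hN
    have h1 := hsub z hz (N * (L / N)) (L % N)
    rw [Nat.div_add_mod] at h1
    have h2 := hmul z hz N (L / N)
    have h3 := hone z hz (L % N)
    have h4 : ((L / N : ℕ) : ℝ) ≤ L / N := Nat.cast_div_le
    have h5 : ((L % N : ℕ) : ℝ) ≤ N := by exact_mod_cast (Nat.mod_lt L hN).le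
    have h6 := mul_le_mul_of_nonneg_right h4 (norm_nonneg (A z N))
    linarith
  have hS : ∀ L : ℕ, 0 < L → c * L ^ 2 ≤ ∑ a ∈ range L, ∑ b ∈ range L,
      ‖inner ℂ (U^[a] v) (U^[b] v)‖ ^ 2 → ∃ z, ‖z‖ = 1 ∧ Real.sqrt (c ^ 2 / 3) * L ≤ ‖A z L‖ := by
    intro L hL hcL
    set g : ℤ → ℂ := fun n => inner ℂ (U^[(-n).toNat] v) (U^[n.toNat] v) with hg
    have hgab : ∀ a b : ℕ, inner ℂ (U^[a] v) (U^[b] v) = g ((b : ℤ) - a) := by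
      intro a b
      simp only [hg]
      rcases le_total a b with hab | hab
      · obtain ⟨d, rfl⟩ := Nat.exists_eq_add_of_le hab
        have e1 : (-(((a + d : ℕ) : ℤ) - a)).toNat = 0 := by omega
        have e2 : (((a + d : ℕ) : ℤ) - a).toNat = d := by omega
        rw [e1, e2, Function.iterate_add_apply, hUn]; rfl
      · obtain ⟨d, rfl⟩ := Nat.exists_eq_add_of_le hab
        have e1 : (-((b : ℤ) - ((b + d : ℕ) : ℤ))).toNat = d := by omega
        have e2 : ((b : ℤ) - ((b + d : ℕ) : ℤ)).toNat = 0 := by omega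
        rw [e1, e2, Function.iterate_add_apply, hUn]; rfl
    obtain ⟨z, hz, hz'⟩ := exists_large_fourier L g (fun n => by
        refine (norm_inner_le_norm _ _).trans ?_
        rw [hUnorm, hUnorm]; exact mul_le_one₀ hv (norm_nonneg _) hv)
      (fun z => ‖A z L‖ ^ 2) (fun _ => sq_nonneg _) hL (fun z hz => by
        have : ((‖A z L‖ ^ 2 : ℝ) : ℂ) = inner ℂ (A z L) (A z L) := by
          rw [inner_self_eq_norm_sq_to_K]; push_cast; rfl
        rw [this]
        simp only [hA, sum_inner, inner_sum, inner_smul_left, inner_smul_right, hgab]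
        simp only [Finset.mul_sum]
        rw [Finset.sum_comm]
        refine Finset.sum_congr rfl fun a _ => Finset.sum_congr rfl fun b _ => ?_
        rw [map_pow, conj_eq_inv hz, zpow_sub₀ (ne_zero_of_norm_one hz), zpow_natCast,
          zpow_natCast, inv_pow]
        ring) hc (by simpa only [hgab] using hcL)
    refine ⟨z, hz, ?_⟩
    refine abs_le_of_sq_le_sq' ?_ (norm_nonneg _) |>.2
    rw [mul_pow, Real.sq_sqrt (by positivity)]; exact hz'
  set κ := Real.sqrt (c ^ 2 / 3) with hκ
  obtain ⟨𝒰, h𝒰, h𝒰'⟩ : ∃ 𝒰 : Ultrafilter ℕ, (𝒰 : Filter ℕ) ≤ atTop ∧ ∀ᶠ L : ℕ in 𝒰,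
      c * L ^ 2 ≤ ∑ a ∈ range L, ∑ b ∈ range L, ‖inner ℂ (U^[a] v) (U^[b] v)‖ ^ 2 := by
    have hne := Filter.frequently_iff_neBot.mp h
    have hle := @Ultrafilter.of_le _ _ hne
    exact ⟨@Ultrafilter.of _ _ hne, hle.trans inf_le_left,
      (hle.trans inf_le_right) (Filter.mem_principal_self _)⟩
  have : ∀ L : ℕ, ∃ z, ‖z‖ = 1 ∧ (0 < L → c * L ^ 2 ≤ ∑ a ∈ range L, ∑ b ∈ range L,
      ‖inner ℂ (U^[a] v) (U^[b] v)‖ ^ 2 → κ * L ≤ ‖A z L‖) := by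
    intro L
    by_cases hL : 0 < L ∧ c * L ^ 2 ≤ ∑ a ∈ range L, ∑ b ∈ range L,
      ‖inner ℂ (U^[a] v) (U^[b] v)‖ ^ 2
    · obtain ⟨z, hz, hz'⟩ := hS L hL.1 hL.2
      exact ⟨z, hz, fun _ _ => hz'⟩
    · exact ⟨1, by simp, fun h1 h2 => absurd ⟨h1, h2⟩ hL⟩
  choose z hz hz' using this
  have hcomp : IsCompact (Metric.sphere (0 : ℂ) 1) := isCompact_sphere _ _
  obtain ⟨ζ, hζ, hlim⟩ := hcomp.ultrafilter_le_nhds (𝒰.map z)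
    (by
      rw [Filter.le_principal_iff]
      exact Filter.mem_map.mpr (Filter.univ_mem' fun L => by simp [hz L]))
  have hζ1 : ‖ζ‖ = 1 := by simpa using hζ
  have hlim' : Tendsto z 𝒰 (nhds ζ) := hlim
  have hlow : ∀ N : ℕ, 0 < N → κ * N ≤ ‖A ζ N‖ := by
    intro N hN
    have hN' : (0 : ℝ) < N := by exact_mod_cast hN
    have t1 : Tendsto (fun L => ‖A (z L) N‖) 𝒰 (nhds ‖A ζ N‖) := by
      have : Continuous fun w : ℂ => ‖A w N‖ := by
        simp only [hA]; fun_prop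
      exact (this.tendsto ζ).comp hlim'
    have t2 : Tendsto (fun L : ℕ => κ * N - N ^ 2 / (L : ℝ)) 𝒰 (nhds (κ * N - 0)) :=
      (tendsto_const_nhds.sub (tendsto_const_div_atTop_nhds_zero_nat _)).mono_left h𝒰
    rw [sub_zero] at t2
    refine le_of_tendsto_of_tendsto t2 t1 ?_
    filter_upwards [h𝒰', h𝒰 (eventually_gt_atTop 0)] with L hL hL0
    have hL0' : (0 : ℝ) < L := by exact_mod_cast (show 0 < L from hL0)
    have h1 := (hz' L hL0 hL).trans (hscale _ (hz L) N L hN)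
    have h2 : (κ * N - N ^ 2 / (L : ℝ)) * (L / N) ≤ ‖A (z L) N‖ * (L / N) := by
      have : (κ * N - N ^ 2 / (L : ℝ)) * (L / N) = κ * L - N := by field_simp
      rw [this]; linarith
    exact le_of_mul_le_mul_right h2 (by positivity)
  set W : E →L[ℂ] E := ζ • U.toContinuousLinearMap with hW
  have hWa : ∀ x, W x = ζ • U x := fun x => rfl
  have hWn : ‖W‖ ≤ 1 := W.opNorm_le_bound zero_le_one fun x => by
    rw [hWa, norm_smul, hζ1, U.norm_map]
  have hWi : ∀ (n : ℕ), W^[n] v = ζ ^ n • U^[n] v := by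
    intro n
    induction n with
    | zero => simp
    | succ n ih =>
      rw [Function.iterate_succ_apply', ih, hWa, map_smul, Function.iterate_succ_apply', smul_smul,
        pow_succ']
  have herg := W.tendsto_birkhoffAverage_orthogonalProjection hWn v
  set g : E := ((W.eqLocus (1 : E →L[ℂ] E)).orthogonalProjectionOnto v : E) with hg
  have hgm : g ∈ W.eqLocus (1 : E →L[ℂ] E) := Submodule.coe_mem _
  have hWg : W g = g := hgm
  refine ⟨ζ⁻¹, g, by rw [norm_inv, hζ1, inv_one], ?_, ?_, ?_⟩
  · rw [hWa] at hWg
    nth_rewrite 2 [← hWg]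
    rw [smul_smul, inv_mul_cancel₀ (ne_zero_of_norm_one hζ1), one_smul]
  · have : inner ℂ g (v - g) = 0 :=
      Submodule.inner_right_of_mem_orthogonal hgm (Submodule.sub_starProjection_mem_orthogonal v)
    rw [inner_sub_right, sub_eq_zero] at this
    rw [this, inner_self_eq_norm_sq_to_K]; rfl
  · have hκg : κ ≤ ‖g‖ := by
      refine ge_of_tendsto herg.norm ?_
      filter_upwards [eventually_gt_atTop 0] with N hN
      have hN' : (0 : ℝ) < N := by exact_mod_cast hN
      have : birkhoffAverage ℂ W _root_.id N v = (N : ℂ)⁻¹ • A ζ N := by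
        simp only [birkhoffAverage, birkhoffSum, id, hWi, hA]
      rw [this, norm_smul, norm_inv, Complex.norm_natCast, inv_mul_eq_div, le_div_iff₀ hN']
      exact hlow N hN
    calc c ^ 2 / 3 = κ ^ 2 := (Real.sq_sqrt (by positivity)).symm
      _ ≤ _ := by gcongr

section Eigenfunctions
variable {X : Type*} [MeasurableSpace X] {μ : Measure X} {T : Equiv.Perm X}

/-- Unimodular eigenfunctions. -/
structure Eig (μ : Measure X) (T : Equiv.Perm X) (χ : X → ℂ) (z : ℂ) : Prop where
  meas : Measurable χ
  norm_one : ∀ x, ‖χ x‖ = 1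
  eq : ∀ᵐ x ∂μ, χ (T x) = z * χ x
  norm_z : ‖z‖ = 1

namespace Eig

lemma b1 {χ : X → ℂ} {z : ℂ} (h : Eig μ T χ z) : B1 χ := ⟨h.meas, fun x => (h.norm_one x).le⟩

lemma one : Eig μ T (fun _ => 1) 1 := ⟨measurable_const, by simp, by simp, by simp⟩

lemma mul {χ ψ : X → ℂ} {z w : ℂ} (h : Eig μ T χ z) (h' : Eig μ T ψ w) :
    Eig μ T (fun x => χ x * ψ x) (z * w) where
  meas := h.meas.mul h'.meas
  norm_one x := by rw [norm_mul, h.norm_one, h'.norm_one, one_mul]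
  eq := by
    filter_upwards [h.eq, h'.eq] with x hx hx'
    rw [hx, hx']; ring
  norm_z := by rw [norm_mul, h.norm_z, h'.norm_z, one_mul]

lemma star {χ : X → ℂ} {z : ℂ} (h : Eig μ T χ z) : Eig μ T (fun x => conj (χ x)) (conj z) where
  meas := by have := h.meas; fun_prop
  norm_one x := by rw [RCLike.norm_conj, h.norm_one]
  eq := by
    filter_upwards [h.eq] with x hx
    rw [hx, map_mul]
  norm_z := by rw [RCLike.norm_conj, h.norm_z]

lemma zpow (hT : Sys μ T) {χ : X → ℂ} {z : ℂ} (h : Eig μ T χ z) (n : ℤ) :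
    ∀ᵐ x ∂μ, sh T n χ x = z ^ n * χ x := by
  have hz := ne_zero_of_norm_one h.norm_z
  induction n with
  | zero => simp [sh]
  | succ n ih =>
    filter_upwards [hT.mp.quasiMeasurePreserving.ae ih, h.eq] with x hx hx'
    have : sh T ((n : ℤ) + 1) χ x = sh T n χ (T x) := by
      simp only [sh, zpow_add_one, Equiv.Perm.mul_apply]
    rw [this, hx, hx', zpow_add_one₀ hz]; ring
  | pred n ih =>
    filter_upwards [hT.mp'.quasiMeasurePreserving.ae ih,
      hT.mp'.quasiMeasurePreserving.ae h.eq] with x hx hx'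
    have : sh T (-(n : ℤ) - 1) χ x = sh T (-(n : ℤ)) χ (T.symm x) := by
      simp only [sh, zpow_sub_one, Equiv.Perm.mul_apply]; rfl
    rw [Equiv.apply_symm_apply] at hx'
    rw [this, hx, hx', zpow_sub_one₀ hz]; field_simp

end Eig

lemma u2_inverse [IsProbabilityMeasure μ] (hT : Sys μ T) (herg : Ergodic T μ) {F : X → ℂ}
    (hF : B1 F) {c : ℝ} (hc : 0 < c)
    (h : ∃ᶠ H : ℕ in atTop, c ≤ G μ T 1 ((H, ()) : ℕ × Par ℕ 0) F) :
    ∃ χ z, Eig μ T χ z ∧ c ^ 2 / 3 ≤ ‖∫ x, F x * χ x ∂μ‖ ^ 2 := by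
  have hm : MemLp F 2 μ := MemLp.of_bound hF.1.aestronglyMeasurable 1 (ae_of_all _ hF.2)
  set v : Lp ℂ 2 μ := hm.toLp with hv
  set U : Lp ℂ 2 μ →ₗᵢ[ℂ] Lp ℂ 2 μ := Lp.compMeasurePreservingₗᵢ ℂ T hT.mp with hU
  have hUa : ∀ g : Lp ℂ 2 μ, U g =ᵐ[μ] g ∘ T := fun g => Lp.coeFn_compMeasurePreserving g hT.mp
  have hUn : ∀ n : ℕ, (U^[n] v : Lp ℂ 2 μ) =ᵐ[μ] sh T n F := by
    intro n
    induction n with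
    | zero =>
      have : sh T ((0 : ℕ) : ℤ) F = F := sh_zero _
      rw [this]; exact hm.coeFn_toLp
    | succ n ih =>
      rw [Function.iterate_succ_apply']
      filter_upwards [hUa (U^[n] v), hT.mp.quasiMeasurePreserving.ae ih] with x hx hx'
      rw [hx, Function.comp_apply, hx']
      simp only [sh, Nat.cast_succ, zpow_add_one, Equiv.Perm.mul_apply]
  have hin : ∀ a b : ℕ, (inner ℂ (U^[a] v) (U^[b] v) : ℂ) =
      ∫ x, sh T b F x * conj (sh T a F x) ∂μ := by
    intro a b
    rw [L2.inner_def]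
    refine integral_congr_ae ?_
    filter_upwards [hUn a, hUn b] with x hx hx'
    rw [hx, hx', RCLike.inner_apply]
  have hv1 : ‖v‖ ≤ 1 := by
    have h1 : ‖v‖ ^ 2 ≤ 1 := by
      have h2 := hin 0 0
      have h3 : ‖(inner ℂ v v : ℂ)‖ ≤ 1 := by
        have : (inner ℂ v v : ℂ) = ∫ x, sh T (0 : ℕ) F x * conj (sh T (0 : ℕ) F x) ∂μ := h2
        rw [this]
        exact B1.norm_integral_le ((hT.b1_sh hF _).mul (hT.b1_sh hF _).star) μ
      rwa [inner_self_eq_norm_sq_to_K, norm_pow, RCLike.norm_ofReal, abs_norm] at h3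
    nlinarith [norm_nonneg v]
  have hfreq : ∃ᶠ L : ℕ in atTop, c * L ^ 2 ≤ ∑ a ∈ range L, ∑ b ∈ range L,
      ‖inner ℂ (U^[a] v) (U^[b] v)‖ ^ 2 := by
    have ht : Tendsto (fun H : ℕ => 2 * H + 1) atTop atTop :=
      tendsto_atTop_mono (fun H => by show H ≤ 2 * H + 1; omega) tendsto_id
    refine ht.frequently (h.mono fun H hH => ?_)
    have e1 : ∀ f : ℤ → ℝ, 𝔼 h ∈ J H, f h = (∑ a ∈ range (2 * H + 1), f (a - H)) / (2 * H + 1) := by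
      intro f
      rw [Finset.expect_eq_sum_div_card, card_J]
      push_cast
      congr 1
      refine (Finset.sum_bij (fun (a : ℕ) _ => (a : ℤ) - H) ?_ ?_ ?_ ?_).symm
      · intro a ha; simp only [Finset.mem_range] at ha; simp only [J, Finset.mem_Icc]; omega
      · intro a _ b _ hab; omega
      · intro b hb
        simp only [J, Finset.mem_Icc] at hb
        exact ⟨(b + H).toNat, by simp only [Finset.mem_range]; omega, by omega⟩
      · intro a _; rfl
    have e2 : G μ T 1 ((H, ()) : ℕ × Par ℕ 0) F = 𝔼 h ∈ J H, 𝔼 k ∈ J H,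
        ‖∫ x, sh T h F x * conj (sh T k F x) ∂μ‖ ^ 2 := rfl
    rw [e2] at hH
    simp only [e1] at hH
    have e3 : ∀ a b : ℕ, ‖∫ x, sh T ((a : ℤ) - H) F x * conj (sh T ((b : ℤ) - H) F x) ∂μ‖ =
        ‖inner ℂ (U^[b] v) (U^[a] v)‖ := by
      intro a b
      rw [hin, ← hT.integral_sh (-H) (fun x => sh T a F x * conj (sh T b F x))]
      congr 2
      ext x
      simp only [sh, ← Equiv.Perm.mul_apply, ← zpow_add]
      rfl
    simp only [e3, ← Finset.sum_div] at hH
    rw [div_div, le_div_iff₀ (by positivity), Finset.sum_comm] at hH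
    push_cast
    linarith
  obtain ⟨ζ, g, hζ, hg, hgv, hgn⟩ := hilbert_eigenvector U v hv1 hc hfreq
  have hgT : ∀ᵐ x ∂μ, g (T x) = ζ * g x := by
    have h1 := hUa g
    rw [hg] at h1
    filter_upwards [h1, Lp.coeFn_smul ζ g] with x hx hx'
    rw [hx'] at hx
    exact hx.symm
  have hgm : Measurable g := (Lp.stronglyMeasurable g).measurable
  obtain ⟨κ, hκ⟩ := herg.ae_eq_const_of_ae_eq_comp_ae (g := fun x => ‖g x‖)
    hgm.norm.aestronglyMeasurable (by
      filter_upwards [hgT] with x hx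
      rw [Function.comp_apply, hx, norm_mul, hζ, one_mul])
  have hκ0 : 0 ≤ κ := by
    obtain ⟨x, hx⟩ := hκ.exists
    have : ‖g x‖ = κ := hx
    rw [← this]; exact norm_nonneg _
  have hgκ : (‖g‖ : ℂ) ^ 2 = κ ^ 2 := by
    have := inner_self_eq_norm_sq_to_K (𝕜 := ℂ) g
    rw [L2.inner_def] at this
    have h2 : ∫ x, (inner ℂ (g x) (g x) : ℂ) ∂μ = ∫ x, (κ ^ 2 : ℂ) ∂μ := by
      refine integral_congr_ae ?_
      filter_upwards [hκ] with x hx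
      have hx' : ‖g x‖ = κ := hx
      rw [inner_self_eq_norm_sq_to_K, hx']; rfl
    rw [h2, integral_const] at this
    simpa using this.symm
  have hκn : ‖g‖ ^ 2 = κ ^ 2 := by exact_mod_cast hgκ
  have hκ1 : 0 < κ := by
    rcases hκ0.lt_or_eq with h | h
    · exact h
    · rw [hκn, ← h] at hgn
      have : 0 < c ^ 2 / 3 := by positivity
      norm_num at hgn; nlinarith
  obtain ⟨χ, hχ⟩ : ∃ χ : X → ℂ, χ = fun x => if g x = 0 then 1 else g x / ‖g x‖ := ⟨_, rfl⟩
  have hχg : ∀ᵐ x ∂μ, χ x = g x / κ := by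
    filter_upwards [hκ] with x hx
    have hx' : ‖g x‖ = κ := hx
    have : g x ≠ 0 := by intro h0; rw [h0, norm_zero] at hx'; exact hκ1.ne hx'
    rw [hχ]; simp only [this, if_false, hx']
  have hE : Eig μ T χ ζ := by
    refine ⟨?_, fun x => ?_, ?_, hζ⟩
    · rw [hχ]
      exact Measurable.ite (hgm (measurableSet_singleton 0)) measurable_const
        (hgm.div (Complex.measurable_ofReal.comp hgm.norm))
    · rw [hχ]
      by_cases h0 : g x = 0
      · simp [h0]
      · simp [h0]
    · filter_upwards [hχg, hT.mp.quasiMeasurePreserving.ae hχg, hgT] with x h1 h2 h3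
      rw [h1, h2, h3]; ring
  refine ⟨_, _, hE.star, ?_⟩
  have h1 : ∫ x, F x * conj (χ x) ∂μ = κ := by
    have h2 : (κ : ℂ) * ∫ x, F x * conj (χ x) ∂μ = κ ^ 2 := by
      rw [← hgκ, ← hgv, L2.inner_def, ← integral_const_mul]
      refine integral_congr_ae ?_
      filter_upwards [hχg, hm.coeFn_toLp] with x hx hx'
      rw [RCLike.inner_apply, hx, hx', map_div₀, Complex.conj_ofReal]
      have : (κ : ℂ) ≠ 0 := by exact_mod_cast hκ1.ne'
      field_simp
    have : (κ : ℂ) ≠ 0 := by exact_mod_cast hκ1.ne'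
    exact mul_left_cancel₀ this (by rw [h2, pow_two])
  rw [h1, Complex.norm_real, Real.norm_eq_abs, sq_abs, ← hκn]
  exact hgn

end Eigenfunctions

end

section

/-- Polynomial phases of bounded degree. -/
def PolyDeg : ℕ → (ℤ → ℂ) → Prop
  | 0, ω => ∀ n, ω n = ω 0
  | d + 1, ω => ∀ h : ℤ, PolyDeg d (fun n => ω (n + h) / ω n)

lemma geometric {ω : ℤ → ℂ} (hω : ∀ n, ‖ω n‖ = 1) {β : ℂ} (h : ∀ n, ω (n + 1) = β * ω n) (n : ℤ) :
    ω n = β ^ n * ω 0 := by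
  have hβ : β ≠ 0 := by
    rintro rfl
    have := hω (0 + 1)
    rw [h 0] at this; simp at this
  induction n with
  | zero => simp
  | succ n ih => rw [h, ih, zpow_add_one₀ hβ]; ring
  | pred n ih =>
    have := h (-(n : ℤ) - 1)
    rw [sub_add_cancel, ih] at this
    rw [zpow_sub_one₀ hβ]
    field_simp
    linear_combination -this

namespace PolyDeg

lemma const (d : ℕ) {c : ℂ} (hc : c ≠ 0) : PolyDeg d (fun _ => c) := by
  induction d generalizing c with
  | zero => intro n; rfl
  | succ d ih => intro h; simp only [div_self hc]; exact ih one_ne_zero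

lemma mul {d : ℕ} {ω σ : ℤ → ℂ} (h : PolyDeg d ω) (h' : PolyDeg d σ) :
    PolyDeg d (fun n => ω n * σ n) := by
  induction d generalizing ω σ with
  | zero => intro n; simp only [h n, h' n]
  | succ d ih =>
    intro k
    have := ih (h k) (h' k)
    simpa only [div_mul_div_comm] using this

lemma prod {d : ℕ} {ι : Type*} (s : Finset ι) {ω : ι → ℤ → ℂ} (h : ∀ i ∈ s, PolyDeg d (ω i)) :
    PolyDeg d (fun n => ∏ i ∈ s, ω i n) := by
  classical
  induction s using Finset.induction_on with
  | empty => simpa using const d one_ne_zero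
  | insert a s ha ih =>
    simp only [Finset.prod_insert ha]
    exact (h a (Finset.mem_insert_self a s)).mul
      (ih fun i hi => h i (Finset.mem_insert_of_mem hi))

lemma pow {d : ℕ} {ω : ℤ → ℂ} (h : PolyDeg d ω) (Q : ℕ) : PolyDeg d (fun n => ω n ^ Q) := by
  induction d generalizing ω with
  | zero => intro n; simp only [h n]
  | succ d ih => intro k; simpa only [← div_pow] using ih (h k)

/-- Periodic polynomial phases take values in a coset of a finite group. -/
lemma of_periodic {d : ℕ} {ω : ℤ → ℂ} (hω : ∀ n, ‖ω n‖ = 1) (h : PolyDeg d ω) {g : ℕ}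
    (hg : ∀ n, ω (n + g) = ω n) (n : ℤ) : (ω n / ω 0) ^ g ^ d = 1 := by
  have h0 := fun n => ne_zero_of_norm_one (hω n)
  induction d generalizing ω n with
  | zero =>
    have : ω n = ω 0 := h n
    rw [this, div_self (h0 0), one_pow]
  | succ d ih =>
    have h1 := ih (ω := fun n => ω (n + 1) / ω n) (fun n => by rw [norm_div, hω, hω, div_one]) (h 1)
      (fun n => by simp only [show n + g + 1 = n + 1 + g by ring, hg])
    have h2 := fun n => h1 n fun n => div_ne_zero (h0 (n + 1)) (h0 n)
    set β : ℂ := (ω 1 / ω 0) ^ g ^ d with hβ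
    have h3 : ∀ n, ω (n + 1) ^ g ^ d = β * ω n ^ g ^ d := by
      intro n
      have := h2 n
      simp only [zero_add] at this
      rw [div_pow, div_eq_one_iff_eq (pow_ne_zero _ (div_ne_zero (h0 1) (h0 0))), div_pow,
        div_eq_iff (pow_ne_zero _ (h0 n))] at this
      exact this
    have h4 := geometric (ω := fun n => ω n ^ g ^ d)
      (fun n => by rw [norm_pow, hω, one_pow]) h3
    have h5 : β ^ g = 1 := by
      have h6 : ω g ^ g ^ d = β ^ (g : ℤ) * ω 0 ^ g ^ d := h4 g
      have h7 : ω g = ω 0 := by simpa using hg 0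
      rw [h7, zpow_natCast] at h6
      exact mul_right_cancel₀ (pow_ne_zero (g ^ d) (h0 0)) (by rw [one_mul]; exact h6.symm)
    have h8 : ω n ^ g ^ d = β ^ n * ω 0 ^ g ^ d := h4 n
    rw [pow_succ, pow_mul, div_pow, h8, mul_div_cancel_right₀ _ (pow_ne_zero _ (h0 0)),
      ← zpow_natCast, ← zpow_mul, mul_comm, zpow_mul, zpow_natCast, h5, one_zpow]

/-- Polynomial phases valued in a coset of a finite group are periodic. -/
lemma periodic_of {d : ℕ} {σ : ℤ → ℂ} (hσ : ∀ n, ‖σ n‖ = 1) (h : PolyDeg d σ) {K : ℕ}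
    (hK : ∀ n, (σ n / σ 0) ^ K = 1) (n : ℤ) : σ (n + (K ^ d : ℕ)) = σ n := by
  have h0 := fun n => ne_zero_of_norm_one (hσ n)
  have hK' : ∀ m n, σ m ^ K = σ n ^ K := by
    have : ∀ n, σ n ^ K = σ 0 ^ K := fun n => by
      have := hK n
      rwa [div_pow, div_eq_one_iff_eq (pow_ne_zero _ (h0 0))] at this
    intro m n; rw [this m, this n]
  induction d generalizing σ n with
  | zero =>
    have h' : ∀ n, σ n = σ 0 := h
    rw [h' n, h']
  | succ d ih =>
    have h1 := fun n => ih (σ := fun n => σ (n + 1) / σ n)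
      (fun n => by rw [norm_div, hσ, hσ, div_one]) (h 1)
      (fun n => by simp only [div_pow]; rw [hK' (n + 1) n, hK' (0 + 1) 0,
        div_self (pow_ne_zero _ (h0 _)), div_self (pow_ne_zero _ (h0 _)), div_one]) n
      (fun n => div_ne_zero (h0 (n + 1)) (h0 n))
      (fun m n => by simp only [div_pow]; rw [hK' (m + 1) m, hK' (n + 1) n,
        div_self (pow_ne_zero _ (h0 _)), div_self (pow_ne_zero _ (h0 _))])
    set L : ℕ := K ^ d with hL
    have h2 : ∀ n : ℤ, σ (n + L) = (σ L / σ 0) * σ n := by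
      have h3 : ∀ n : ℤ, (fun n : ℤ => σ (n + L) / σ n) (n + 1) =
          1 * (fun n : ℤ => σ (n + L) / σ n) n := by
        intro n
        have := h1 n
        simp only at this ⊢
        rw [div_eq_div_iff (h0 _) (h0 _)] at this
        rw [one_mul, div_eq_div_iff (h0 _) (h0 _), show n + 1 + (L : ℤ) = n + L + 1 by ring, this]
        ring
      intro n
      have := geometric (ω := fun n : ℤ => σ (n + L) / σ n)
        (fun n => by rw [norm_div, hσ, hσ, div_one]) h3 n
      simp only [one_zpow, one_mul, zero_add] at this
      rw [← this, div_mul_cancel₀ _ (h0 n)]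
    have h4 : ∀ (j : ℕ) (n : ℤ), σ (n + (L * j : ℕ)) = (σ L / σ 0) ^ j * σ n := by
      intro j
      induction j with
      | zero => simp
      | succ j ih' =>
        intro n
        have : n + ((L * (j + 1) : ℕ) : ℤ) = n + (L * j : ℕ) + L := by push_cast; ring
        rw [this, h2, ih', pow_succ]; ring
    rw [pow_succ, h4, hK, one_mul]

end PolyDeg

lemma exists_difference (M : InvMean) {ω : ℤ → ℂ} (hω : ∀ n, ‖ω n‖ = 1) {c : ℝ} (hc : 0 < c)
    (h : c ≤ ‖M.m ω‖) {H : ℕ} (hH : 1 / (2 * (H : ℝ) + 1) < c ^ 2 / 2) :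
    ∃ g : ℤ, g ≠ 0 ∧ g.natAbs ≤ 2 * H ∧ c ^ 2 / 2 ≤ ‖M.m (fun n => ω (n + g) / ω n)‖ := by
  have h1 := vdC (μ := Measure.dirac ()) M (f₀ := fun _ => 1) (v := fun n _ => ω n) B1.one
    (fun n => ⟨measurable_const, fun _ => (hω n).le⟩) (J_nonempty H)
  simp only [one_mul, integral_dirac] at h1
  by_contra hcon
  push Not at hcon
  have hdiv : ∀ m n, ω m * conj (ω n) = ω m / ω n := fun m n => by
    rw [conj_eq_inv (hω n), div_eq_mul_inv]
  have hb : ∀ n m, ‖ω n / ω m‖ ≤ 1 := fun n m => by rw [norm_div, hω, hω, div_one]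
  have h2 : ∀ h ∈ J H, ∀ h' ∈ J H, ‖M.m (fun n => ω (n + h) * conj (ω (n + h')))‖ ≤
      (if h = h' then 1 else 0) + c ^ 2 / 2 := by
    intro h hh h' hh'
    simp only [J, Finset.mem_Icc] at hh hh'
    simp only [hdiv]
    by_cases heq : h = h'
    · subst heq
      rw [if_pos rfl]
      refine (M.norm_le _ 1 fun n => hb _ _).trans ?_
      nlinarith
    · rw [if_neg heq, zero_add]
      have h3 := hcon (h - h') (sub_ne_zero.mpr heq) (by omega)
      rw [← M.shift _ 1 h' (fun n => hb _ _)] at h3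
      have e : ∀ n : ℤ, n + h' + (h - h') = n + h := fun n => by omega
      simp only [e] at h3
      exact h3.le
  have h4 : 𝔼 h ∈ J H, 𝔼 h' ∈ J H, ((if h = h' then 1 else 0) + c ^ 2 / 2 : ℝ) =
      1 / (2 * (H : ℝ) + 1) + c ^ 2 / 2 := by
    have : ∀ h ∈ J H, 𝔼 h' ∈ J H, ((if h = h' then 1 else 0) + c ^ 2 / 2 : ℝ) =
        1 / (2 * (H : ℝ) + 1) + c ^ 2 / 2 := by
      intro h hh
      rw [Finset.expect_add_distrib, Finset.expect_const (J_nonempty H),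
        Finset.expect_eq_sum_div_card, Finset.sum_ite_eq, if_pos hh, card_J]
      push_cast; rfl
    rw [Finset.expect_congr rfl this, Finset.expect_const (J_nonempty H)]
  have h5 := h1.trans (Finset.expect_le_expect fun h hh => Finset.expect_le_expect fun h' hh' =>
    h2 h hh h' hh')
  rw [h4] at h5
  have h6 : c ^ 2 ≤ ‖M.m fun n => ω n‖ ^ 2 := by gcongr
  linarith


/-- Polynomial phases with large mean value have a bounded order. -/
lemma polyDeg_weyl (d : ℕ) : ∀ c : ℝ, 0 < c → ∃ Q : ℕ, 0 < Q ∧ ∀ (M : InvMean) (ω : ℤ → ℂ),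
    (∀ n, ‖ω n‖ = 1) → PolyDeg d ω → c ≤ ‖M.m ω‖ → ∀ n, (ω n / ω 0) ^ Q = 1 := by
  induction d with
  | zero =>
    refine fun c _ => ⟨1, one_pos, fun M ω hω hd _ n => ?_⟩
    have h' : ∀ n, ω n = ω 0 := hd
    rw [h' n, div_self (ne_zero_of_norm_one (hω 0)), one_pow]
  | succ d ih =>
    intro c hc
    obtain ⟨Q', hQ', hI⟩ := ih (c ^ 2 / 2) (by positivity)
    obtain ⟨H, hH⟩ := exists_nat_gt (1 / (c ^ 2 / 2))
    have hH' : 1 / (2 * (H : ℝ) + 1) < c ^ 2 / 2 := by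
      have hp : (0 : ℝ) < c ^ 2 / 2 := by positivity
      rw [div_lt_iff₀ hp] at hH
      rw [div_lt_iff₀ (by positivity)]
      have : (0 : ℝ) ≤ (H : ℝ) * (c ^ 2 / 2) := by positivity
      nlinarith
    obtain ⟨Q3, hQ3⟩ : ∃ Q3 : ℕ → ℕ, ∀ g, Q3 g = Q' * g ^ d := ⟨_, fun _ => rfl⟩
    have hQ3' : ∀ g, 0 < g → 0 < Q3 g := fun g hg => by rw [hQ3]; positivity
    refine ⟨∏ g ∈ Finset.Icc 1 (2 * H), (Q3 g * Q3 g ^ d), Finset.prod_pos fun g hg => ?_, ?_⟩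
    · have := hQ3' g (by simp only [Finset.mem_Icc] at hg; omega)
      positivity
    intro M ω hω hd hm n
    have h0 := fun n => ne_zero_of_norm_one (hω n)
    obtain ⟨g, hg0, hgH, hg⟩ := exists_difference M hω hc hm hH'
    have h1 := hI M (fun n => ω (n + g) / ω n) (fun n => by rw [norm_div, hω, hω, div_one]) (hd g) hg
    simp only [zero_add] at h1
    set G := g.natAbs with hG
    have hGpos : 0 < G := Int.natAbs_pos.mpr hg0
    obtain ⟨δ, hδ⟩ : ∃ δ : ℤ → ℂ, δ = fun n => ω (n + 1) / ω n := ⟨_, rfl⟩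
    have hδ1 : ∀ n, ‖δ n‖ = 1 := fun n => by rw [hδ]; simp only [norm_div, hω, div_one]
    have hδ0 := fun n => ne_zero_of_norm_one (hδ1 n)
    have hδd : PolyDeg d δ := by rw [hδ]; exact hd 1
    have hper : ∀ n, δ (n + g) ^ Q' = δ n ^ Q' := by
      intro n
      have a1 := h1 n
      have a2 := h1 (n + 1)
      rw [div_pow, div_eq_one_iff_eq (pow_ne_zero _ (div_ne_zero (h0 _) (h0 _)))] at a1 a2
      rw [← a1, div_pow, div_pow, div_eq_div_iff (pow_ne_zero _ (h0 _)) (pow_ne_zero _ (h0 _))] at a2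
      rw [hδ]
      simp only [div_pow]
      rw [div_eq_div_iff (pow_ne_zero _ (h0 _)) (pow_ne_zero _ (h0 _)),
        show n + g + 1 = n + 1 + g by ring, a2, mul_comm]
    have hper' : ∀ n, δ (n + G) ^ Q' = δ n ^ Q' := by
      intro n
      rcases Int.natAbs_eq g with h | h
      · rw [← hG] at h; rw [← h]; exact hper n
      · rw [← hG] at h
        have := hper (n + G)
        rw [h, add_neg_cancel_right] at this
        exact this.symm
    have h2 : ∀ n, (δ n / δ 0) ^ Q3 G = 1 := by
      intro n
      have := (hδd.pow Q').of_periodic (fun n => by rw [norm_pow, hδ1, one_pow]) hper' n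
      rwa [hQ3, pow_mul, div_pow]
    have h3 := hδd.periodic_of hδ1 h2
    set L : ℕ := Q3 G ^ d with hL
    have h4 : ∀ n : ℤ, ω (n + L) / ω n = ω L / ω 0 := by
      intro n
      have := geometric (ω := fun n : ℤ => ω (n + L) / ω n) (β := 1)
        (fun n => by rw [norm_div, hω, hω, div_one]) (fun n => by
          have := h3 n
          rw [hδ] at this
          simp only at this
          rw [div_eq_div_iff (h0 _) (h0 _)] at this
          rw [one_mul, div_eq_div_iff (h0 _) (h0 _), show n + 1 + (L : ℤ) = n + L + 1 by ring, this]
          ring) n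
      simpa using this
    have h5 : ω L / ω 0 = 1 := by
      have e : (fun n : ℤ => ω (n + L)) = fun n => (ω L / ω 0) * ω n := by
        ext n; rw [← h4 n, div_mul_cancel₀ _ (h0 n)]
      have h6 := M.shift ω 1 L fun n => (hω n).le
      rw [e, M.const_mul] at h6
      have h7 : M.m ω ≠ 0 := by
        intro h; rw [h, norm_zero] at hm; linarith
      exact mul_right_cancel₀ h7 (by rw [h6, one_mul])
    have h6 := geometric (ω := fun n : ℤ => ω n ^ Q3 G) (β := δ 0 ^ Q3 G)
      (fun n => by rw [norm_pow, hω, one_pow]) (fun n => by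
        have := h2 n
        rw [div_pow, div_eq_one_iff_eq (pow_ne_zero _ (hδ0 0))] at this
        rw [← this, hδ, ← mul_pow]
        simp only [div_mul_cancel₀ _ (h0 n)])
    have h7 : (δ 0 ^ Q3 G) ^ L = 1 := by
      have h8 := h6 L
      rw [div_eq_one_iff_eq (h0 0)] at h5
      rw [h5, zpow_natCast] at h8
      exact mul_right_cancel₀ (pow_ne_zero (Q3 G) (h0 0)) (by rw [one_mul]; exact h8.symm)
    have h8 : (ω n / ω 0) ^ (Q3 G * L) = 1 := by
      have h9 := h6 n
      rw [pow_mul, div_pow, h9, mul_div_cancel_right₀ _ (pow_ne_zero _ (h0 0)), ← zpow_natCast,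
        ← zpow_mul, mul_comm, zpow_mul, zpow_natCast, h7, one_zpow]
    obtain ⟨r, hr⟩ := Finset.dvd_prod_of_mem (fun g => Q3 g * Q3 g ^ d)
      (show G ∈ Finset.Icc 1 (2 * H) by simp only [Finset.mem_Icc]; omega)
    rw [hr, pow_mul, h8, one_pow]

end

section

lemma polyDeg_of_rep {z : ℂ} (hz : ‖z‖ = 1) (d : ℕ) : ∀ {q : Polynomial ℚ} {P : ℤ → ℤ},
    Rep q P → q.natDegree ≤ d → PolyDeg d (fun n => z ^ P n) := by
  have hz0 : z ≠ 0 := ne_zero_of_norm_one hz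
  induction d with
  | zero =>
    intro q P hq hd n
    simp only [hq.const_of_natDegree_eq_zero (Nat.le_zero.1 hd) n]
  | succ d ih =>
    intro q P hq hd h
    have hr := hq.taylor_sub hq h 0
    have : (fun n => z ^ P (n + h) / z ^ P n) = fun n => z ^ (P (n + h) - P (n + 0)) := by
      funext n; rw [add_zero, zpow_sub₀ hz0]
    rw [this]
    refine ih hr ?_
    simp only [Int.cast_zero, Polynomial.taylor_zero]
    rcases Nat.eq_zero_or_pos q.natDegree with h0 | h0
    · rw [Polynomial.eq_C_of_natDegree_eq_zero h0]; simp
    · have := natDegree_sub_lt_of_eq (p := Polynomial.taylor (h : ℚ) q) (r := q)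
        (by simp) (by simpa using h0) (by simp)
      simp only [Polynomial.natDegree_taylor] at this
      omega

lemma exists_multiple_mem_closure {ι : Type*} [Fintype ι] [DecidableEq ι] (V : Set (ι → ℤ))
    (hV : ∀ c : ι → ℤ, c ≠ 0 → ∃ v ∈ V, ∑ i, c i * v i ≠ 0) :
    ∃ l : ℕ, 0 < l ∧ ∀ j, (l • Pi.single j 1 : ι → ℤ) ∈ AddSubgroup.closure V := by
  let cst : (ι → ℤ) → ι → ℚ := fun v i => v i
  have htop : Submodule.span ℚ (cst '' V) = ⊤ := by
    by_contra hne
    obtain ⟨f, hf0, hf⟩ := Submodule.exists_le_ker_of_lt_top _ (lt_top_iff_ne_top.2 hne)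
    obtain ⟨b, hb⟩ := IsLocalization.exist_integer_multiples_of_finite (nonZeroDivisors ℤ)
      (fun i => f (Pi.single i 1))
    choose c hc using hb
    have hb0 : ((b : ℤ) : ℚ) ≠ 0 := by
      exact_mod_cast nonZeroDivisors.ne_zero b.2
    have hfx : ∀ x : ι → ℚ, f x = ∑ i, x i * f (Pi.single i 1) := fun x => by
      conv_lhs => rw [pi_eq_sum_univ' x]
      rw [map_sum]
      refine Finset.sum_congr rfl fun i _ => ?_
      rw [map_smul, smul_eq_mul]
    have hc' : ∀ i, (c i : ℚ) = b * f (Pi.single i 1) := fun i => by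
      have := hc i
      simpa [Algebra.smul_def] using this
    have hcne : c ≠ 0 := by
      rintro rfl
      apply hf0
      ext i
      have := hc' i
      simp only [Pi.zero_apply, Int.cast_zero, zero_eq_mul, hb0, false_or] at this
      simpa using this
    obtain ⟨v, hv, hv'⟩ := hV c hcne
    apply hv'
    have h0 : f (cst v) = 0 := hf (Submodule.subset_span ⟨v, hv, rfl⟩)
    rw [hfx] at h0
    have : ((∑ i, c i * v i : ℤ) : ℚ) = b * ∑ i, cst v i * f (Pi.single i 1) := by
      push_cast
      rw [Finset.mul_sum]
      refine Finset.sum_congr rfl fun i _ => ?_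
      rw [hc' i]; simp only [cst]; ring
    rw [h0, mul_zero] at this
    exact_mod_cast this
  have key : ∀ x ∈ Submodule.span ℚ (cst '' V), ∃ l : ℕ, 0 < l ∧
      ∃ y ∈ AddSubgroup.closure V, (l : ℚ) • x = cst y := by
    intro x hx
    induction hx using Submodule.span_induction with
    | mem x hx =>
      obtain ⟨v, hv, rfl⟩ := hx
      exact ⟨1, one_pos, v, AddSubgroup.subset_closure hv, by simp⟩
    | zero => exact ⟨1, one_pos, 0, zero_mem _, by ext i; simp [cst]⟩
    | add x y _ _ hx hy =>
      obtain ⟨l, hl, u, hu, hxu⟩ := hx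
      obtain ⟨m, hm, v, hv, hyv⟩ := hy
      refine ⟨l * m, by positivity, m • u + l • v,
        add_mem (AddSubgroup.nsmul_mem _ hu _) (AddSubgroup.nsmul_mem _ hv _), ?_⟩
      ext i
      have h1 := congrFun hxu i
      have h2 := congrFun hyv i
      simp only [cst, Pi.smul_apply, smul_eq_mul, Pi.add_apply] at h1 h2 ⊢
      push_cast
      simp only [nsmul_eq_mul, Int.cast_mul, Int.cast_natCast]
      rw [← h1, ← h2]; ring
    | smul a x _ hx =>
      obtain ⟨l, hl, u, hu, hxu⟩ := hx
      refine ⟨l * a.den, Nat.mul_pos hl a.den_pos, a.num • u, AddSubgroup.zsmul_mem _ hu _, ?_⟩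
      ext i
      have h1 := congrFun hxu i
      simp only [cst, Pi.smul_apply, smul_eq_mul] at h1 ⊢
      push_cast
      rw [← h1]
      have := Rat.mul_den_eq_num a
      rw [← this]; ring
  have key' : ∀ j : ι, ∃ l : ℕ, 0 < l ∧
      (l • Pi.single j 1 : ι → ℤ) ∈ AddSubgroup.closure V := by
    intro j
    obtain ⟨l, hl, y, hy, h⟩ := key (Pi.single j 1) (htop ▸ Submodule.mem_top)
    refine ⟨l, hl, ?_⟩
    convert hy using 1
    ext i
    have h1 := congrFun h i
    simp only [cst, Pi.smul_apply, smul_eq_mul] at h1 ⊢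
    rw [Pi.single_apply] at h1 ⊢
    have h2 : (((l : ℤ) * if i = j then 1 else 0 : ℤ) : ℚ) = y i := by
      rw [← h1]; push_cast; rfl
    rw [nsmul_eq_mul]
    exact_mod_cast h2
  choose l hl h using key'
  refine ⟨∏ j, l j, Finset.prod_pos fun j _ => hl j, fun j => ?_⟩
  rw [← Finset.prod_erase_mul _ _ (Finset.mem_univ j), mul_smul]
  exact AddSubgroup.nsmul_mem _ (h j) _

/-- A rationally independent family of integer polynomials. -/
structure Fam {ι : Type*} [Fintype ι] (p : ι → ℤ → ℤ) : Prop where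
  rep : ∀ i, ∃ q : Polynomial ℚ, Rep q (p i)
  ind : ∀ c : ι → ℤ, c ≠ 0 → ¬ ∃ C : ℤ, ∀ n : ℤ, (∑ i, c i * p i n) = C

lemma weyl_indep {ι : Type*} [Fintype ι] {p : ι → ℤ → ℤ} (hp : Fam p) (c : ℝ) (hc : 0 < c) :
    ∃ Q : ℕ, 0 < Q ∧ ∀ (M : InvMean) (z : ι → ℂ), (∀ j, ‖z j‖ = 1) →
      c ≤ ‖M.m (fun n => ∏ j, z j ^ p j n)‖ → ∀ j, z j ^ Q = 1 := by
  classical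
  choose q hq using hp.rep
  obtain ⟨Q, hQ, hW⟩ := polyDeg_weyl (Finset.univ.sup fun i => (q i).natDegree) c hc
  obtain ⟨l, hl, hcl⟩ := exists_multiple_mem_closure
    (Set.range fun n : ℤ => fun i => p i n - p i 0) (by
      intro a ha
      by_contra! hcon
      refine hp.ind a ha ⟨∑ i, a i * p i 0, fun n => ?_⟩
      have := hcon _ ⟨n, rfl⟩
      simp only [mul_sub, Finset.sum_sub_distrib] at this
      linarith)
  refine ⟨Q * l, Nat.mul_pos hQ hl, fun M z hz hlarge j => ?_⟩
  have hz0 : ∀ i, z i ≠ 0 := fun i => ne_zero_of_norm_one (hz i)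
  have h1 := hW M _ (fun n => by simp [norm_prod, hz])
    (PolyDeg.prod Finset.univ fun i _ => polyDeg_of_rep (hz i) _ (hq i)
      (Finset.le_sup (f := fun i => (q i).natDegree) (Finset.mem_univ i))) hlarge
  have h2 : ∀ x ∈ AddSubgroup.closure (Set.range fun n : ℤ => fun i => p i n - p i 0),
      (∏ i, z i ^ x i) ^ Q = 1 := by
    intro x hx
    induction hx using AddSubgroup.closure_induction with
    | mem x hx =>
      obtain ⟨n, rfl⟩ := hx
      rw [← h1 n, ← Finset.prod_div_distrib]
      simp only [zpow_sub₀ (hz0 _)]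
    | zero => simp
    | add x y _ _ hx hy =>
      simp only [Pi.add_apply, zpow_add₀ (hz0 _), Finset.prod_mul_distrib, mul_pow, hx, hy, one_mul]
    | neg x _ hx =>
      simp only [Pi.neg_apply, zpow_neg, Finset.prod_inv_distrib, inv_pow, hx, inv_one]
  have h3 := h2 _ (hcl j)
  have : ∏ i, z i ^ (l • Pi.single j 1 : ι → ℤ) i = z j ^ l := by
    rw [Finset.prod_eq_single j]
    · simp
    · intro i _ hi; simp [hi]
    · simp
  rw [this, ← pow_mul, mul_comm] at h3
  exact h3

end

section

open Classical in
/-- The real valued indicator of a proposition. -/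
noncomputable def ind (P : Prop) : ℝ := if P then 1 else 0

lemma ind_of {P : Prop} (h : P) : ind P = 1 := if_pos h
lemma ind_not {P : Prop} (h : ¬P) : ind P = 0 := if_neg h

lemma ind_nonneg (P : Prop) : 0 ≤ ind P := by
  by_cases h : P
  · simp [ind_of h]
  · simp [ind_not h]

lemma ind_mono {P Q : Prop} (h : P → Q) : ind P ≤ ind Q := by
  by_cases hP : P
  · rw [ind_of hP, ind_of (h hP)]
  · rw [ind_not hP]; exact ind_nonneg Q

lemma markov {ι : Type*} {s : Finset ι} (hs : s.Nonempty) {f : ι → ℝ} (hf : ∀ i ∈ s, f i ≤ 1)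
    {c : ℝ} (hc : 0 ≤ c) (h : c ≤ 𝔼 i ∈ s, f i) : c / 2 ≤ 𝔼 i ∈ s, ind (c / 2 ≤ f i) := by
  have h1 : 𝔼 i ∈ s, f i ≤ 𝔼 i ∈ s, (ind (c / 2 ≤ f i) + c / 2) := by
    refine Finset.expect_le_expect fun i hi => ?_
    by_cases h : c / 2 ≤ f i
    · rw [ind_of h]; linarith [hf i hi]
    · rw [ind_not h]; linarith
  rw [Finset.expect_add_distrib, Finset.expect_const hs] at h1
  linarith

variable {X : Type*} [MeasurableSpace X] {μ : Measure X} {T : Equiv.Perm X}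

lemma Eig.cube {t : ℕ} {χ : Par ℤ t → X → ℂ} {z : Par ℤ t → ℂ} (h : ∀ u, Eig μ T (χ u) (z u))
    (u v : Par ℤ t) : Eig μ T (fun x => cube t (fun u => χ u x) u v) (cube t z u v) := by
  induction t with
  | zero => exact h _
  | succ t ih =>
    have := ih (χ := fun s x => χ ((u.1, s) : ℤ × Par ℤ t) x * conj (χ ((v.1, s) : ℤ × Par ℤ t) x))
      (fun s => (h _).mul (h _).star) u.2 v.2
    exact this

lemma cube_ne_zero {t : ℕ} {a : Par ℤ t → ℂ} {h k : Par ℤ t} (hc : cube t a h k ≠ 0) :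
    a h ≠ 0 := by
  induction t with
  | zero => exact hc
  | succ t ih =>
    have := ih (a := fun u => a ((h.1, u) : ℤ × Par ℤ t) * conj (a ((k.1, u) : ℤ × Par ℤ t))) hc
    exact left_ne_zero_of_mul this

lemma cube_prod {ι : Type*} (s : Finset ι) (t : ℕ) (a : ι → Par ℤ t → ℂ) (h k : Par ℤ t) :
    cube t (fun u => ∏ i ∈ s, a i u) h k = ∏ i ∈ s, cube t (a i) h k := by
  classical
  induction s using Finset.induction_on with
  | empty =>
    simp only [Finset.prod_empty]
    rcases t with _ | t
    · rfl
    · exact cube_const t (by simp) h k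
  | insert i s hi ih => simp only [Finset.prod_insert hi, cube_mul, ih]

variable {ι : Type} [Fintype ι] [DecidableEq ι] {p : ι → ℤ → ℤ}

/-- Large correlations along the family `p`, with the functions outside of `S` being
eigenfunctions, force all eigenvalues to be roots of unity of bounded order. -/
def MainClaim (μ : Measure X) (T : Equiv.Perm X) (p : ι → ℤ → ℤ) (S : Finset ι) : Prop :=
  ∀ c : ℝ, 0 < c → ∃ Q : ℕ, 0 < Q ∧ ∀ (M : InvMean) (z : ι → ℂ) (f₀ : X → ℂ) (f : ι → X → ℂ),
    (∀ j, ‖z j‖ = 1) → B1 f₀ → (∀ i, B1 (f i)) →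
    c ≤ ‖M.m (fun n => (∏ j ∈ Sᶜ, z j ^ p j n) *
      ∫ x, f₀ x * ∏ i ∈ S, sh T (p i n) (f i) x ∂μ)‖ →
    (∀ j, j ∉ S → z j ^ Q = 1) ∧ ∃ ρ w, Eig μ T ρ w ∧ w ^ Q = 1 ∧ ∫ x, f₀ x * ρ x ∂μ ≠ 0

/-- Dual functions for the slot `m` of the family `p`. -/
def IsDual (μ : Measure X) (T : Equiv.Perm X) (p : ι → ℤ → ℤ) (S : Finset ι) (m : ι)
    (E : X → ℂ) : Prop :=
  B1 E ∧ ∃ (M : InvMean) (W : ℤ → ℂ) (f₀ : X → ℂ) (f : ι → X → ℂ), (∀ n, ‖W n‖ = 1) ∧ B1 f₀ ∧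
    (∀ i, B1 (f i)) ∧ ∀ g, B1 g → ∫ x, E x * g x ∂μ = M.m (fun n => ∫ x,
      (W n * sh T (-p m n) (fun y => f₀ y * ∏ i ∈ S, sh T (p i n) (f i) y) x) * g x ∂μ)

lemma integral_sh_mul (hT : Sys μ T) (s : ℤ) (f g : X → ℂ) :
    ∫ x, sh T s f x * g x ∂μ = ∫ x, f x * sh T (-s) g x ∂μ := by
  rw [← hT.integral_sh s (fun x => f x * sh T (-s) g x)]
  congr 1; ext x
  simp only [sh, ← Equiv.Perm.mul_apply, ← zpow_add]
  simp

lemma IsDual.cube_roots [IsProbabilityMeasure μ] (hT : Sys μ T) {S : Finset ι} {m : ι} (hm : m ∉ S)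
    (hMC : MainClaim μ T p S) (t : ℕ) (c : ℝ) (hc : 0 < c) :
    ∃ c' : ℝ, 0 < c' ∧ ∃ Q : ℕ, 0 < Q ∧ ∀ E, IsDual μ T p S m E → ∀ (H : Par ℕ (t + 1))
      (w : Par ℤ (t + 1) → ℂ) (χ : Par ℤ (t + 1) → X → ℂ) (z : Par ℤ (t + 1) → ℂ)
      (l : Par ℤ (t + 1) → X → ℂ), (∀ u, ‖w u‖ ≤ 1) → (∀ u, Eig μ T (χ u) (z u)) → LO (t + 1) l →
      c ≤ ‖𝔼 u ∈ bx (t + 1) H, ∫ x, sh T (su (t + 1) u) E x * (w u * χ u x * l u x) ∂μ‖ →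
      c' ≤ 𝔼 h ∈ bx (t + 1) H, 𝔼 k ∈ bx (t + 1) H,
        ind (w h ≠ 0 ∧ cube (t + 1) z h k ^ Q = 1) := by
  have hc1 : 0 < c ^ 2 ^ (t + 1) / 2 := by positivity
  obtain ⟨Q, hQ, hMC⟩ := hMC _ hc1
  refine ⟨c ^ 2 ^ (t + 1) / 2, hc1, Q, hQ, ?_⟩
  rintro E ⟨hE, M, W, f₀, f, hW, hf₀, hf, hdual⟩ H w χ z l hw hχ hl hlarge
  set F : ℤ → X → ℂ := fun n x =>
    W n * sh T (-p m n) (fun y => f₀ y * ∏ i ∈ S, sh T (p i n) (f i) y) x with hF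
  have hFB : ∀ n, B1 (F n) := fun n => ((hT.b1_sh (hf₀.mul
    (B1.prod S fun i _ => hT.b1_sh (hf i) _)) _).const_mul (hW n).le)
  have hwχ : ∀ u, B1 (fun x => w u * χ u x) := fun u => (hχ u).b1.const_mul (hw u)
  have haB : ∀ n u, B1 (fun x => sh T (su (t + 1) u) (F n) x * (w u * χ u x)) := fun n u =>
    (hT.b1_sh (hFB n) _).mul (hwχ u)
  have e1 : 𝔼 u ∈ bx (t + 1) H, ∫ x, sh T (su (t + 1) u) E x * (w u * χ u x * l u x) ∂μ =
      M.m (fun n => 𝔼 u ∈ bx (t + 1) H,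
        ∫ x, (sh T (su (t + 1) u) (F n) x * (w u * χ u x)) * l u x ∂μ) := by
    rw [M.expect]
    refine Finset.expect_congr rfl fun u _ => ?_
    rw [integral_sh_mul hT, hdual _ (hT.b1_sh ((hwχ u).mul (hl.b1 u)) _)]
    congr 1; ext n
    rw [← integral_sh_mul hT]
    congr 1; ext x; ring
  have hb : ∀ n, ‖𝔼 u ∈ bx (t + 1) H,
      ∫ x, (sh T (su (t + 1) u) (F n) x * (w u * χ u x)) * l u x ∂μ‖ ≤ 1 := fun n =>
    norm_expect_le_of_le zero_le_one fun u _ => ((haB n u).mul (hl.b1 u)).norm_integral_le μ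
  have hcubeB : ∀ n h k, B1 (fun x => cube (t + 1)
      (fun u => sh T (su (t + 1) u) (F n) x * (w u * χ u x)) h k) := fun n h k =>
    B1.cube (haB n) h k
  have h2 : c ^ 2 ^ (t + 1) ≤ (M.m (fun n => 𝔼 h ∈ bx (t + 1) H, 𝔼 k ∈ bx (t + 1) H,
      ∫ x, cube (t + 1) (fun u => sh T (su (t + 1) u) (F n) x * (w u * χ u x)) h k ∂μ)).re := by
    rw [e1] at hlarge
    refine (pow_le_pow_left₀ hc.le hlarge _).trans ((M.jensen_pow (t + 1) hb).trans ?_)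
    refine M.mono (C := 1) (D := 1) (fun n => ?_) (fun n => ?_) (fun n => ?_)
    · rw [Complex.norm_real, Real.norm_of_nonneg (by positivity)]
      exact pow_le_one₀ (norm_nonneg _) (hb n)
    · exact norm_expect_le_of_le zero_le_one fun h _ => norm_expect_le_of_le zero_le_one
        fun k _ => (hcubeB n h k).norm_integral_le μ
    · rw [Complex.ofReal_re]
      exact gcs t H _ l (haB n) hl
  have hcubeχ := fun h k => Eig.cube hχ h k
  have h3 : ∀ h k, M.m (fun n => ∫ x, cube (t + 1)
        (fun u => sh T (su (t + 1) u) (F n) x * (w u * χ u x)) h k ∂μ) =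
      cube (t + 1) w h k * M.m (fun n => cube (t + 1) z h k ^ p m n *
        ∫ x, (cube (t + 1) (fun u => sh T (su (t + 1) u) f₀ x) h k *
          cube (t + 1) (fun u => χ u x) h k) *
          ∏ i ∈ S, sh T (p i n)
            (fun x => cube (t + 1) (fun u => sh T (su (t + 1) u) (f i) x) h k) x ∂μ) := by
    intro h k
    rw [← M.const_mul]
    congr 1; ext n
    rw [← integral_const_mul, ← integral_const_mul,
      ← hT.integral_sh (-p m n) (fun x => cube (t + 1) w h k * (_ * _))]
    refine integral_congr_ae ?_
    filter_upwards [(hcubeχ h k).zpow hT (-p m n)] with x hx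
    simp only [cube_mul, hF, sh, cube_const t (hW n), one_mul, cube_prod] at hx ⊢
    rw [hx, zpow_neg (cube (t + 1) z h k)]
    have hz : cube (t + 1) z h k ^ p m n ≠ 0 :=
      zpow_ne_zero _ (ne_zero_of_norm_one (hcubeχ h k).norm_z)
    simp only [← Equiv.Perm.mul_apply, ← zpow_add, add_comm, ← add_assoc]
    field_simp
  have h4 : c ^ 2 ^ (t + 1) ≤ 𝔼 v ∈ bx (t + 1) H ×ˢ bx (t + 1) H,
      ‖M.m (fun n => ∫ x, cube (t + 1)
        (fun u => sh T (su (t + 1) u) (F n) x * (w u * χ u x)) v.1 v.2 ∂μ)‖ := by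
    rw [Finset.expect_product]
    refine h2.trans ((Complex.re_le_norm _).trans ?_)
    simp only [M.expect]
    exact (norm_expect_le _ _).trans (Finset.expect_le_expect fun h _ => norm_expect_le _ _)
  have h5 := markov ((bx_nonempty (t + 1) H).product (bx_nonempty (t + 1) H)) (fun v _ =>
    M.norm_le _ 1 (fun n => (hcubeB n v.1 v.2).norm_integral_le μ)) (by positivity) h4
  rw [Finset.expect_product] at h5
  refine h5.trans (Finset.expect_le_expect fun h _ => Finset.expect_le_expect fun k _ =>
    ind_mono fun hbig => ?_)
  simp only at hbig
  rw [h3, norm_mul] at hbig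
  have hcw : ‖cube (t + 1) w h k‖ ≤ 1 := norm_cube_le _ _ hw _ _
  refine ⟨cube_ne_zero (k := k) (fun h0 => ?_), ?_⟩
  · rw [h0] at hbig; simp at hbig; linarith
  have hbig' := hbig.trans (mul_le_of_le_one_left (norm_nonneg _) hcw)
  have hz1 := (hcubeχ h k).norm_z
  obtain ⟨hroot, -⟩ := hMC M (Function.update (fun _ => 1) m (cube (t + 1) z h k)) _ _ (fun j => by
      by_cases hj : j = m
      · subst hj; simpa using hz1
      · simp [hj])
    ((B1.cube (fun u => hT.b1_sh hf₀ _) h k).mul (hcubeχ h k).b1)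
    (fun i => B1.cube (fun u => hT.b1_sh (hf i) _) h k) (hbig'.trans_eq (by
      congr 2; ext n
      congr 1
      rw [Finset.prod_eq_single m]
      · simp
      · intro j _ hj; simp [hj]
      · simp [hm]))
  simpa using hroot m hm

end

section

variable {X : Type*} [MeasurableSpace X] {μ : Measure X} {T : Equiv.Perm X}

lemma G_ge_of_LO [IsProbabilityMeasure μ] (hT : Sys μ T) (t : ℕ) (H : Par ℕ (t + 1)) {E ρ : X → ℂ}
    (hE : B1 E) (hρ : B1 ρ) {l : Par ℤ (t + 1) → X → ℂ} (hl : LO (t + 1) l) {c : ℝ} (hc : 0 ≤ c)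
    (h : c ≤ 𝔼 u ∈ bx (t + 1) H, ‖∫ x, sh T (su (t + 1) u) E x * (ρ x * l u x) ∂μ‖) :
    c ^ (2 * 2 ^ (t + 1)) ≤ G μ T (t + 1) H E := by
  have hl' := (((hl.mul_fixed hρ).comp (φ := Prod.fst) measurable_fst).mul
    ((hl.mul_fixed hρ).comp (φ := Prod.snd) measurable_snd).star : LO (X := X × X) (t + 1) _)
  have hsE := fun u => hT.b1_sh hE (su (t + 1) u)
  have e1 : ∀ f : X → ℂ, ((‖∫ x, f x ∂μ‖ ^ 2 : ℝ) : ℂ) =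
      ∫ v, f v.1 * conj (f v.2) ∂(μ.prod μ) := by
    intro f
    rw [integral_prod_mul (μ := μ) (ν := μ) f (fun x => conj (f x)), integral_conj, Complex.mul_conj,
      Complex.normSq_eq_norm_sq]
  have e2 : 𝔼 u ∈ bx (t + 1) H, ‖∫ x, sh T (su (t + 1) u) E x * (ρ x * l u x) ∂μ‖ ^ 2 ≤
      ‖𝔼 u ∈ bx (t + 1) H, ∫ v, (sh T (su (t + 1) u) E v.1 * conj (sh T (su (t + 1) u) E v.2)) *
        ((l u v.1 * ρ v.1) * conj (l u v.2 * ρ v.2)) ∂(μ.prod μ)‖ := by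
    have : 𝔼 u ∈ bx (t + 1) H, ∫ v, (sh T (su (t + 1) u) E v.1 *
        conj (sh T (su (t + 1) u) E v.2)) * ((l u v.1 * ρ v.1) * conj (l u v.2 * ρ v.2)) ∂(μ.prod μ) =
        ((𝔼 u ∈ bx (t + 1) H, ‖∫ x, sh T (su (t + 1) u) E x * (ρ x * l u x) ∂μ‖ ^ 2 : ℝ) : ℂ) := by
      rw [Complex.ofReal_expect]
      refine Finset.expect_congr rfl fun u _ => ?_
      rw [e1]
      congr 1; ext v
      simp only [map_mul]; ring
    rw [this, Complex.norm_real]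
    exact le_abs_self _
  have e3 := gcs (ν := μ.prod μ) t H
    (fun u v => sh T (su (t + 1) u) E v.1 * conj (sh T (su (t + 1) u) E v.2)) _
    (fun u => ((hsE u).comp measurable_fst).mul ((hsE u).comp measurable_snd).star) hl'
  have e4 : (𝔼 h ∈ bx (t + 1) H, 𝔼 k ∈ bx (t + 1) H, ∫ v, cube (t + 1) (fun u =>
      sh T (su (t + 1) u) E v.1 * conj (sh T (su (t + 1) u) E v.2)) h k ∂(μ.prod μ)).re =
      G μ T (t + 1) H E := by
    rw [G_eq, re_expect]
    refine Finset.expect_congr rfl fun h _ => ?_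
    rw [re_expect]
    refine Finset.expect_congr rfl fun k _ => ?_
    simp only [cube_mul, cube_star]
    rw [← e1 (fun x => cube (t + 1) (fun u => sh T (su (t + 1) u) E x) h k), Complex.ofReal_re]
  calc c ^ (2 * 2 ^ (t + 1)) = (c ^ 2) ^ 2 ^ (t + 1) := pow_mul _ _ _
    _ ≤ (‖𝔼 u ∈ bx (t + 1) H, ∫ v, (sh T (su (t + 1) u) E v.1 *
          conj (sh T (su (t + 1) u) E v.2)) *
        ((l u v.1 * ρ v.1) * conj (l u v.2 * ρ v.2)) ∂(μ.prod μ)‖) ^ 2 ^ (t + 1) := by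
      refine pow_le_pow_left₀ (by positivity) (le_trans ?_ e2) _
      exact (pow_le_pow_left₀ hc h 2).trans
        (expect_pow_le _ (bx_nonempty _ _) _ (fun _ _ => norm_nonneg _) 2)
    _ ≤ _ := e3.trans_eq e4

lemma Eig.eq_const_mul [IsProbabilityMeasure μ] (herg : Ergodic T μ) {χ ψ : X → ℂ} {z : ℂ}
    (hχ : Eig μ T χ z) (hψ : Eig μ T ψ z) : ∃ d : ℂ, ‖d‖ = 1 ∧ ∀ᵐ x ∂μ, χ x = d * ψ x := by
  have h := hχ.mul hψ.star
  have hz : z * conj z = 1 := by rw [Complex.mul_conj, Complex.normSq_eq_norm_sq, hχ.norm_z]; simp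
  have hae : (fun x => χ x * conj (ψ x)) ∘ T =ᵐ[μ] (fun x => χ x * conj (ψ x)) := by
    filter_upwards [h.eq] with x hx
    simp only [Function.comp]
    rw [hx, hz, one_mul]
  obtain ⟨d, hd⟩ := herg.ae_eq_const_of_ae_eq_comp_ae h.meas.aestronglyMeasurable hae
  refine ⟨d, ?_, ?_⟩
  · obtain ⟨x, hx⟩ := hd.exists
    rw [← show χ x * conj (ψ x) = d from hx]
    exact h.norm_one x
  · filter_upwards [hd] with x hx
    rw [← show χ x * conj (ψ x) = d from hx, mul_assoc, mul_comm (conj (ψ x)), Complex.mul_conj,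
      Complex.normSq_eq_norm_sq, hψ.norm_one]
    simp

lemma G_one_le_one [IsProbabilityMeasure μ] (hT : Sys μ T) (H : Par ℕ 1) {F : X → ℂ} (hF : B1 F) :
    G μ T 1 H F ≤ 1 := by
  change 𝔼 h ∈ J H.1, 𝔼 k ∈ J H.1, ‖∫ x, sh T h F x * conj (sh T k F x) ∂μ‖ ^ 2 ≤ 1
  have : ∀ h k, ‖∫ x, sh T h F x * conj (sh T k F x) ∂μ‖ ^ 2 ≤ 1 := fun h k =>
    pow_le_one₀ (norm_nonneg _) (((hT.b1_sh hF h).mul (hT.b1_sh hF k).star).norm_integral_le μ)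
  exact Finset.expect_le (J_nonempty _) fun h _ => Finset.expect_le (J_nonempty _) fun k _ => this h k

variable {ι : Type} [Fintype ι] [DecidableEq ι] {p : ι → ℤ → ℤ}

lemma exists_eigenfunctions [IsProbabilityMeasure μ] (hT : Sys μ T) (herg : Ergodic T μ) (t : ℕ)
    {c : ℝ} (hc : 0 < c) {E : X → ℂ} (hE : B1 E)
    (hG : ∀ H : Par ℕ (t + 1), c ≤ G μ T (t + 1) H E) (H : Par ℕ t) :
    ∃ (Good : Par ℤ t → Par ℤ t → Prop) (χ : Par ℤ t → Par ℤ t → X → ℂ) (z : Par ℤ t → Par ℤ t → ℂ),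
      (∀ h k, Eig μ T (χ h k) (z h k)) ∧
      (∀ h k, Good h k → c ^ 2 / 12 ≤ ‖∫ x, cube t (fun u => sh T (su t u) E x) h k * χ h k x ∂μ‖ ^ 2)
      ∧ c / 2 ≤ 𝔼 h ∈ bx t H, 𝔼 k ∈ bx t H, ind (Good h k) := by
  have hcB : ∀ h k, B1 (fun x => cube t (fun u => sh T (su t u) E x) h k) := fun h k =>
    B1.cube (fun u => hT.b1_sh hE _) h k
  have hex : ∀ h k, ∃ (χ : X → ℂ) (z : ℂ), Eig μ T χ z ∧
      ((∃ᶠ H' : ℕ in atTop, c / 2 ≤ G μ T 1 ((H', ()) : ℕ × Par ℕ 0)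
        (fun x => cube t (fun u => sh T (su t u) E x) h k)) →
        c ^ 2 / 12 ≤ ‖∫ x, cube t (fun u => sh T (su t u) E x) h k * χ x ∂μ‖ ^ 2) := by
    intro h k
    by_cases hf : ∃ᶠ H' : ℕ in atTop, c / 2 ≤ G μ T 1 ((H', ()) : ℕ × Par ℕ 0)
        (fun x => cube t (fun u => sh T (su t u) E x) h k)
    · obtain ⟨χ, z, h1, h2⟩ := u2_inverse hT herg (hcB h k) (half_pos hc) hf
      exact ⟨χ, z, h1, fun _ => by convert h2 using 1; ring⟩
    · exact ⟨_, _, Eig.one, fun h => absurd h hf⟩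
  choose χ z hE1 hE2 using hex
  refine ⟨_, χ, z, hE1, hE2, ?_⟩
  have hev : ∀ᶠ H' : ℕ in atTop, ∀ v ∈ bx t H ×ˢ bx t H,
      c / 2 ≤ G μ T 1 ((H', ()) : ℕ × Par ℕ 0)
        (fun x => cube t (fun u => sh T (su t u) E x) v.1 v.2) →
      ∃ᶠ H' : ℕ in atTop, c / 2 ≤ G μ T 1 ((H', ()) : ℕ × Par ℕ 0)
        (fun x => cube t (fun u => sh T (su t u) E x) v.1 v.2) := by
    rw [Filter.eventually_all_finset]
    intro v _
    by_cases hf : ∃ᶠ H' : ℕ in atTop, c / 2 ≤ G μ T 1 ((H', ()) : ℕ × Par ℕ 0)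
        (fun x => cube t (fun u => sh T (su t u) E x) v.1 v.2)
    · exact Filter.Eventually.of_forall fun _ _ => hf
    · rw [Filter.not_frequently] at hf
      filter_upwards [hf] with H' h1 h2
      exact absurd h2 h1
  obtain ⟨H', hH'⟩ := hev.exists
  have h1 := hG ((H', H) : ℕ × Par ℕ t)
  rw [G_succ_eq, ← Finset.expect_product (bx t H) (bx t H) (fun v => G μ T 1 ((H', ()) : ℕ × Par ℕ 0)
        (fun x => cube t (fun u => sh T (su t u) E x) v.1 v.2))] at h1
  have h2 := markov ((bx_nonempty t H).product (bx_nonempty t H))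
    (fun v _ => G_one_le_one hT _ (hcB v.1 v.2)) hc.le h1
  rw [← Finset.expect_product (bx t H) (bx t H) (fun v => ind (∃ᶠ H' : ℕ in atTop,
    c / 2 ≤ G μ T 1 ((H', ()) : ℕ × Par ℕ 0)
        (fun x => cube t (fun u => sh T (su t u) E x) v.1 v.2)))]
  exact h2.trans (Finset.expect_le_expect fun v hv => ind_mono (hH' v hv))

end

section

variable {X : Type*} [MeasurableSpace X] {μ : Measure X} {T : Equiv.Perm X}
variable {ι : Type} [Fintype ι] [DecidableEq ι] {p : ι → ℤ → ℤ}

lemma exists_phase (a : ℂ) : ∃ c : ℂ, ‖c‖ = 1 ∧ c * a = ‖a‖ := by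
  by_cases h : a = 0
  · exact ⟨1, by simp, by simp [h]⟩
  · have hn : ‖a‖ ≠ 0 := norm_ne_zero_iff.2 h
    refine ⟨conj a / ‖a‖, ?_, ?_⟩
    · rw [norm_div, RCLike.norm_conj]; simp [hn]
    · have : (‖a‖ : ℂ) ≠ 0 := by exact_mod_cast hn
      rw [div_mul_eq_mul_div, mul_comm (conj a), Complex.mul_conj, Complex.normSq_eq_norm_sq]
      field_simp
      push_cast; ring

lemma IsDual.degree_lowering [IsProbabilityMeasure μ] (hT : Sys μ T) (herg : Ergodic T μ)
    {S : Finset ι} {m : ι} (hm : m ∉ S) (hMC : MainClaim μ T p S) (t : ℕ) (c : ℝ) (hc : 0 < c) :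
    ∃ c' : ℝ, 0 < c' ∧ ∀ E, IsDual μ T p S m E → (∀ H : Par ℕ (t + 2), c ≤ G μ T (t + 2) H E) →
      ∀ H : Par ℕ (t + 1), c' ≤ G μ T (t + 1) H E := by
  set c₁ : ℝ := Real.sqrt (c ^ 2 / 12) with hc₁
  have hc₁0 : 0 < c₁ := Real.sqrt_pos.2 (by positivity)
  obtain ⟨c₃, hc₃, Q, hQ, hroots⟩ := IsDual.cube_roots hT hm hMC t (c / 2 * c₁) (by positivity)
  have hQ' : (0 : ℝ) < Q := by exact_mod_cast hQ
  refine ⟨(c₃ / Q * c₁) ^ (2 * 2 ^ (t + 1)), by positivity, fun E hEd hG H => ?_⟩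
  have hE := hEd.1
  obtain ⟨Good, χ₂, z₂, hEig₂, hGood₂, hdens⟩ := exists_eigenfunctions hT herg (t + 1) hc hE hG H
  rw [Finset.expect_comm] at hdens
  obtain ⟨k, -, hk⟩ := Finset.exists_le_of_le_expect (bx_nonempty (t + 1) H) hdens
  obtain ⟨l, hl, hcube⟩ := cube_eq_mul_LO (fun u => hT.b1_sh hE (su (t + 1) u)) k
  set χ := fun h => χ₂ h k
  set z := fun h => z₂ h k
  have hEig : ∀ h, Eig μ T (χ h) (z h) := fun h => hEig₂ h k
  have hGood : ∀ h, Good h k → c₁ ≤ ‖∫ x, sh T (su (t + 1) h) E x * (χ h x * l h x) ∂μ‖ := by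
    intro h hh
    have h1 := hGood₂ h k hh
    rw [← Real.sqrt_le_left (norm_nonneg _)] at h1
    refine h1.trans_eq ?_
    congr 2; ext x
    rw [hcube]
    simp only [χ]; ring
  choose φ hφ hφ' using fun h => exists_phase (∫ x, sh T (su (t + 1) h) E x * (χ h x * l h x) ∂μ)
  have hlarge : c / 2 * c₁ ≤ ‖𝔼 u ∈ bx (t + 1) H, ∫ x, sh T (su (t + 1) u) E x *
      (((ind (Good u k) : ℂ) * φ u) * χ u x * l u x) ∂μ‖ := by
    have e : ∀ u, ∫ x, sh T (su (t + 1) u) E x *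
        (((ind (Good u k) : ℂ) * φ u) * χ u x * l u x) ∂μ =
        ((ind (Good u k) * ‖∫ x, sh T (su (t + 1) u) E x * (χ u x * l u x) ∂μ‖ : ℝ) : ℂ) := by
      intro u
      rw [Complex.ofReal_mul, ← hφ', ← mul_assoc, ← integral_const_mul]
      congr 1; ext x; ring
    simp only [e]
    rw [← Complex.ofReal_expect, Complex.norm_real]
    refine le_trans ?_ (le_abs_self _)
    refine (mul_le_mul_of_nonneg_right hk hc₁0.le).trans ?_
    rw [Finset.expect_mul]
    refine Finset.expect_le_expect fun u _ => ?_
    by_cases hu : Good u k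
    · rw [ind_of hu, one_mul, one_mul]; exact hGood u hu
    · rw [ind_not hu, zero_mul, zero_mul]
  have hind1 : ∀ P : Prop, ind P ≤ 1 := fun P => (ind_mono (Q := True) fun _ => trivial).trans_eq
    (ind_of trivial)
  have h1 := hroots E hEd H (fun u => (ind (Good u k) : ℂ) * φ u) χ z l (fun u => by
    rw [norm_mul, hφ, mul_one, Complex.norm_real, Real.norm_of_nonneg (ind_nonneg _)]
    exact hind1 _) hEig hl hlarge
  rw [Finset.expect_comm] at h1
  obtain ⟨k₁, -, hk₁⟩ := Finset.exists_le_of_le_expect (bx_nonempty (t + 1) H) h1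
  have hsum : ∀ h, ind ((ind (Good h k) : ℂ) * φ h ≠ 0 ∧ cube (t + 1) z h k₁ ^ Q = 1) ≤
      ∑ r ∈ Polynomial.nthRootsFinset Q (1 : ℂ), ind (Good h k ∧ cube (t + 1) z h k₁ = r) := by
    intro h
    by_cases hP : (ind (Good h k) : ℂ) * φ h ≠ 0 ∧ cube (t + 1) z h k₁ ^ Q = 1
    · rw [ind_of hP]
      have hg : Good h k := by
        by_contra hg
        apply hP.1
        rw [ind_not hg]; simp
      have hmem : cube (t + 1) z h k₁ ∈ Polynomial.nthRootsFinset Q (1 : ℂ) :=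
        (Polynomial.mem_nthRootsFinset hQ _).2 hP.2
      refine le_trans ?_ (Finset.single_le_sum (fun r _ => ind_nonneg _) hmem)
      rw [ind_of ⟨hg, rfl⟩]
    · rw [ind_not hP]
      exact Finset.sum_nonneg fun r _ => ind_nonneg _
  have h2 : c₃ ≤ ∑ r ∈ Polynomial.nthRootsFinset Q (1 : ℂ), 𝔼 h ∈ bx (t + 1) H,
      ind (Good h k ∧ cube (t + 1) z h k₁ = r) := by
    rw [← Finset.expect_sum_comm]
    exact hk₁.trans (Finset.expect_le_expect fun h _ => hsum h)
  have hcard : ((Polynomial.nthRootsFinset Q (1 : ℂ)).card : ℝ) ≤ Q := by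
    have : (Polynomial.nthRootsFinset Q (1 : ℂ)).card ≤ Q := by
      classical
      rw [Polynomial.nthRootsFinset_def]
      exact (Multiset.toFinset_card_le _).trans (Polynomial.card_nthRoots Q 1)
    exact_mod_cast this
  obtain ⟨r, -, hr⟩ : ∃ r ∈ Polynomial.nthRootsFinset Q (1 : ℂ), c₃ / Q ≤
      𝔼 h ∈ bx (t + 1) H, ind (Good h k ∧ cube (t + 1) z h k₁ = r) := by
    by_contra! hcon
    have hne : (Polynomial.nthRootsFinset Q (1 : ℂ)).Nonempty :=
      ⟨1, (Polynomial.mem_nthRootsFinset hQ _).2 (one_pow _)⟩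
    have := Finset.sum_lt_sum_of_nonempty hne hcon
    rw [Finset.sum_const, nsmul_eq_mul] at this
    have h3 : ((Polynomial.nthRootsFinset Q (1 : ℂ)).card : ℝ) * (c₃ / Q) ≤ Q * (c₃ / Q) := by
      gcongr
    rw [mul_div_cancel₀ _ hQ'.ne'] at h3
    linarith
  obtain ⟨h₀, hh₀⟩ : ∃ h₀, Good h₀ k ∧ cube (t + 1) z h₀ k₁ = r := by
    by_contra! hcon
    have : ∀ h ∈ bx (t + 1) H, ind (Good h k ∧ cube (t + 1) z h k₁ = r) = 0 := fun h _ =>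
      ind_not fun hh => hcon h hh.1 hh.2
    rw [Finset.expect_congr rfl this, Finset.expect_const_zero] at hr
    have : 0 < c₃ / Q := by positivity
    linarith
  obtain ⟨l', hl', hcube'⟩ := cube_eq_mul_LO (fun u => (hEig u).b1) k₁
  set ρ : X → ℂ := fun x => cube (t + 1) (fun u => χ u x) h₀ k₁ with hρ
  have hρE : Eig μ T ρ r := hh₀.2 ▸ Eig.cube hEig h₀ k₁
  refine G_ge_of_LO hT t H hE hρE.b1 (hl'.star.mul hl) (by positivity) ?_
  refine (mul_le_mul_of_nonneg_right hr hc₁0.le).trans ?_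
  rw [Finset.expect_mul]
  refine Finset.expect_le_expect fun h _ => ?_
  by_cases hP : Good h k ∧ cube (t + 1) z h k₁ = r
  · rw [ind_of hP, one_mul]
    obtain ⟨d, hd, hd'⟩ := Eig.eq_const_mul herg (hP.2 ▸ Eig.cube hEig h k₁) hρE
    have e : ∫ x, sh T (su (t + 1) h) E x * (χ h x * l h x) ∂μ =
        d * ∫ x, sh T (su (t + 1) h) E x * (ρ x * (conj (l' h x) * l h x)) ∂μ := by
      rw [← integral_const_mul]
      refine integral_congr_ae ?_
      filter_upwards [hd'] with x hx
      have hn : l' h x * conj (l' h x) = 1 := by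
        have h5 := (Eig.cube hEig h k₁).norm_one x
        rw [hcube', norm_mul, (hEig h).norm_one, one_mul] at h5
        rw [Complex.mul_conj, Complex.normSq_eq_norm_sq, h5]; simp
      rw [hcube'] at hx
      have h6 : χ h x = d * ρ x * conj (l' h x) := by
        rw [← hx, mul_assoc, hn, mul_one]
      rw [h6]; ring
    have h7 := hGood h hP.1
    rw [e, norm_mul, hd, one_mul] at h7
    exact h7
  · rw [ind_not hP, zero_mul]; exact norm_nonneg _

lemma IsDual.exists_eig_of_G [IsProbabilityMeasure μ] (hT : Sys μ T) (herg : Ergodic T μ)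
    {S : Finset ι} {m : ι} (hm : m ∉ S) (hMC : MainClaim μ T p S) (t : ℕ) : ∀ c : ℝ, 0 < c →
    ∃ c' : ℝ, 0 < c' ∧ ∀ E, IsDual μ T p S m E → (∀ H : Par ℕ t, c ≤ G μ T t H E) →
      ∃ χ z, Eig μ T χ z ∧ c' ≤ ‖∫ x, E x * χ x ∂μ‖ := by
  induction t with
  | zero =>
    intro c hc
    refine ⟨Real.sqrt c, Real.sqrt_pos.2 hc, fun E _ h => ⟨_, _, Eig.one, ?_⟩⟩
    have := h ()
    rw [G, ← Real.sqrt_le_left (norm_nonneg _)] at this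
    simpa using this
  | succ t ih =>
    intro c hc
    rcases t with _ | t
    · refine ⟨Real.sqrt (c ^ 2 / 3), Real.sqrt_pos.2 (by positivity), fun E hE h => ?_⟩
      obtain ⟨χ, z, h1, h2⟩ := u2_inverse hT herg hE.1 hc
        (Filter.Frequently.of_forall fun H => h ((H, ()) : ℕ × Par ℕ 0))
      exact ⟨χ, z, h1, by rwa [← Real.sqrt_le_left (norm_nonneg _)] at h2⟩
    · obtain ⟨c', hc', h⟩ := IsDual.degree_lowering hT herg hm hMC t c hc
      obtain ⟨c'', hc'', h'⟩ := ih c' hc'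
      exact ⟨c'', hc'', fun E hE hG => h' E hE (h E hE hG)⟩

lemma IsDual.exists_eig_of_ctl [IsProbabilityMeasure μ] (hT : Sys μ T) (herg : Ergodic T μ)
    {S : Finset ι} {m : ι} (hm : m ∉ S) (hMC : MainClaim μ T p S) (N : ℕ) :
    ∃ c' : ℝ, 0 < c' ∧ ∀ E, IsDual μ T p S m E → Ctl μ T N E →
      ∃ χ z, Eig μ T χ z ∧ c' ≤ ‖∫ x, E x * χ x ∂μ‖ := by
  choose c' hc' h using fun t => IsDual.exists_eig_of_G hT herg hm hMC t (1 / ((N : ℝ) + 1))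
    (by positivity)
  have hne : (Finset.range (N + 1)).Nonempty := ⟨0, by simp⟩
  refine ⟨(Finset.range (N + 1)).inf' hne c', (Finset.lt_inf'_iff hne).2 fun t _ => hc' t,
    fun E hE hctl => ?_⟩
  obtain ⟨t, ht, hG⟩ := hctl
  obtain ⟨χ, z, h1, h2⟩ := h t E hE hG
  exact ⟨χ, z, h1, (Finset.inf'_le _ (by simp; omega)).trans h2⟩

end

section

variable {X : Type*} [MeasurableSpace X] {μ : Measure X} {T : Equiv.Perm X}
variable {ι : Type} [Fintype ι] {p : ι → ℤ → ℤ}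

lemma Fam.natDegree_pos (hp : Fam p) {i : ι} {q : Polynomial ℚ} (hq : Rep q (p i)) :
    0 < q.natDegree := by
  classical
  by_contra h
  refine hp.ind (Pi.single i 1) (by simp) ⟨p i 0, fun n => ?_⟩
  rw [Finset.sum_eq_single i (fun j _ hj => by simp [hj]) (by simp)]
  simpa using hq.const_of_natDegree_eq_zero (by omega) n

lemma Fam.natDegree_sub_pos (hp : Fam p) {i j : ι} (hij : i ≠ j) {q r : Polynomial ℚ}
    (hq : Rep q (p i)) (hr : Rep r (p j)) : 0 < (q - r).natDegree := by
  classical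
  by_contra h
  have hrep : Rep (q - r) (fun n => p i n - p j n) := by
    intro n
    rw [Polynomial.eval_sub, hq, hr]; push_cast; ring
  refine hp.ind (Pi.single i 1 - Pi.single j 1) (fun h0 => ?_) ⟨p i 0 - p j 0, fun n => ?_⟩
  · have := congrFun h0 i
    simp [hij] at this
  · have h1 := hrep.const_of_natDegree_eq_zero (by omega) n
    rw [← h1]
    simp [sub_mul, Finset.sum_sub_distrib, Pi.single_apply]

variable [DecidableEq ι]

lemma G_star (t : ℕ) (H : Par ℕ t) (F : X → ℂ) :
    G μ T t H (fun x => conj (F x)) = G μ T t H F := by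
  rw [G_eq, G_eq]
  refine Finset.expect_congr rfl fun h _ => Finset.expect_congr rfl fun k _ => ?_
  have : ∀ x, cube t (fun u => sh T (su t u) (fun x => conj (F x)) x) h k =
      conj (cube t (fun u => sh T (su t u) F x) h k) := fun x => cube_star _ _ _ _
  simp only [this]
  rw [integral_conj, RCLike.norm_conj]

lemma mainClaim_empty [IsProbabilityMeasure μ] (hp : Fam p) : MainClaim μ T p ∅ := by
  intro c hc
  obtain ⟨Q, hQ, hW⟩ := weyl_indep hp c hc
  refine ⟨Q, hQ, fun M z f₀ f hz hf₀ hf h => ?_⟩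
  have e : M.m (fun n => (∏ j ∈ (∅ : Finset ι)ᶜ, z j ^ p j n) *
      ∫ x, f₀ x * ∏ i ∈ (∅ : Finset ι), sh T (p i n) (f i) x ∂μ) =
      (∫ x, f₀ x ∂μ) * M.m (fun n => ∏ j, z j ^ p j n) := by
    rw [← M.const_mul]
    congr 1; ext n
    simp [mul_comm]
  rw [e, norm_mul] at h
  refine ⟨fun j _ => hW M z hz (h.trans ?_) j, _, _, Eig.one, by simp, fun h0 => ?_⟩
  · exact mul_le_of_le_one_left (norm_nonneg _) (hf₀.norm_integral_le μ)
  · simp only [mul_one] at h0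
    rw [h0] at h
    simp at h; linarith

lemma mainClaim_step [IsProbabilityMeasure μ] (hT : Sys μ T) (herg : Ergodic T μ) (hp : Fam p)
    {q : ι → Polynomial ℚ} (hq : ∀ i, Rep (q i) (p i)) {S : Finset ι} {m : ι} (hm : m ∉ S)
    (hmax : ∀ i ∈ S, (q i).natDegree ≤ (q m).natDegree) (hMC : MainClaim μ T p S) :
    MainClaim μ T p (insert m S) := by
  intro c hc
  obtain ⟨N, hpet⟩ := pet hT (insert m S) q p m (Finset.mem_insert_self _ _) (fun i _ => hq i)
    (fun i _ => hp.natDegree_pos (hq i))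
    (fun i hi => by
      rcases Finset.mem_insert.1 hi with rfl | hi
      · exact le_rfl
      · exact hmax i hi)
    (fun i _ him => hp.natDegree_sub_pos (Ne.symm him) (hq m) (hq i)) (c ^ 2) (by positivity)
  obtain ⟨c', hc', hlow⟩ := IsDual.exists_eig_of_ctl hT herg hm hMC N
  obtain ⟨Q, hQ, hMC⟩ := hMC c' hc'
  refine ⟨Q, hQ, fun M z f₀ f hz hf₀ hf h => ?_⟩
  set W : ℤ → ℂ := fun n => ∏ j ∈ (insert m S)ᶜ, z j ^ p j n with hWdef
  have hW : ∀ n, ‖W n‖ = 1 := fun n => by simp [W, norm_prod, hz]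
  have hg : ∀ n, B1 (fun y => f₀ y * ∏ i ∈ S, sh T (p i n) (f i) y) := fun n =>
    hf₀.mul (B1.prod S fun i _ => hT.b1_sh (hf i) _)
  obtain ⟨D, hD, hDint⟩ := exists_weakAvg μ M (fun n x =>
    W n * sh T (-p m n) (fun y => f₀ y * ∏ i ∈ S, sh T (p i n) (f i) y) x)
    (fun n => (hT.b1_sh (hg n) _).const_mul (hW n).le)
  have hdual : IsDual μ T p S m D := ⟨hD, M, W, f₀, f, hW, hf₀, hf, hDint⟩
  have hDint' : ∀ g, B1 g → ∫ x, D x * g x ∂μ = M.m (fun n => W n *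
      ∫ x, (f₀ x * ∏ i ∈ S, sh T (p i n) (f i) x) * sh T (p m n) g x ∂μ) := by
    intro g hg
    rw [hDint g hg]
    congr 1; ext n
    simp only [mul_assoc]
    rw [integral_const_mul]
    have := integral_sh_mul hT (-p m n) (fun y => f₀ y * ∏ i ∈ S, sh T (p i n) (f i) y) g
    rw [neg_neg] at this
    rw [this]
    simp only [mul_assoc]
  have h1 : c ≤ ‖∫ x, f m x * D x ∂μ‖ := by
    simp only [mul_comm (f m _)]
    rw [hDint' _ (hf m)]
    refine h.trans_eq ?_
    congr 2; ext n
    simp only [Finset.prod_insert hm, W]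
    congr 2; ext x; ring
  have h2 : c ^ 2 ≤ ∫ x, ‖D x‖ ^ 2 ∂μ :=
    (pow_le_pow_left₀ hc.le h1 2).trans (norm_integral_mul_sq_le μ (hf m) hD.1 hD.2)
  have h3 : ((∫ x, ‖D x‖ ^ 2 ∂μ : ℝ) : ℂ) = ∫ x, D x * conj (D x) ∂μ := by
    rw [← integral_complex_ofReal]
    congr 1; ext x
    rw [Complex.mul_conj, Complex.normSq_eq_norm_sq]
  have hctl : Ctl μ T N (fun x => conj (D x)) := by
    have := hpet M W f₀ (Function.update f m (fun x => conj (D x))) (fun n => (hW n).le) hf₀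
      (fun i => by
        by_cases hi : i = m
        · subst hi; simpa using hD.star
        · simpa [hi] using hf i) ?_
    · simpa using this
    · rw [hDint' _ hD.star] at h3
      have h4 : c ^ 2 ≤ ‖((∫ x, ‖D x‖ ^ 2 ∂μ : ℝ) : ℂ)‖ := by
        rw [Complex.norm_real]; exact h2.trans (le_abs_self _)
      rw [h3] at h4
      refine h4.trans_eq ?_
      congr 2; ext n
      rw [← integral_const_mul]
      congr 1; ext x
      rw [Finset.prod_insert hm, Function.update_self]
      have : ∏ i ∈ S, sh T (p i n) (Function.update f m (fun x => conj (D x)) i) x =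
          ∏ i ∈ S, sh T (p i n) (f i) x := Finset.prod_congr rfl fun i hi => by
        have hne : i ≠ m := fun h => hm (h ▸ hi)
        rw [Function.update_of_ne hne]
      rw [this]; ring
  have hctl' : Ctl μ T N D := by
    obtain ⟨t, ht, hG⟩ := hctl
    exact ⟨t, ht, fun H => by rw [← G_star]; exact hG H⟩
  obtain ⟨χ, ζ, hχ, hlarge⟩ := hlow D hdual hctl'
  obtain ⟨hroot, ρ, w, hρ, hw, hne⟩ := hMC M (Function.update z m ζ) (fun x => f₀ x * χ x) f
    (fun j => by
      by_cases hj : j = m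
      · subst hj; simpa using hχ.norm_z
      · simpa [hj] using hz j) (hf₀.mul hχ.b1) hf (by
    rw [hDint' _ hχ.b1] at hlarge
    refine hlarge.trans_eq ?_
    congr 2; ext n
    have e : Sᶜ = insert m (insert m S)ᶜ := by
      ext i
      simp only [Finset.mem_compl, Finset.mem_insert]
      by_cases hi : i = m
      · subst hi; simp [hm]
      · simp [hi]
    rw [e, Finset.prod_insert (by simp), Function.update_self]
    have e2 : ∏ j ∈ (insert m S)ᶜ, Function.update z m ζ j ^ p j n = W n :=
      Finset.prod_congr rfl fun i hi => by
        rw [Function.update_of_ne]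
        rintro rfl
        simp at hi
    rw [e2, mul_comm (ζ ^ p m n), mul_assoc, ← integral_const_mul (ζ ^ p m n)]
    congr 1
    refine integral_congr_ae ?_
    filter_upwards [hχ.zpow hT (p m n)] with x hx
    rw [hx]; ring)
  refine ⟨fun j hj => ?_, fun x => χ x * ρ x, ζ * w, hχ.mul hρ, ?_, ?_⟩
  · have hjm : j ≠ m := by rintro rfl; simp at hj
    have := hroot j (fun h => hj (Finset.mem_insert_of_mem h))
    rwa [Function.update_of_ne hjm] at this
  · have := hroot m hm
    rw [Function.update_self] at this
    rw [mul_pow, this, hw, one_mul]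
  · simpa only [mul_assoc] using hne

theorem mainClaim [IsProbabilityMeasure μ] (hT : Sys μ T) (herg : Ergodic T μ) (hp : Fam p)
    (S : Finset ι) : MainClaim μ T p S := by
  choose q hq using hp.rep
  induction hS : S.card generalizing S with
  | zero =>
    rw [Finset.card_eq_zero.1 hS]
    exact mainClaim_empty hp
  | succ n ih =>
    obtain ⟨m, hm, hmax⟩ := Finset.exists_max_image S (fun i => (q i).natDegree)
      (Finset.card_pos.1 (by omega))
    rw [← Finset.insert_erase hm]
    exact mainClaim_step hT herg hp hq (Finset.notMem_erase m S)
      (fun i hi => hmax i (Finset.mem_of_mem_erase hi))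
      (ih _ (by rw [Finset.card_erase_of_mem hm]; omega))

end

section Characteristic

variable {X : Type*} [MeasurableSpace X] {μ : Measure X} {T : Equiv.Perm X}
variable {ι : Type} [Fintype ι] [DecidableEq ι] {p : ι → ℤ → ℤ}

/-- A function orthogonal to all eigenfunctions whose eigenvalue is a root of unity. -/
def PerpRat (μ : Measure X) (T : Equiv.Perm X) (f : X → ℂ) : Prop :=
  ∀ (ρ : X → ℂ) (w : ℂ) (Q : ℕ), 0 < Q → Eig μ T ρ w → w ^ Q = 1 → ∫ x, f x * ρ x ∂μ = 0

lemma PerpRat.mean_base [IsProbabilityMeasure μ] (hT : Sys μ T) (herg : Ergodic T μ) (hp : Fam p)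
    (M : InvMean) {f₀ : X → ℂ} {f : ι → X → ℂ} (hf₀ : B1 f₀) (hf : ∀ i, B1 (f i))
    (hperp : PerpRat μ T f₀) :
    M.m (fun n => ∫ x, f₀ x * ∏ i, sh T (p i n) (f i) x ∂μ) = 0 := by
  by_contra hne
  obtain ⟨Q, hQ, h⟩ := mainClaim hT herg hp Finset.univ _ (norm_pos_iff.2 hne)
  obtain ⟨-, ρ, w, hρ, hw, hne'⟩ := h M (fun _ => 1) f₀ f (by simp) hf₀ hf (by simp)
  exact hne' (hperp ρ w Q hQ hρ hw)

lemma Fam.recenter (hp : Fam p) (i₀ : ι) :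
    Fam (Function.update (fun j n => p j n - p i₀ n) i₀ (fun n => -p i₀ n)) where
  rep i := by
    choose q hq using hp.rep
    by_cases hi : i = i₀
    · subst hi
      refine ⟨-q i, fun n => ?_⟩
      have := hq i n
      simp only [Polynomial.eval_neg, Function.update_self]
      rw [this]; push_cast; ring
    · refine ⟨q i - q i₀, fun n => ?_⟩
      have h1 := hq i n
      have h2 := hq i₀ n
      simp only [Polynomial.eval_sub, Function.update_of_ne hi]
      rw [h1, h2]; push_cast; ring
  ind c hc := by
    rintro ⟨C, hC⟩
    refine hp.ind (Function.update c i₀ (-∑ j, c j)) (fun h0 => hc ?_) ⟨C, fun n => ?_⟩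
    · have h1 : ∀ j, j ≠ i₀ → c j = 0 := fun j hj => by
        have := congrFun h0 j
        simpa [hj] using this
      have h2 := congrFun h0 i₀
      simp only [Function.update_self, Pi.zero_apply, neg_eq_zero] at h2
      rw [Finset.sum_eq_single i₀ (fun j _ hj => h1 j hj) (by simp)] at h2
      ext j
      by_cases hj : j = i₀
      · rw [hj, h2]; rfl
      · exact h1 j hj
    · rw [← hC n, ← Finset.add_sum_erase _ _ (Finset.mem_univ i₀),
        ← Finset.add_sum_erase _ _ (Finset.mem_univ i₀),
        ← Finset.add_sum_erase _ _ (Finset.mem_univ i₀)]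
      simp only [Function.update_self]
      have e1 : ∑ x ∈ Finset.univ.erase i₀, Function.update c i₀
            (-(c i₀ + ∑ x ∈ Finset.univ.erase i₀, c x)) x * p x n =
          ∑ x ∈ Finset.univ.erase i₀, c x * p x n :=
        Finset.sum_congr rfl fun x hx => by
          rw [Function.update_of_ne (Finset.ne_of_mem_erase hx)]
      have e2 : ∑ x ∈ Finset.univ.erase i₀, c x *
            Function.update (fun j n => p j n - p i₀ n) i₀ (fun n => -p i₀ n) x n =
          ∑ x ∈ Finset.univ.erase i₀, (c x * p x n - c x * p i₀ n) :=
        Finset.sum_congr rfl fun x hx => by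
          rw [Function.update_of_ne (Finset.ne_of_mem_erase hx)]; ring
      rw [e1, e2, Finset.sum_sub_distrib, ← Finset.sum_mul]
      ring

lemma PerpRat.mean_slot [IsProbabilityMeasure μ] (hT : Sys μ T) (herg : Ergodic T μ)
    (hp : Fam p) (M : InvMean) {f₀ : X → ℂ} {f : ι → X → ℂ} (hf₀ : B1 f₀) (hf : ∀ i, B1 (f i))
    (i₀ : ι) (hperp : PerpRat μ T (f i₀)) :
    M.m (fun n => ∫ x, f₀ x * ∏ i, sh T (p i n) (f i) x ∂μ) = 0 := by
  have hB : ∀ i, B1 (Function.update f i₀ f₀ i) := fun i => by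
    by_cases hi : i = i₀
    · subst hi; simpa using hf₀
    · simpa [hi] using hf i
  rw [← PerpRat.mean_base hT herg (hp.recenter i₀) M (hf i₀) hB hperp]
  congr 1; ext n
  rw [← hT.integral_sh' (-p i₀ n)]
  congr 1; ext x
  rw [← Finset.mul_prod_erase _ _ (Finset.mem_univ i₀),
    ← Finset.mul_prod_erase _ _ (Finset.mem_univ i₀)]
  simp only [Function.update_self]
  have : ∏ x_1 ∈ Finset.univ.erase i₀, sh T (Function.update (fun j n => p j n - p i₀ n) i₀
      (fun n => -p i₀ n) x_1 n) (Function.update f i₀ f₀ x_1) x =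
      ∏ x_1 ∈ Finset.univ.erase i₀, sh T (-p i₀ n) (sh T (p x_1 n) (f x_1)) x :=
    Finset.prod_congr rfl fun i hi => by
      have hne := Finset.ne_of_mem_erase hi
      rw [Function.update_of_ne hne, Function.update_of_ne hne, sh_sh, sub_eq_add_neg]
  rw [this]
  have h2 : sh T (-p i₀ n) (sh T (p i₀ n) (f i₀)) = f i₀ := by
    rw [sh_sh, add_neg_cancel, sh_zero]
  have h3 := congrFun h2 x
  simp only [sh] at h3 ⊢
  rw [h3]; ring

end Characteristic

section AlmostInvariant

variable {X : Type*} [mX : MeasurableSpace X] {μ : Measure X} {T : Equiv.Perm X}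

/-- The σ-algebra of measurable sets that are almost invariant under `T ^ k`. -/
@[reducible] def aeInv (μ : Measure X) (T : Equiv.Perm X) (k : ℤ) : MeasurableSpace X where
  MeasurableSet' s := MeasurableSet s ∧ ∀ᵐ x ∂μ, (T ^ k) x ∈ s ↔ x ∈ s
  measurableSet_empty := ⟨MeasurableSet.empty, by simp⟩
  measurableSet_compl s hs := ⟨hs.1.compl, by
    filter_upwards [hs.2] with x hx
    simp [hx]⟩
  measurableSet_iUnion f hf := ⟨MeasurableSet.iUnion fun i => (hf i).1, by
    filter_upwards [ae_all_iff.2 fun i => (hf i).2] with x hx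
    simp [hx]⟩

lemma aeInv_le (k : ℤ) : aeInv μ T k ≤ mX := fun _ hs => hs.1

lemma measurable_aeInv {β : Type*} [MeasurableSpace β] {k : ℤ} {f : X → β} (hf : Measurable f)
    (h : ∀ᵐ x ∂μ, f ((T ^ k) x) = f x) : Measurable[aeInv μ T k] f := fun s hs =>
  ⟨hf hs, by
    filter_upwards [h] with x hx
    simp [hx]⟩

lemma comp_eq_of_aeInv {k : ℤ} {f : X → ℝ} (hf : Measurable[aeInv μ T k] f) :
    ∀ᵐ x ∂μ, f ((T ^ k) x) = f x := by
  have h : ∀ q : ℚ, ∀ᵐ x ∂μ, f ((T ^ k) x) < q ↔ f x < q := fun q =>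
    (hf (measurableSet_Iio (a := (q : ℝ)))).2
  filter_upwards [ae_all_iff.2 h] with x hx
  rcases lt_trichotomy (f ((T ^ k) x)) (f x) with h1 | h1 | h1
  · obtain ⟨q, h2, h3⟩ := exists_rat_btwn h1
    exact absurd ((hx q).1 h2) (not_lt.2 h3.le)
  · exact h1
  · obtain ⟨q, h2, h3⟩ := exists_rat_btwn h1
    exact absurd ((hx q).2 h2) (not_lt.2 h3.le)

lemma aeInv_mono (hT : Sys μ T) {k l : ℤ} (h : k ∣ l) : aeInv μ T k ≤ aeInv μ T l := by
  obtain ⟨m, rfl⟩ := h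
  intro s hs
  refine ⟨hs.1, ?_⟩
  have hq : ∀ n : ℤ, ∀ᵐ x ∂μ, (T ^ k) ((T ^ n) x) ∈ s ↔ (T ^ n) x ∈ s := fun n =>
    (hT.zpow n).quasiMeasurePreserving.ae hs.2
  induction m using Int.induction_on with
  | zero => simp
  | succ m ih =>
    filter_upwards [ih, hq (k * m)] with x h1 h2
    rw [← h1, ← h2, ← Equiv.Perm.mul_apply, ← zpow_add]
    congr! 3; ring_nf
  | pred m ih =>
    filter_upwards [ih, hq (k * (-m - 1))] with x h1 h2
    rw [← h1, ← h2, ← Equiv.Perm.mul_apply, ← zpow_add]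
    congr! 3; ring_nf

/-- The filtration of sets almost invariant under `T ^ n!`. -/
def facFiltration (hT : Sys μ T) : Filtration ℕ mX where
  seq n := aeInv μ T (n.factorial : ℤ)
  mono' _ _ h := aeInv_mono hT (by exact_mod_cast Nat.factorial_dvd_factorial h)
  le' _ := aeInv_le _

lemma Eig.measurable_aeInv (hT : Sys μ T) {ρ : X → ℂ} {w : ℂ} (hρ : Eig μ T ρ w) {Q : ℕ}
    (hw : w ^ Q = 1) : Measurable[aeInv μ T Q] ρ := by
  refine IndepPoly.measurable_aeInv hρ.meas ?_
  filter_upwards [hρ.zpow hT Q] with x hx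
  simpa [sh, hw] using hx

/-- Truncation to the unit interval. -/
def clip (y : ℝ) : ℝ := max 0 (min 1 y)

lemma clip_mem (y : ℝ) : 0 ≤ clip y ∧ clip y ≤ 1 := by
  unfold clip; exact ⟨le_max_left _ _, max_le zero_le_one (min_le_left _ _)⟩

lemma clip_eq {y : ℝ} (h0 : 0 ≤ y) (h1 : y ≤ 1) : clip y = y := by
  unfold clip; rw [min_eq_right h1, max_eq_right h0]

lemma measurable_clip : Measurable clip := by
  unfold clip; fun_prop

lemma clip_condExp [IsProbabilityMeasure μ] {A : Set X} (hA : MeasurableSet A)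
    (m : MeasurableSpace X) :
    ∀ᵐ x ∂μ, clip ((μ[A.indicator (fun _ => (1 : ℝ)) | m]) x) =
      (μ[A.indicator (fun _ => (1 : ℝ)) | m]) x := by
  have hi : Integrable (A.indicator (fun _ => (1 : ℝ))) μ := (integrable_const 1).indicator hA
  by_cases hm : m ≤ mX
  · have h0 : 0 ≤ᵐ[μ] μ[A.indicator (fun _ => (1 : ℝ)) | m] :=
      condExp_nonneg (ae_of_all _ fun x => Set.indicator_nonneg (fun _ _ => zero_le_one) x)
    have h1 : μ[A.indicator (fun _ => (1 : ℝ)) | m] ≤ᵐ[μ] μ[fun _ => (1 : ℝ) | m] :=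
      condExp_mono hi (integrable_const 1)
        (ae_of_all _ fun x => Set.indicator_le_self' (fun _ _ => zero_le_one) x)
    rw [condExp_const hm] at h1
    filter_upwards [h0, h1] with x hx0 hx1
    exact clip_eq hx0 hx1
  · rw [condExp_of_not_le hm]
    exact ae_of_all _ fun x => clip_eq le_rfl zero_le_one

lemma B1.ofReal {u : X → ℝ} (hu : Measurable u) (hb : ∀ x, 0 ≤ u x ∧ u x ≤ 1) :
    B1 (fun x => (u x : ℂ)) :=
  ⟨Complex.measurable_ofReal.comp hu, fun x => by
    change ‖((u x : ℝ) : ℂ)‖ ≤ 1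
    rw [Complex.norm_real, Real.norm_eq_abs, abs_of_nonneg (hb x).1]
    exact (hb x).2⟩

lemma exists_rational_part [IsProbabilityMeasure μ] (hT : Sys μ T) {A : Set X}
    (hA : MeasurableSet A) :
    ∃ u : X → ℝ, Measurable u ∧ (∀ x, 0 ≤ u x ∧ u x ≤ 1) ∧
      PerpRat μ T (fun x => ((A.indicator (fun _ => (1 : ℝ)) x - u x : ℝ) : ℂ)) ∧
      ∀ δ > (0 : ℝ), ∃ n₀ : ℕ, ∀ n ≥ n₀, ∃ w : X → ℝ, Measurable w ∧
        (∀ x, 0 ≤ w x ∧ w x ≤ 1) ∧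
        (∀ m : ℤ, ∀ᵐ x ∂μ, w ((T ^ ((n.factorial : ℤ) * m)) x) = w x) ∧
        ∫ x, w x ∂μ = μ.real A ∧ ∫ x, |w x - u x| ∂μ ≤ δ := by
  set g : X → ℝ := A.indicator (fun _ => (1 : ℝ)) with hg
  have hgi : Integrable g μ := (integrable_const 1).indicator hA
  set ℱ := facFiltration hT
  have hle : (⨆ n, ℱ n) ≤ mX := iSup_le fun n => ℱ.le n
  have hmeas : ∀ m : MeasurableSpace X, m ≤ mX →
      Measurable[mX] (fun x => clip ((μ[g | m]) x)) := fun m hm =>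
    @Measurable.comp _ _ _ mX _ _ clip _ measurable_clip
      ((stronglyMeasurable_condExp.mono hm).measurable)
  refine ⟨fun x => clip ((μ[g | ⨆ n, ℱ n]) x), hmeas _ hle, fun x => clip_mem _, ?_, ?_⟩
  · intro ρ w Q hQ hρ hw
    have hQle : aeInv μ T Q ≤ ⨆ n, ℱ n :=
      (aeInv_mono hT (by exact_mod_cast Nat.dvd_factorial hQ le_rfl)).trans (le_iSup ℱ Q)
    have hρm : StronglyMeasurable[⨆ n, ℱ n] ρ :=
      ((hρ.measurable_aeInv hT hw).mono hQle le_rfl).stronglyMeasurable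
    have hpull := condExp_stronglyMeasurable_bilin_of_bound
      (ContinuousLinearMap.lsmul ℝ ℝ (E := ℂ)).flip hle hρm hgi 1
      (ae_of_all μ fun x => (hρ.norm_one x).le)
    have h_intble : ∫ x, (g x : ℂ) * ρ x ∂μ = ∫ x, ((μ[g | ⨆ n, ℱ n]) x : ℂ) * ρ x ∂μ := by
      have h1 := integral_congr_ae hpull
      rw [integral_condExp hle] at h1
      simpa using h1
    have hρi : ∀ h : X → ℝ, Measurable h → (∀ x, 0 ≤ h x ∧ h x ≤ 1) →
        Integrable (fun x => (h x : ℂ) * ρ x) μ := fun h hh hb =>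
      B1.integrable (B1.mul (B1.ofReal hh hb) hρ.b1) μ
    simp only [Complex.ofReal_sub, sub_mul]
    rw [integral_sub, h_intble, sub_eq_zero]
    · refine integral_congr_ae ?_
      filter_upwards [clip_condExp hA (⨆ n, ℱ n) (μ := μ)] with x hx
      rw [hx]
    · exact hρi g (measurable_const.indicator hA) fun x =>
        ⟨Set.indicator_nonneg (fun _ _ => zero_le_one) x,
          Set.indicator_le_self' (fun _ _ => zero_le_one) x⟩
    · exact hρi _ (hmeas _ hle) fun x => clip_mem _
  · intro δ hδ
    have hlim := tendsto_eLpNorm_condExp (μ := μ) (ℱ := ℱ) g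
    obtain ⟨n₀, hn₀⟩ := eventually_atTop.1
      (hlim.eventually (ge_mem_nhds (ENNReal.ofReal_pos.2 hδ)))
    refine ⟨n₀, fun n hn => ⟨fun x => clip ((μ[g | ℱ n]) x), hmeas _ (ℱ.le n),
      fun x => clip_mem _, fun m => ?_, ?_, ?_⟩⟩
    · have : Measurable[aeInv μ T ((n.factorial : ℤ) * m)] (fun x => clip ((μ[g | ℱ n]) x)) :=
        (measurable_clip.comp (stronglyMeasurable_condExp (m := ℱ n)).measurable).mono
          (aeInv_mono hT (Dvd.intro _ rfl)) le_rfl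
      exact comp_eq_of_aeInv this
    · rw [integral_congr_ae (clip_condExp hA (ℱ n)), integral_condExp (ℱ.le n),
        integral_indicator_const _ hA]
      simp
    · have h1 := hn₀ n hn
      rw [eLpNorm_one_eq_lintegral_enorm] at h1
      have e : ∫ x, |clip ((μ[g | ℱ n]) x) - clip ((μ[g | ⨆ n, ℱ n]) x)| ∂μ =
          ∫ x, ‖(μ[g | ℱ n] - μ[g | ⨆ n, ℱ n]) x‖ ∂μ := by
        refine integral_congr_ae ?_
        filter_upwards [clip_condExp hA (ℱ n) (μ := μ), clip_condExp hA (⨆ n, ℱ n) (μ := μ)]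
          with x hx hy
        rw [hx, hy]; rfl
      rw [e, integral_norm_eq_lintegral_enorm
        (integrable_condExp.sub integrable_condExp).aestronglyMeasurable]
      exact ENNReal.toReal_le_of_le_ofReal hδ.le h1

end AlmostInvariant

section ErgodicMean

variable {X : Type*} [MeasurableSpace X] {μ : Measure X} {T : Equiv.Perm X}
variable {ι : Type} [Fintype ι] {p : ι → ℤ → ℤ}

lemma prod_le_prod_add_sum {ι : Type*} (s : Finset ι) {a b : ι → ℝ}
    (ha : ∀ i, 0 ≤ a i ∧ a i ≤ 1) (hb : ∀ i, 0 ≤ b i ∧ b i ≤ 1) :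
    ∏ i ∈ s, a i ≤ ∏ i ∈ s, b i + ∑ i ∈ s, |a i - b i| := by
  classical
  induction s using Finset.induction_on with
  | empty => simp
  | insert i s hi ih =>
    rw [Finset.prod_insert hi, Finset.prod_insert hi, Finset.sum_insert hi]
    have h1 : a i * ∏ j ∈ s, a j ≤ a i * (∏ j ∈ s, b j + ∑ j ∈ s, |a j - b j|) :=
      mul_le_mul_of_nonneg_left ih (ha i).1
    have h2 : 0 ≤ ∑ j ∈ s, |a j - b j| := Finset.sum_nonneg fun _ _ => abs_nonneg _
    have h3 : 0 ≤ ∏ j ∈ s, b j := Finset.prod_nonneg fun j _ => (hb j).1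
    have h4 : ∏ j ∈ s, b j ≤ 1 := Finset.prod_le_one (fun j _ => (hb j).1) fun j _ => (hb j).2
    have h5 : a i * ∑ j ∈ s, |a j - b j| ≤ ∑ j ∈ s, |a j - b j| :=
      mul_le_of_le_one_left h2 (ha i).2
    have h6 : (a i - b i) * ∏ j ∈ s, b j ≤ |a i - b i| :=
      (mul_le_mul_of_nonneg_right (le_abs_self _) h3).trans
        (mul_le_of_le_one_right (abs_nonneg _) h4)
    linarith

lemma integrable_unit [IsProbabilityMeasure μ] {u : X → ℝ} (hu : Measurable u)
    (hb : ∀ x, 0 ≤ u x ∧ u x ≤ 1) : Integrable u μ :=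
  Integrable.of_bound hu.aestronglyMeasurable 1 (ae_of_all _ fun x => by
    rw [Real.norm_eq_abs, abs_of_nonneg (hb x).1]; exact (hb x).2)

lemma integral_pow_le [IsProbabilityMeasure μ] {u : X → ℝ} (hu : Measurable u)
    (hb : ∀ x, 0 ≤ u x ∧ u x ≤ 1) (k : ℕ) : (∫ x, u x ∂μ) ^ k ≤ ∫ x, u x ^ k ∂μ :=
  (convexOn_pow k).map_integral_le (continuous_pow k).continuousOn isClosed_Ici
    (ae_of_all _ fun x => (hb x).1) (integrable_unit hu hb)
    (integrable_unit (hu.pow_const k) fun x =>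
      ⟨pow_nonneg (hb x).1 k, pow_le_one₀ (hb x).1 (hb x).2⟩)

lemma integral_prod_shift_ge [IsProbabilityMeasure μ] (hT : Sys μ T) {u w : X → ℝ}
    (hu : Measurable u) (hub : ∀ x, 0 ≤ u x ∧ u x ≤ 1) (hw : Measurable w)
    (hwb : ∀ x, 0 ≤ w x ∧ w x ≤ 1) (s : ι → ℤ) (hinv : ∀ i, ∀ᵐ x ∂μ, w ((T ^ s i) x) = w x) :
    (∫ x, w x ∂μ) ^ (Fintype.card ι + 1) - (Fintype.card ι + 1) * ∫ x, |w x - u x| ∂μ ≤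
      ∫ x, u x * ∏ i, u ((T ^ s i) x) ∂μ := by
  refine (sub_le_sub_right (integral_pow_le hw hwb _) _).trans ?_
  have hd : Measurable fun x => |w x - u x| := by fun_prop
  have hdb : ∀ x, 0 ≤ |w x - u x| ∧ |w x - u x| ≤ 1 := fun x =>
    ⟨abs_nonneg _, abs_le.2 ⟨by linarith [(hwb x).1, (hub x).2], by linarith [(hwb x).2, (hub x).1]⟩⟩
  have hTm : ∀ i, Measurable (T ^ s i) := fun i => (hT.zpow (s i)).measurable
  have hdi : Integrable (fun x => |w x - u x|) μ := integrable_unit hd hdb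
  have hdsi : ∀ i, Integrable (fun x => |w ((T ^ s i) x) - u ((T ^ s i) x)|) μ := fun i =>
    integrable_unit (hd.comp (hTm i)) fun x => hdb _
  have hprod : Integrable (fun x => u x * ∏ i, u ((T ^ s i) x)) μ :=
    integrable_unit (hu.mul (Finset.measurable_prod _ fun i _ => hu.comp (hTm i))) fun x =>
      ⟨mul_nonneg (hub x).1 (Finset.prod_nonneg fun i _ => (hub _).1),
        mul_le_one₀ (hub x).2 (Finset.prod_nonneg fun i _ => (hub _).1)
          (Finset.prod_le_one (fun i _ => (hub _).1) fun i _ => (hub _).2)⟩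
  have hsum : Integrable (fun x => ∑ i, |w ((T ^ s i) x) - u ((T ^ s i) x)|) μ :=
    integrable_finsetSum _ fun i _ => hdsi i
  have key : ∫ x, w x ^ (Fintype.card ι + 1) ∂μ ≤ ∫ x, (u x * ∏ i, u ((T ^ s i) x) +
      (|w x - u x| + ∑ i, |w ((T ^ s i) x) - u ((T ^ s i) x)|)) ∂μ := by
    refine integral_mono_ae (integrable_unit (hw.pow_const _) fun x =>
      ⟨pow_nonneg (hwb x).1 _, pow_le_one₀ (hwb x).1 (hwb x).2⟩) (hprod.add (hdi.add hsum)) ?_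
    filter_upwards [ae_all_iff.2 hinv] with x hx
    have := prod_le_prod_add_sum (Finset.univ : Finset (Option ι))
      (a := fun o => w (o.elim x fun i => (T ^ s i) x))
      (b := fun o => u (o.elim x fun i => (T ^ s i) x)) (fun _ => hwb _) (fun _ => hub _)
    simp only [Fintype.prod_option, Fintype.sum_option, Option.elim_none, Option.elim_some, hx,
      Finset.prod_const, Finset.card_univ] at this
    simp only [hx]
    rw [pow_succ, mul_comm]
    exact this
  have hdsum : Integrable (fun x => |w x - u x| +
      ∑ i, |w ((T ^ s i) x) - u ((T ^ s i) x)|) μ := hdi.add hsum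
  rw [integral_add hprod hdsum, integral_add hdi hsum,
    integral_finsetSum _ (fun i _ => hdsi i)] at key
  have e : ∀ i, ∫ x, |w ((T ^ s i) x) - u ((T ^ s i) x)| ∂μ = ∫ x, |w x - u x| ∂μ := fun i =>
    hT.integral_sh' (s i) (fun x => |w x - u x|)
  simp only [e, Finset.sum_const, Finset.card_univ, nsmul_eq_mul] at key
  linarith

lemma real_inter_eq_integral [IsProbabilityMeasure μ] (hT : Sys μ T) {A : Set X}
    (hA : MeasurableSet A) (s : ι → ℤ) :
    ((μ.real (A ∩ ⋂ i, (T ^ s i) ⁻¹' A) : ℝ) : ℂ) =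
      ∫ x, ((A.indicator (fun _ => (1 : ℝ)) x : ℝ) : ℂ) *
        ∏ i, sh T (s i) (fun x => ((A.indicator (fun _ => (1 : ℝ)) x : ℝ) : ℂ)) x ∂μ := by
  have hm : MeasurableSet (A ∩ ⋂ i, (T ^ s i) ⁻¹' A) :=
    hA.inter (MeasurableSet.iInter fun i => (hT.zpow (s i)).measurable hA)
  have h1 := integral_indicator_const (μ := μ) (1 : ℝ) hm
  rw [smul_eq_mul, mul_one] at h1
  rw [← h1, ← integral_complex_ofReal]
  congr 1; ext x
  simp only [sh]
  rw [← Complex.ofReal_prod, ← Complex.ofReal_mul]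
  congr 1
  have h1 : ∀ y ∈ A, A.indicator (fun _ => (1 : ℝ)) y = 1 := fun y hy =>
    Set.indicator_of_mem hy _
  by_cases hx : x ∈ A ∩ ⋂ i, (T ^ s i) ⁻¹' A
  · rw [Set.indicator_of_mem hx, h1 x hx.1, one_mul, Finset.prod_eq_one]
    intro i _
    exact h1 _ (Set.mem_iInter.1 hx.2 i)
  · rw [Set.indicator_of_notMem hx]
    by_cases hxA : x ∈ A
    · have : ∃ i, (T ^ s i) x ∉ A := by
        by_contra! h
        exact hx ⟨hxA, Set.mem_iInter.2 h⟩
      obtain ⟨i, hi⟩ := this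
      rw [Finset.prod_eq_zero (Finset.mem_univ i) (Set.indicator_of_notMem hi _), mul_zero]
    · rw [Set.indicator_of_notMem hxA, zero_mul]

variable [DecidableEq ι]

lemma PerpRat.mean_replace_slot [IsProbabilityMeasure μ] (hT : Sys μ T) (herg : Ergodic T μ)
    (hp : Fam p) (M : InvMean) {f₀ : X → ℂ} {f : ι → X → ℂ} (hf₀ : B1 f₀) (hf : ∀ i, B1 (f i))
    (i₀ : ι) {U : X → ℂ} (hU : B1 U) (hb : B1 (fun x => f i₀ x - U x))
    (hperp : PerpRat μ T (fun x => f i₀ x - U x)) :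
    M.m (fun n => ∫ x, f₀ x * ∏ i, sh T (p i n) (f i) x ∂μ) =
      M.m (fun n => ∫ x, f₀ x * ∏ i, sh T (p i n) (Function.update f i₀ U i) x ∂μ) := by
  have hB : ∀ g : X → ℂ, B1 g → ∀ i, B1 (Function.update f i₀ g i) := fun g hg i => by
    by_cases hi : i = i₀
    · subst hi; simpa using hg
    · simpa [hi] using hf i
  have h0 := PerpRat.mean_slot hT herg hp M hf₀ (hB _ hb) i₀ (by simpa using hperp)
  rw [← sub_eq_zero, ← M.sub', ← h0]
  congr 1; ext n
  have h_intble : ∀ g : ι → X → ℂ, (∀ i, B1 (g i)) →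
      Integrable (fun x => f₀ x * ∏ i, sh T (p i n) (g i) x) μ := fun g hg =>
    (hf₀.mul (B1.prod Finset.univ fun i _ => hT.b1_sh (hg i) _)).integrable μ
  rw [← integral_sub (h_intble f hf) (h_intble _ (hB U hU))]
  congr 1; ext x
  have e : ∀ g : X → ℂ, ∏ i, sh T (p i n) (Function.update f i₀ g i) x =
      sh T (p i₀ n) g x * ∏ i ∈ Finset.univ.erase i₀, sh T (p i n) (f i) x := fun g => by
    rw [← Finset.mul_prod_erase _ _ (Finset.mem_univ i₀), Function.update_self]
    congr 1
    exact Finset.prod_congr rfl fun i hi => by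
      rw [Function.update_of_ne (Finset.ne_of_mem_erase hi)]
  rw [e, e, ← Finset.mul_prod_erase _ _ (Finset.mem_univ i₀)]
  simp only [sh]
  ring

lemma PerpRat.mean_replace [IsProbabilityMeasure μ] (hT : Sys μ T) (herg : Ergodic T μ)
    (hp : Fam p) (M : InvMean) {a U : X → ℂ} (ha : B1 a) (hU : B1 U)
    (hb : B1 (fun x => a x - U x)) (hperp : PerpRat μ T (fun x => a x - U x)) :
    M.m (fun n => ∫ x, a x * ∏ i, sh T (p i n) a x ∂μ) =
      M.m (fun n => ∫ x, U x * ∏ i, sh T (p i n) U x ∂μ) := by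
  have hS : ∀ S : Finset ι, M.m (fun n => ∫ x, a x * ∏ i, sh T (p i n) a x ∂μ) =
      M.m (fun n => ∫ x, a x * ∏ i, sh T (p i n) (if i ∈ S then U else a) x ∂μ) := by
    intro S
    induction S using Finset.induction_on with
    | empty => simp
    | insert i₀ S hi ih =>
      rw [ih, PerpRat.mean_replace_slot hT herg hp M ha (f := fun i => if i ∈ S then U else a)
        (fun i => by split_ifs <;> assumption) i₀ hU (by simpa [hi] using hb)
        (by simpa [hi] using hperp)]
      congr 1; ext n; congr 1; ext x; congr 1
      refine Finset.prod_congr rfl fun i _ => ?_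
      by_cases h : i = i₀
      · subst h; simp
      · simp [h]
  rw [hS Finset.univ, ← sub_eq_zero, ← M.sub',
    ← PerpRat.mean_base hT herg hp M hb (fun _ : ι => hU) hperp]
  congr 1; ext n
  have h_intble : ∀ g : X → ℂ, B1 g → Integrable (fun x => g x * ∏ i, sh T (p i n) U x) μ :=
    fun g hg => (hg.mul (B1.prod Finset.univ fun i _ => hT.b1_sh hU _)).integrable μ
  simp only [Finset.mem_univ, if_true]
  rw [← integral_sub (h_intble a ha) (h_intble U hU)]
  congr 1; ext x; ring

theorem ergodic_mean_ge [IsProbabilityMeasure μ] (hT : Sys μ T) (herg : Ergodic T μ) {A : Set X}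
    (hA : MeasurableSet A) (ε : ℝ) (hε : 0 < ε) :
    ∃ n₀ : ℕ, ∀ n ≥ n₀, ∀ p : ι → ℤ → ℤ, Fam p → (∀ i j, (n.factorial : ℤ) ∣ p i j) →
      ∀ M : InvMean, μ.real A ^ (Fintype.card ι + 1) - ε ≤
        (M.m (fun j => ((μ.real (A ∩ ⋂ i, (T ^ p i j) ⁻¹' A) : ℝ) : ℂ))).re := by
  obtain ⟨u, hu, hub, hperp, happ⟩ := exists_rational_part hT hA
  obtain ⟨n₀, hn₀⟩ := happ (ε / (Fintype.card ι + 1)) (by positivity)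
  refine ⟨n₀, fun n hn p hp hdvd M => ?_⟩
  obtain ⟨w, hw, hwb, hinv, h_intble, hδ⟩ := hn₀ n hn
  have hgm : Measurable (A.indicator (fun _ => (1 : ℝ))) := measurable_const.indicator hA
  have hgb : ∀ x, 0 ≤ A.indicator (fun _ => (1 : ℝ)) x ∧ A.indicator (fun _ => (1 : ℝ)) x ≤ 1 :=
    fun x => ⟨Set.indicator_nonneg (fun _ _ => zero_le_one) x,
      Set.indicator_le_self' (fun _ _ => zero_le_one) x⟩
  simp only [Complex.ofReal_sub] at hperp
  simp only [real_inter_eq_integral hT hA]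
  rw [PerpRat.mean_replace hT herg hp M (B1.ofReal hgm hgb) (B1.ofReal hu hub)
    ⟨(Complex.measurable_ofReal.comp hgm).sub (Complex.measurable_ofReal.comp hu), fun x => by
      beta_reduce
      rw [← Complex.ofReal_sub, Complex.norm_real, Real.norm_eq_abs, abs_le]
      constructor <;> linarith [(hgb x).1, (hub x).1, (hgb x).2, (hub x).2]⟩ hperp]
  have hc := M.const ((μ.real A ^ (Fintype.card ι + 1) - ε : ℝ) : ℂ)
  have hre : ((μ.real A ^ (Fintype.card ι + 1) - ε : ℝ) : ℂ).re =
    μ.real A ^ (Fintype.card ι + 1) - ε := Complex.ofReal_re _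
  rw [← hre, ← hc]
  refine M.mono (fun _ => le_rfl) (D := 1) (fun j => ?_) fun j => ?_
  · exact B1.norm_integral_le (B1.mul (B1.ofReal hu hub)
      (B1.prod Finset.univ fun i _ => hT.b1_sh (B1.ofReal hu hub) _)) μ
  · have h1 := integral_prod_shift_ge hT hu hub hw hwb (fun i => p i j) (fun i => by
      obtain ⟨m, hm⟩ := hdvd i j
      simp only [hm]; exact hinv m)
    have e : ∫ x, (u x : ℂ) * ∏ i, sh T (p i j) (fun x => (u x : ℂ)) x ∂μ =
        ((∫ x, u x * ∏ i, u ((T ^ p i j) x) ∂μ : ℝ) : ℂ) := by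
      rw [← integral_complex_ofReal]
      congr 1; ext x
      simp [sh]
    rw [e, Complex.ofReal_re, Complex.ofReal_re, ← h_intble]
    refine le_trans ?_ h1
    have : (Fintype.card ι + 1 : ℝ) * ∫ x, |w x - u x| ∂μ ≤ ε := by
      rw [le_div_iff₀ (by positivity)] at hδ
      linarith
    linarith

end ErgodicMean

section Intervals

lemma eventually_interval_mean_ge {u : ℤ → ℝ} (hu : ∀ n, 0 ≤ u n ∧ u n ≤ 1) {c c' : ℝ}
    (hM : ∀ M : InvMean, c ≤ (M.m (fun n => (u n : ℂ))).re) (hc : c' < c) (b : ℕ → ℤ) :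
    ∀ᶠ N in atTop, c' ≤ 𝔼 j ∈ Finset.range (N + 1), u (b N + j) := by
  by_contra hcon
  rw [Filter.not_eventually, Filter.frequently_iff_neBot] at hcon
  set 𝒰 := Ultrafilter.of
    (atTop ⊓ 𝓟 {N : ℕ | ¬ c' ≤ 𝔼 j ∈ Finset.range (N + 1), u (b N + j)}) with h𝒰
  have hle := Ultrafilter.of_le
    (atTop ⊓ 𝓟 {N : ℕ | ¬ c' ≤ 𝔼 j ∈ Finset.range (N + 1), u (b N + j)})
  obtain ⟨M, h⟩ := exists_invMean b (fun N => N + 1) (tendsto_add_atTop_nat 1) 𝒰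
    (hle.trans inf_le_left)
  have h1 := h (fun n => (u n : ℂ)) 1 (fun n => by
    rw [Complex.norm_real, Real.norm_eq_abs, abs_of_nonneg (hu n).1]; exact (hu n).2)
  have h2 : (M.m (fun n => (u n : ℂ))).re ≤ c' := by
    refine le_of_tendsto ((Complex.continuous_re.tendsto _).comp h1) ?_
    have h3 : ∀ᶠ N in (𝒰 : Filter ℕ),
        N ∈ {N : ℕ | ¬ c' ≤ 𝔼 j ∈ Finset.range (N + 1), u (b N + j)} :=
      (hle.trans inf_le_right) (mem_principal_self _)
    filter_upwards [h3] with N hN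
    simp only [Function.comp, iavg, ← Complex.ofReal_expect, Complex.ofReal_re]
    exact (not_le.1 hN).le
  linarith [hM M]

lemma Rep.exists_scale {q : Polynomial ℚ} {P : ℤ → ℤ} (hq : Rep q P) (h0 : P 0 = 0) :
    ∃ D : ℕ, 0 < D ∧ ∀ K j : ℤ, K ∣ P (D * K * j) := by
  obtain ⟨b, hbmem, hb⟩ := IsLocalization.integerNormalization_spec (nonZeroDivisors ℤ) q
  set r := IsLocalization.integerNormalization (nonZeroDivisors ℤ) q
  have hb0 : b ≠ 0 := nonZeroDivisors.ne_zero hbmem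
  have hr : ∀ n : ℤ, r.eval n = b * P n := by
    intro n
    have h1 : (r.map (algebraMap ℤ ℚ)).eval (n : ℚ) = b * q.eval (n : ℚ) := by
      rw [hb, Polynomial.eval_smul, zsmul_eq_mul]
    rw [hq n] at h1
    have h2 : ((r.eval n : ℤ) : ℚ) = (r.map (algebraMap ℤ ℚ)).eval (n : ℚ) := by
      rw [← eq_intCast (algebraMap ℤ ℚ) n, Polynomial.eval_map_apply]; simp
    rw [h1] at h2
    exact_mod_cast h2
  refine ⟨b.natAbs ^ 2, by positivity, fun K j => ?_⟩
  have e : ((b.natAbs ^ 2 : ℕ) : ℤ) = b ^ 2 := by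
    push_cast; exact sq_abs _
  rw [e]
  have h1 := Polynomial.sub_dvd_eval_sub (b ^ 2 * K * j) 0 r
  rw [hr, hr, h0, mul_zero, sub_zero, sub_zero] at h1
  have h2 : b * (K * (b * j)) ∣ b * P (b ^ 2 * K * j) := by
    have e3 : b ^ 2 * K * j = b * (K * (b * j)) := by ring
    rw [e3] at h1 ⊢
    exact h1
  exact (Dvd.intro _ rfl).trans (Int.dvd_of_mul_dvd_mul_left hb0 h2)

variable {ι : Type} [Fintype ι] {p : ι → ℤ → ℤ}

lemma Fam.exists_scale (hp : Fam p) (h0 : ∀ i, p i 0 = 0) :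
    ∃ D : ℕ, 0 < D ∧ ∀ i, ∀ K j : ℤ, K ∣ p i (D * K * j) := by
  choose q hq using hp.rep
  choose D hD h using fun i => (hq i).exists_scale (h0 i)
  refine ⟨∏ i, D i, Finset.prod_pos fun i _ => hD i, fun i K j => ?_⟩
  obtain ⟨m, hm⟩ := Finset.dvd_prod_of_mem D (Finset.mem_univ i)
  have := h i K (m * j)
  rw [hm]
  convert this using 2
  push_cast
  ring

lemma Fam.comp_mul (hp : Fam p) {d : ℤ} (hd : d ≠ 0) : Fam (fun i n => p i (d * n)) where
  rep i := by
    obtain ⟨q, hq⟩ := hp.rep i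
    refine ⟨q.comp (Polynomial.C (d : ℚ) * Polynomial.X), fun n => ?_⟩
    have := hq (d * n)
    rw [Polynomial.eval_comp]
    push_cast at this
    simpa using this
  ind c hc := by
    rintro ⟨C, hC⟩
    choose q hq using hp.rep
    refine hp.ind c hc ⟨C, fun n => ?_⟩
    set R : Polynomial ℚ := ∑ i, Polynomial.C (c i : ℚ) * q i - Polynomial.C (C : ℚ)
    have hR : ∀ m : ℤ, R.eval (m : ℚ) = ((∑ i, c i * p i m - C : ℤ) : ℚ) := fun m => by
      simp only [R, Polynomial.eval_sub, Polynomial.eval_finsetSum, Polynomial.eval_mul,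
        Polynomial.eval_C]
      push_cast
      simp only [hq _ m]
    have h0 : R = 0 := by
      refine Polynomial.eq_zero_of_infinite_isRoot R
        (Set.Infinite.mono (s := Set.range fun n : ℤ => ((d * n : ℤ) : ℚ)) ?_ ?_)
      · rintro _ ⟨n, rfl⟩
        change R.eval _ = 0
        rw [hR, hC n]; simp
      · refine Set.infinite_range_of_injective fun a b hab => ?_
        have : d * a = d * b := by exact_mod_cast hab
        exact mul_left_cancel₀ hd this
    have h1 := hR n
    rw [h0, Polynomial.eval_zero] at h1
    have : (∑ i, c i * p i n - C : ℤ) = 0 := by exact_mod_cast h1.symm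
    linarith

end Intervals

section Decomposition

variable {X : Type*} [mX : MeasurableSpace X] {ν : Measure X} {T : Equiv.Perm X}

lemma exists_countable_piSystem [MeasurableSpace.CountablyGenerated X] :
    ∃ C : Set (Set X), C.Countable ∧ mX = MeasurableSpace.generateFrom C ∧ IsPiSystem C := by
  set G := MeasurableSpace.countableGeneratingSet X
  refine ⟨(fun t : Set (Set X) => ⋂₀ t) '' {t | t.Finite ∧ t ⊆ G}, ?_, ?_, ?_⟩
  · exact (Set.countable_ofPred_finite_subset
      MeasurableSpace.countable_countableGeneratingSet).image _
  · refine le_antisymm ?_ (MeasurableSpace.generateFrom_le ?_)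
    · conv_lhs => rw [← MeasurableSpace.generateFrom_countableGeneratingSet (α := X)]
      refine MeasurableSpace.generateFrom_mono fun s hs => ⟨{s}, ⟨Set.finite_singleton s, ?_⟩, ?_⟩
      · simpa using hs
      · simp
    · rintro _ ⟨t, ⟨htf, ht⟩, rfl⟩
      exact MeasurableSet.sInter htf.countable fun s hs =>
        MeasurableSpace.measurableSet_countableGeneratingSet (ht hs)
  · rintro _ ⟨t, ⟨htf, ht⟩, rfl⟩ _ ⟨u, ⟨huf, hu⟩, rfl⟩ -
    exact ⟨t ∪ u, ⟨htf.union huf, Set.union_subset ht hu⟩, Set.sInter_union t u⟩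

/-- Time averages along the orbit of `T`. -/
noncomputable def orbAvg (T : X → X) (N : ℕ) (f : X → ℝ) (x : X) : ℝ :=
  (N + 1 : ℝ)⁻¹ * ∑ j ∈ Finset.range (N + 1), f (T^[j] x)

lemma measurable_orbAvg {T : X → X} (hT : Measurable T) (N : ℕ) {f : X → ℝ} (hf : Measurable f) :
    Measurable (orbAvg T N f) :=
  (Finset.measurable_sum _ fun j _ => hf.comp (hT.iterate j)).const_mul _

lemma exists_mean_limit [IsProbabilityMeasure ν] {T : X → X} (hT : MeasurePreserving T ν ν)
    {f : X → ℝ} (hf : MemLp f 2 ν) :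
    ∃ h : X → ℝ, Measurable h ∧ (∀ᵐ x ∂ν, h (T x) = h x) ∧
      Tendsto (fun N => ∫⁻ x, ‖orbAvg T N f x - h x‖ₑ ∂ν) atTop (nhds 0) := by
  set U := (Lp.compMeasurePreservingₗᵢ ℝ (E := ℝ) (p := 2) T hT).toContinuousLinearMap
  have hU : ‖U‖ ≤ 1 := LinearIsometry.norm_toContinuousLinearMap_le _
  have hlim := ContinuousLinearMap.tendsto_birkhoffAverage_orthogonalProjection U hU (hf.toLp f)
  set P := (U.eqLocus (1 : Lp ℝ 2 ν →L[ℝ] Lp ℝ 2 ν)).orthogonalProjectionOnto (hf.toLp f)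
  have hP : U (P : Lp ℝ 2 ν) = P := P.2
  have hsum : ∀ N : ℕ, ∃ h : MemLp (fun x => ∑ j ∈ Finset.range N, f (T^[j] x)) 2 ν,
      birkhoffSum U _root_.id N (hf.toLp f) = h.toLp := by
    have hiter : ∀ j : ℕ, U^[j] (hf.toLp f) =
        (hf.comp_measurePreserving (hT.iterate j)).toLp := by
      intro j
      induction j with
      | zero => rfl
      | succ j ih =>
        rw [Function.iterate_succ_apply', ih]
        rfl
    intro N
    induction N with
    | zero => exact ⟨by simp, by simp⟩
    | succ N ih =>
      obtain ⟨h, hN⟩ := ih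
      have hadd := h.add (hf.comp_measurePreserving (hT.iterate N))
      have e : (fun x => ∑ j ∈ Finset.range (N + 1), f (T^[j] x)) =
          (fun x => ∑ j ∈ Finset.range N, f (T^[j] x)) + f ∘ T^[N] := by
        ext x; simp [Finset.sum_range_succ]
      refine ⟨e ▸ hadd, ?_⟩
      rw [birkhoffSum_succ, hN, _root_.id, hiter, ← MemLp.toLp_add]
      exact MemLp.toLp_congr _ _ (by rw [e])
  have havg : ∀ N : ℕ, ((birkhoffAverage ℝ U _root_.id (N + 1) (hf.toLp f) : Lp ℝ 2 ν) : X → ℝ) =ᵐ[ν]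
      orbAvg T N f := by
    intro N
    obtain ⟨h, hN⟩ := hsum (N + 1)
    rw [birkhoffAverage, hN]
    filter_upwards [Lp.coeFn_smul (((N + 1 : ℕ) : ℝ)⁻¹) h.toLp, h.coeFn_toLp] with x hx hy
    rw [hx, Pi.smul_apply, hy]
    simp [orbAvg]
  obtain ⟨h, hhm, hh⟩ : ∃ h : X → ℝ, Measurable h ∧ ((P : Lp ℝ 2 ν) : X → ℝ) =ᵐ[ν] h :=
    ⟨_, (Lp.stronglyMeasurable (P : Lp ℝ 2 ν)).measurable, EventuallyEq.rfl⟩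
  refine ⟨h, hhm, ?_, ?_⟩
  · have h1 : ((U (P : Lp ℝ 2 ν)) : X → ℝ) =ᵐ[ν] ((P : Lp ℝ 2 ν) : X → ℝ) ∘ T :=
      Lp.coeFn_compMeasurePreserving _ hT
    rw [hP] at h1
    filter_upwards [h1, hh, hT.quasiMeasurePreserving.ae hh] with x h1 h2 h3
    rw [← h3, ← h2, h1]; rfl
  · have h1 := (Lp.tendsto_Lp_iff_tendsto_eLpNorm' _ _).1
      (hlim.comp (tendsto_add_atTop_nat 1))
    refine tendsto_of_tendsto_of_tendsto_of_le_of_le tendsto_const_nhds h1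
      (fun _ => zero_le) fun N => ?_
    have h2 : ∫⁻ x, ‖orbAvg T N f x - h x‖ₑ ∂ν =
        eLpNorm (((birkhoffAverage ℝ U _root_.id (N + 1) (hf.toLp f) : Lp ℝ 2 ν) : X → ℝ) -
          ((P : Lp ℝ 2 ν) : X → ℝ)) 1 ν := by
      rw [eLpNorm_one_eq_lintegral_enorm]
      refine lintegral_congr_ae ?_
      filter_upwards [havg N, hh] with x hx hy
      rw [Pi.sub_apply, hx, hy]
    rw [h2]
    exact eLpNorm_le_eLpNorm_of_exponent_le (by norm_num)
      ((Lp.aestronglyMeasurable _).sub (Lp.aestronglyMeasurable _))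

end Decomposition

section Ergodic

open ProbabilityTheory

lemma ae_iInf_lintegral_eq_zero {Y X : Type*} [MeasurableSpace Y] [MeasurableSpace X]
    {ρ : Measure Y} [IsFiniteMeasure ρ] {κ : Kernel Y X} [IsMarkovKernel κ]
    {F : ℕ → Y × X → ℝ≥0∞} (hF : ∀ N, Measurable (F N))
    (h : Tendsto (fun N => ∫⁻ z, F N z ∂(ρ ⊗ₘ κ)) atTop (nhds 0)) :
    ∀ᵐ a ∂ρ, ⨅ N, ∫⁻ y, F N (a, y) ∂(κ a) = 0 := by
  have hm : ∀ N, Measurable fun a => ∫⁻ y, F N (a, y) ∂(κ a) := fun N =>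
    (hF N).lintegral_kernel_prod_right'
  have h0 : ∫⁻ a, ⨅ N, ∫⁻ y, F N (a, y) ∂(κ a) ∂ρ = 0 := by
    refine le_antisymm (ge_of_tendsto' h fun N => ?_) zero_le
    rw [Measure.lintegral_compProd (hF N)]
    exact lintegral_mono fun a => iInf_le _ N
  exact (lintegral_eq_zero_iff (Measurable.iInf hm)).1 h0

lemma measurable_enorm_sub_prod {Y X : Type*} [MeasurableSpace Y] [MeasurableSpace X]
    {f : X → ℝ} {h : Y → ℝ} (hf : Measurable f) (hh : Measurable h) :
    Measurable fun z : Y × X => ‖f z.2 - h z.1‖ₑ :=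
  ((hf.comp measurable_snd).sub (hh.comp measurable_fst)).enorm

lemma measurable_diag_of_le {X : Type*} {m mX : MeasurableSpace X} (h : m ≤ mX) :
    @Measurable _ _ mX (m.prod mX) (Function.diag : X → X × X) :=
  Measurable.prodMk (measurable_id'' h) measurable_id

variable {X : Type*} [mX : MeasurableSpace X] {ν : Measure X} {T : Equiv.Perm X}

lemma Sys.of_map_eq {η : Measure X} (hm : Measurable T) (hm' : Measurable T.symm)
    (h : η.map T = η) : Sys η T := by
  refine ⟨⟨hm, h⟩, ⟨hm', ?_⟩⟩
  conv_lhs => rw [← h]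
  rw [Measure.map_map hm' hm]
  simp

lemma condExp_preimage [IsProbabilityMeasure ν] (hT : Sys ν T) {s : Set X}
    (hs : MeasurableSet s) :
    ν[(T ⁻¹' s).indicator (fun _ => (1 : ℝ)) | aeInv ν T 1] =ᵐ[ν]
      ν[s.indicator (fun _ => (1 : ℝ)) | aeInv ν T 1] := by
  have hsi : Integrable (s.indicator (fun _ => (1 : ℝ))) ν := (integrable_const 1).indicator hs
  have hTs : MeasurableSet (T ⁻¹' s) := hT.mp.measurable hs
  refine (ae_eq_condExp_of_forall_setIntegral_eq (aeInv_le 1)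
    ((integrable_const 1).indicator hTs) (fun _ _ _ => integrable_condExp.integrableOn) ?_
    stronglyMeasurable_condExp.aestronglyMeasurable).symm
  intro t ht _
  rw [setIntegral_condExp (aeInv_le 1) hsi ht, setIntegral_indicator hs, setIntegral_indicator hTs]
  simp only [integral_const, smul_eq_mul, mul_one, measureReal_restrict_apply_univ]
  rw [← hT.mp.measureReal_preimage (ht.1.inter hs).nullMeasurableSet, Set.preimage_inter]
  refine measureReal_congr ?_
  filter_upwards [ht.2] with x hx
  rw [zpow_one] at hx
  change (x ∈ T ⁻¹' t ∩ T ⁻¹' s) = (x ∈ t ∩ T ⁻¹' s)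
  simp [hx]

/-- Almost every conditional measure on almost invariant sets is invariant. -/
lemma ae_sys_condExpKernel [StandardBorelSpace X] [IsProbabilityMeasure ν] (hT : Sys ν T) :
    ∀ᵐ ω ∂ν, Sys (condExpKernel ν (aeInv ν T 1) ω) T := by
  obtain ⟨C, hC, hgen, hpi⟩ := exists_countable_piSystem (X := X)
  have hCm : ∀ s ∈ C, MeasurableSet s := fun s hs => by
    rw [hgen]; exact MeasurableSpace.measurableSet_generateFrom hs
  have key : ∀ᵐ ω ∂ν, ∀ s ∈ C, (condExpKernel ν (aeInv ν T 1) ω).real (T ⁻¹' s) =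
      (condExpKernel ν (aeInv ν T 1) ω).real s := by
    refine (ae_ball_iff hC).2 fun s hs => ?_
    filter_upwards [condExpKernel_ae_eq_condExp (μ := ν) (aeInv_le (μ := ν) (T := T) 1) (hCm s hs),
      condExpKernel_ae_eq_condExp (μ := ν) (aeInv_le (μ := ν) (T := T) 1)
        (hT.mp.measurable (hCm s hs)), condExp_preimage hT (hCm s hs)] with x h1 h2 h3
    rw [h1, h2, h3]
  filter_upwards [key] with ω hω
  refine Sys.of_map_eq hT.mp.measurable hT.mp'.measurable ?_
  have : IsProbabilityMeasure ((condExpKernel ν (aeInv ν T 1) ω).map T) :=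
    Measure.isProbabilityMeasure_map hT.mp.measurable.aemeasurable
  refine ext_of_generate_finite C hgen hpi (fun s hs => ?_) (by simp)
  rw [Measure.map_apply hT.mp.measurable (hCm s hs), ← measureReal_eq_measureReal_iff]
  exact hω s hs

lemma setIntegral_orbAvg {η : Measure X} [IsProbabilityMeasure η] (hT : Sys η T) {f : X → ℝ}
    (hf : Integrable f η) {s : Set X} (hs : MeasurableSet s) (hTs : T ⁻¹' s = s) (N : ℕ) :
    IntegrableOn (orbAvg T N f) s η ∧ ∫ x in s, orbAvg T N f x ∂η = ∫ x in s, f x ∂η := by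
  have hj : ∀ j : ℕ, Integrable (fun x => f (T^[j] x)) η := fun j =>
    (hT.mp.iterate j).integrable_comp_of_integrable hf
  have hjs : ∀ j : ℕ, ∫ x in s, f (T^[j] x) ∂η = ∫ x in s, f x ∂η := by
    intro j
    have hinv : T^[j] ⁻¹' s = s := by
      induction j with
      | zero => rfl
      | succ j ih => rw [Function.iterate_succ, Set.preimage_comp, ih, hTs]
    have e : s.indicator (fun x => f (T^[j] x)) = fun x => s.indicator f (T^[j] x) := by
      ext x
      have : T^[j] x ∈ s ↔ x ∈ s := by
        conv_rhs => rw [← hinv]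
        rfl
      by_cases h : x ∈ s
      · rw [Set.indicator_of_mem h, Set.indicator_of_mem (this.2 h)]
      · rw [Set.indicator_of_notMem h, Set.indicator_of_notMem (fun h' => h (this.1 h'))]
    rw [← integral_indicator hs, ← integral_indicator hs, e]
    have hmp := hT.mp.iterate j
    rw [← integral_map (φ := T^[j]) (f := s.indicator f) hmp.measurable.aemeasurable, hmp.map_eq]
    rw [hmp.map_eq]
    exact (hf.indicator hs).aestronglyMeasurable
  constructor
  · exact ((integrable_finsetSum _ fun j _ => hj j).const_mul _).integrableOn
  · unfold orbAvg
    rw [integral_const_mul, integral_finsetSum _ fun j _ => (hj j).integrableOn]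
    simp only [hjs, Finset.sum_const, Finset.card_range, nsmul_eq_mul]
    rw [← mul_assoc]
    push_cast
    rw [inv_mul_cancel₀ (by positivity), one_mul]

lemma setIntegral_eq_of_iInf_eq_zero {η : Measure X} [IsProbabilityMeasure η] (hT : Sys η T)
    {f : X → ℝ} (hf : Integrable f η) {a : ℝ}
    (h : ⨅ N, ∫⁻ y, ‖orbAvg T N f y - a‖ₑ ∂η = 0) {s : Set X} (hs : MeasurableSet s)
    (hTs : T ⁻¹' s = s) : ∫ x in s, f x ∂η = a * η.real s := by
  have key : ∀ N, ‖∫ x in s, f x ∂η - a * η.real s‖ₑ ≤ ∫⁻ y, ‖orbAvg T N f y - a‖ₑ ∂η := by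
    intro N
    obtain ⟨hi, he⟩ := setIntegral_orbAvg hT hf hs hTs N
    have : ∫ x in s, f x ∂η - a * η.real s = ∫ x in s, (orbAvg T N f x - a) ∂η := by
      rw [integral_sub hi (integrable_const a), he]
      simp [mul_comm]
    rw [this]
    exact (enorm_integral_le_lintegral_enorm _).trans (setLIntegral_le_lintegral _ _)
  have h0 : ‖∫ x in s, f x ∂η - a * η.real s‖ₑ = 0 :=
    le_antisymm (h ▸ le_iInf key) zero_le
  exact sub_eq_zero.1 (enorm_eq_zero.1 h0)

lemma ergodic_of_generating {η : Measure X} [IsProbabilityMeasure η] (hT : Sys η T)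
    {C : Set (Set X)} (hgen : mX = MeasurableSpace.generateFrom C) (hpi : IsPiSystem C)
    (h : ∀ c ∈ C, ∃ a : ℝ, ⨅ N, ∫⁻ y, ‖orbAvg T N (c.indicator fun _ => (1 : ℝ)) y - a‖ₑ ∂η = 0) :
    Ergodic T η := by
  have hCm : ∀ s ∈ C, MeasurableSet s := fun s hs => by
    rw [hgen]; exact MeasurableSpace.measurableSet_generateFrom hs
  refine { toMeasurePreserving := hT.mp, aeconst_set := fun s hs hTs => ?_ }
  have key : ∀ c ∈ C, η.real (c ∩ s) = η.real s * η.real c := by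
    intro c hc
    obtain ⟨a, ha⟩ := h c hc
    have hi : Integrable (c.indicator fun _ => (1 : ℝ)) η :=
      (integrable_const 1).indicator (hCm c hc)
    have h1 := setIntegral_eq_of_iInf_eq_zero hT hi ha hs hTs
    have h2 := setIntegral_eq_of_iInf_eq_zero hT hi ha MeasurableSet.univ rfl
    rw [setIntegral_indicator (hCm c hc)] at h1 h2
    simp at h1 h2
    rw [Set.inter_comm, h1, h2, mul_comm]
  have hfin : η.restrict s = η s • η := by
    have : IsFiniteMeasure (η s • η) := Measure.smul_finite η (measure_ne_top _ _)
    refine ext_of_generate_finite C hgen hpi (fun c hc => ?_) (by simp)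
    rw [Measure.restrict_apply (hCm c hc), Measure.smul_apply, smul_eq_mul,
      ← ENNReal.toReal_eq_toReal_iff' (measure_ne_top _ _)
        (ENNReal.mul_ne_top (measure_ne_top _ _) (measure_ne_top _ _)), ENNReal.toReal_mul]
    exact key c hc
  have hsq : η s = η s * η s := by
    have := congrArg (fun m : Measure X => m s) hfin
    simpa [Measure.restrict_apply hs] using this
  rw [eventuallyConst_set']
  rcases eq_or_ne (η s) 0 with h0 | h0
  · exact Or.inl (ae_eq_empty.2 h0)
  · right
    have h1 : η s = 1 := by
      have := (ENNReal.mul_eq_left h0 (measure_ne_top η s)).1 hsq.symm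
      exact this
    exact eventuallyEq_univ.2 ((prob_compl_eq_zero_iff hs).2 h1)

/-- Almost every conditional measure on almost invariant sets is ergodic. -/
theorem ae_ergodic_condExpKernel [StandardBorelSpace X] [IsProbabilityMeasure ν] (hT : Sys ν T) :
    ∀ᵐ ω ∂ν, Sys (condExpKernel ν (aeInv ν T 1) ω) T ∧
      Ergodic T (condExpKernel ν (aeInv ν T 1) ω) := by
  obtain ⟨C, hC, hgen, hpi⟩ := exists_countable_piSystem (X := X)
  have hCm : ∀ s ∈ C, MeasurableSet s := fun s hs => by
    rw [hgen]; exact MeasurableSpace.measurableSet_generateFrom hs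
  have key : ∀ᵐ ω ∂ν, ∀ c ∈ C, ∃ a : ℝ,
      ⨅ N, ∫⁻ y, ‖orbAvg T N (c.indicator fun _ => (1 : ℝ)) y - a‖ₑ
        ∂(condExpKernel ν (aeInv ν T 1) ω) = 0 := by
    refine (ae_ball_iff hC).2 fun c hc => ?_
    have hfm : Measurable (c.indicator fun _ => (1 : ℝ)) := measurable_const.indicator (hCm c hc)
    obtain ⟨h, hm, hinv, hlim⟩ := exists_mean_limit hT.mp
      (f := c.indicator fun _ => (1 : ℝ)) (memLp_indicator_const 2 (hCm c hc) 1
        (Or.inr (measure_ne_top _ _)))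
    have hm' : Measurable[aeInv ν T 1] h := measurable_aeInv hm (by simpa using hinv)
    have hle : aeInv ν T 1 ≤ mX := aeInv_le 1
    have hF := fun N => @measurable_enorm_sub_prod X X (aeInv ν T 1) mX _ _
      (measurable_orbAvg hT.mp.measurable N hfm) hm'
    refine ae_of_ae_trim hle ?_
    have hdiag : @Measurable _ _ mX ((aeInv ν T 1).prod mX) (Function.diag : X → X × X) :=
      measurable_diag_of_le hle
    have := @ae_iInf_lintegral_eq_zero X X (aeInv ν T 1) mX (ν.trim hle) _
      (condExpKernel ν (aeInv ν T 1)) _ _ hF (by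
        rw [compProd_trim_condExpKernel hle]
        simp_rw [@lintegral_map _ _ mX ((aeInv ν T 1).prod mX) _ _ _ (hF _) hdiag]
        exact hlim)
    filter_upwards [this] with ω hω
    exact ⟨h ω, hω⟩
  filter_upwards [key, ae_sys_condExpKernel hT] with ω h1 h2
  exact ⟨h2, ergodic_of_generating h2 hgen hpi h1⟩

end Ergodic

section Standard

open ProbabilityTheory

variable {X : Type*} [mX : MeasurableSpace X] {ν : Measure X} {T : Equiv.Perm X}
variable {ι : Type} [Fintype ι]

/-- The set of points returning to `A` at all times `p i j`. -/
def retSet (T : Equiv.Perm X) (p : ι → ℤ → ℤ) (A : Set X) (j : ℤ) : Set X :=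
  A ∩ ⋂ i, (T ^ p i j) ⁻¹' A

lemma measurableSet_retSet (hT : Sys ν T) (p : ι → ℤ → ℤ) {A : Set X} (hA : MeasurableSet A)
    (j : ℤ) : MeasurableSet (retSet T p A j) :=
  hA.inter (MeasurableSet.iInter fun i => (hT.zpow (p i j)).measurable hA)

lemma measurable_condExpKernel_real [StandardBorelSpace X] [IsProbabilityMeasure ν] {s : Set X}
    (hs : MeasurableSet s) :
    Measurable fun ω => (condExpKernel ν (aeInv ν T 1) ω).real s :=
  ((measurable_condExpKernel hs).mono (aeInv_le 1) le_rfl).ennreal_toReal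

lemma integral_condExpKernel_real [StandardBorelSpace X] [IsProbabilityMeasure ν] {s : Set X}
    (hs : MeasurableSet s) :
    ∫ ω, (condExpKernel ν (aeInv ν T 1) ω).real s ∂ν = ν.real s := by
  rw [integral_congr_ae (condExpKernel_ae_eq_condExp (aeInv_le 1) hs),
    integral_condExp (aeInv_le 1), integral_indicator_const _ hs]
  simp

lemma integral_le_of_lintegral_le {f : X → ℝ} (hf : Integrable f ν) {a : ℝ} (ha : 0 ≤ a)
    (h : ∫⁻ x, ENNReal.ofReal (f x) ∂ν ≤ ENNReal.ofReal a) : ∫ x, f x ∂ν ≤ a := by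
  rw [integral_eq_lintegral_pos_part_sub_lintegral_neg_part hf]
  have := ENNReal.toReal_le_of_le_ofReal ha h
  have h2 : 0 ≤ (∫⁻ x, ENNReal.ofReal (-f x) ∂ν).toReal := ENNReal.toReal_nonneg
  linarith

lemma lintegral_liminf_liminf_le {g : ℕ → ℕ → X → ℝ≥0∞} (hg : ∀ n N, Measurable (g n N))
    {a : ℝ≥0∞} (h : ∀ n N, ∫⁻ x, g n N x ∂ν ≤ a) :
    ∫⁻ x, liminf (fun n => liminf (fun N => g n N x) atTop) atTop ∂ν ≤ a := by
  have hlim : ∀ u : ℕ → ℝ≥0∞, (∀ n, u n ≤ a) → liminf u atTop ≤ a := fun u hu =>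
    (liminf_le_liminf (Eventually.of_forall hu)).trans_eq (liminf_const a)
  refine (lintegral_liminf_le fun n => Measurable.liminf (hg n)).trans (hlim _ fun n => ?_)
  exact (lintegral_liminf_le (hg n)).trans (hlim _ (h n))

lemma lt_on_progression_of_not_mem {S : ℕ → Prop} {a q N j : ℕ} (hq : 0 < q)
    (h : ∀ n, S n → a ≤ n → a + q * (N + 1) < n) (hj : j < N + 1) :
    ¬ S (q * (a / q + 1 + j)) := by
  intro hS
  have h1 : a < q * (a / q + 1) := Nat.lt_mul_div_succ a hq
  have h2 : q * (a / q) ≤ a := Nat.mul_div_le a q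
  have h3 := h _ hS (by nlinarith)
  have h4 : q * j ≤ q * N := Nat.mul_le_mul_left q (by omega)
  nlinarith

theorem syndetic_of_standardBorel [DecidableEq ι] [StandardBorelSpace X] [IsProbabilityMeasure ν] (hT : Sys ν T)
    {p : ι → ℤ → ℤ} (hp : Fam p) (h0 : ∀ i, p i 0 = 0) {A : Set X} (hA : MeasurableSet A)
    {ε : ℝ} (hε : 0 < ε) :
    Syndetic {n : ℕ | ν.real A ^ (Fintype.card ι + 1) - ε ≤ ν.real (retSet T p A n)} := by
  by_contra hS
  unfold Syndetic at hS
  push Not at hS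
  obtain ⟨D, hD, hdvd⟩ := hp.exists_scale h0
  set k := Fintype.card ι
  set q : ℕ → ℕ := fun n => D * n.factorial with hq
  have hqpos : ∀ n, 0 < q n := fun n => Nat.mul_pos hD n.factorial_pos
  choose a ha using hS
  set b : ℕ → ℕ → ℕ := fun n N => a (q n * (N + 1)) / q n + 1 with hb
  have hlt : ∀ n N j : ℕ, j < N + 1 →
      ν.real (retSet T p A (q n * ((b n N : ℤ) + j))) < ν.real A ^ (k + 1) - ε := by
    intro n N j hj
    have := lt_on_progression_of_not_mem (hqpos n) (ha (q n * (N + 1))) hj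
    rw [lt_sub_iff_add_lt]
    simpa [hb] using this
  have hpos : 0 < ν.real A ^ (k + 1) - ε := measureReal_nonneg.trans_lt (hlt 0 0 0 one_pos)
  set κ := condExpKernel ν (aeInv ν T 1) with hκ
  set V : ℕ → X → ℤ → ℝ := fun n ω j => (κ ω).real (retSet T p A (q n * j)) with hV
  have hVb : ∀ n ω j, 0 ≤ V n ω j ∧ V n ω j ≤ 1 := fun n ω j =>
    ⟨measureReal_nonneg, measureReal_le_one⟩
  have hVm : ∀ n j, Measurable fun ω => V n ω j := fun n j =>
    measurable_condExpKernel_real (measurableSet_retSet hT p hA _)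
  set G : ℕ → ℕ → X → ℝ := fun n N ω => 𝔼 j ∈ Finset.range (N + 1), V n ω (b n N + j) with hG
  have hGm : ∀ n N, Measurable (G n N) := by
    intro n N
    simp only [hG, Finset.expect_eq_sum_div_card]
    exact (Finset.measurable_sum _ fun j _ => hVm n _).div_const _
  have hGint : ∀ n N, ∫⁻ ω, ENNReal.ofReal (G n N ω) ∂ν ≤
      ENNReal.ofReal (ν.real A ^ (k + 1) - ε) := by
    intro n N
    have hVi : ∀ j, Integrable (fun ω => V n ω j) ν := fun j =>
      integrable_unit (hVm n j) fun ω => hVb n ω j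
    rw [← ofReal_integral_eq_lintegral_ofReal]
    · refine ENNReal.ofReal_le_ofReal ?_
      simp only [hG, Finset.expect_eq_sum_div_card]
      rw [integral_div, integral_finsetSum _ fun j _ => hVi _]
      rw [div_le_iff₀ (by simp; positivity)]
      refine (Finset.sum_le_card_nsmul _ _ (ν.real A ^ (k + 1) - ε) fun j hj => ?_).trans_eq ?_
      · simp only [hV, hκ]
        rw [integral_condExpKernel_real (measurableSet_retSet hT p hA _)]
        exact (hlt n N j (Finset.mem_range.1 hj)).le
      · rw [nsmul_eq_mul, mul_comm]
    · simp only [hG, Finset.expect_eq_sum_div_card]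
      exact (integrable_finsetSum _ fun j _ => hVi _).div_const _
    · exact ae_of_all _ fun ω => Finset.expect_nonneg fun j _ => (hVb n ω _).1
  have hlow : ∀ᵐ ω ∂ν, ENNReal.ofReal ((κ ω).real A ^ (k + 1) - ε / 2) ≤
      liminf (fun n => liminf (fun N => ENNReal.ofReal (G n N ω)) atTop) atTop := by
    filter_upwards [ae_ergodic_condExpKernel hT] with ω hω
    obtain ⟨n₀, hn₀⟩ := ergodic_mean_ge hω.1 hω.2 hA (ε / 4) (by positivity) (ι := ι)
    refine le_liminf_of_le (by isBoundedDefault) (eventually_atTop.2 ⟨n₀, fun n hn => ?_⟩)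
    refine le_liminf_of_le (by isBoundedDefault) ?_
    have hfam : Fam fun i j => p i ((q n : ℤ) * j) :=
      hp.comp_mul (by exact_mod_cast (hqpos n).ne')
    have hM := hn₀ n hn _ hfam fun i j => by
      have := hdvd i (n.factorial : ℤ) j
      simpa [hq] using this
    have := eventually_interval_mean_ge (u := V n ω) (hVb n ω) hM
      (c' := (κ ω).real A ^ (k + 1) - ε / 2) (by simp only [hκ]; linarith) (fun N => b n N)
    filter_upwards [this] with N hN
    exact ENNReal.ofReal_le_ofReal hN
  have hKm : Measurable fun ω => (κ ω).real A := measurable_condExpKernel_real hA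
  have hKb : ∀ ω, 0 ≤ (κ ω).real A ∧ (κ ω).real A ≤ 1 := fun ω =>
    ⟨measureReal_nonneg, measureReal_le_one⟩
  have hKi : Integrable (fun ω => (κ ω).real A ^ (k + 1)) ν :=
    integrable_unit (hKm.pow_const _) fun ω =>
      ⟨pow_nonneg (hKb ω).1 _, pow_le_one₀ (hKb ω).1 (hKb ω).2⟩
  have hup := integral_le_of_lintegral_le (hKi.sub (integrable_const (ε / 2))) hpos.le
    ((lintegral_mono_ae hlow).trans
      (lintegral_liminf_liminf_le (fun n N => (hGm n N).ennreal_ofReal) hGint))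
  have hpow := integral_pow_le (μ := ν) hKm hKb (k + 1)
  rw [integral_condExpKernel_real hA] at hpow
  have hsub : ∫ ω, ((fun ω => (κ ω).real A ^ (k + 1)) - fun _ => ε / 2 : X → ℝ) ω ∂ν =
      ∫ ω, (κ ω).real A ^ (k + 1) ∂ν - ε / 2 := by
    rw [integral_sub' hKi (integrable_const _)]; simp
  rw [hsub] at hup
  linarith

end Standard

section Coding

variable {X : Type*} [mX : MeasurableSpace X] {μ : Measure X} {T : Equiv.Perm X}

/-- The shift on two-sided binary sequences. -/
def bshift : Equiv.Perm (ℤ → Bool) where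
  toFun ω n := ω (n + 1)
  invFun ω n := ω (n - 1)
  left_inv ω := by ext n; simp
  right_inv ω := by ext n; simp

lemma bshift_zpow (m : ℤ) (ω : ℤ → Bool) (n : ℤ) : (bshift ^ m) ω n = ω (n + m) := by
  induction m using Int.induction_on generalizing ω with
  | zero => simp
  | succ m ih => rw [zpow_add_one, Equiv.Perm.mul_apply, ih]; simp [bshift, add_assoc]
  | pred m ih =>
    rw [zpow_sub_one, Equiv.Perm.mul_apply, ih]
    change ω (n + -m - 1) = _
    congr 1; ring

open Classical in
/-- The itinerary of a point relative to `A`. -/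
noncomputable def itin (T : Equiv.Perm X) (A : Set X) (x : X) (n : ℤ) : Bool :=
  decide ((T ^ n) x ∈ A)

lemma measurable_itin (hT : Sys μ T) {A : Set X} (hA : MeasurableSet A) :
    Measurable (itin T A) := by
  refine measurable_pi_lambda _ fun n => measurable_to_bool ?_
  have : (fun x => itin T A x n) ⁻¹' {true} = (T ^ n) ⁻¹' A := by
    ext x; simp [itin]
  rw [this]
  exact (hT.zpow n).measurable hA

lemma sys_bshift (hT : Sys μ T) {A : Set X} (hA : MeasurableSet A) :
    Sys (μ.map (itin T A)) bshift := by
  have hm : Measurable (bshift : (ℤ → Bool) → ℤ → Bool) :=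
    measurable_pi_lambda _ fun n => measurable_pi_apply (n + 1)
  have hm' : Measurable (bshift.symm : (ℤ → Bool) → ℤ → Bool) :=
    measurable_pi_lambda _ fun n => measurable_pi_apply (n - 1)
  refine Sys.of_map_eq hm hm' ?_
  have hcomm : bshift ∘ itin T A = itin T A ∘ T := by
    ext x n
    simp [itin, bshift, zpow_add]
  rw [Measure.map_map hm (measurable_itin hT hA), hcomm,
    ← Measure.map_map (measurable_itin hT hA) hT.mp.measurable, hT.mp.map_eq]

theorem syndetic_retSet [IsProbabilityMeasure μ] (hT : Sys μ T) {ι : Type} [Fintype ι]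
    [DecidableEq ι] {p : ι → ℤ → ℤ} (hp : Fam p) (h0 : ∀ i, p i 0 = 0) {A : Set X}
    (hA : MeasurableSet A) {ε : ℝ} (hε : 0 < ε) :
    Syndetic {n : ℕ | μ.real A ^ (Fintype.card ι + 1) - ε ≤ μ.real (retSet T p A n)} := by
  have hm := measurable_itin hT hA
  have : IsProbabilityMeasure (μ.map (itin T A)) :=
    Measure.isProbabilityMeasure_map hm.aemeasurable
  set B : Set (ℤ → Bool) := {ω | ω 0 = true} with hB
  have hev : Measurable fun ω : ℤ → Bool => ω 0 := measurable_pi_apply 0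
  have hBm : MeasurableSet B := hev (measurableSet_singleton true)
  have hσ := sys_bshift hT hA
  have h := syndetic_of_standardBorel hσ hp h0 hBm hε
  have e0 : (μ.map (itin T A)).real B = μ.real A := by
    rw [map_measureReal_apply hm hBm]
    congr 1; ext x; simp [hB, itin]
  have e1 : ∀ n : ℕ, (μ.map (itin T A)).real (retSet bshift p B n) = μ.real (retSet T p A n) := by
    intro n
    rw [map_measureReal_apply hm (measurableSet_retSet hσ p hBm n)]
    congr 1; ext x; simp [hB, itin, retSet, bshift_zpow]
  simpa only [e0, e1] using h

end Coding

end IndepPoly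

theorem multiple_recurrence_independent_polynomials
    {X : Type*} [MeasurableSpace X] (μ : Measure X) [IsProbabilityMeasure μ]
    (T : Equiv.Perm X) (hT : MeasurePreserving T μ μ) (hT' : MeasurePreserving T.symm μ μ)
    (k : ℕ) (p : Fin k → ℤ → ℤ) (hpoly : ∀ i, IsIntPoly (p i)) (hind : RatIndep p)
    (hzero : ∀ i, p i 0 = 0)
    (A : Set X) (hA : MeasurableSet A) :
    ∀ ε > (0 : ℝ),
      Syndetic {n : ℕ |
        (μ A).toReal ^ (k + 1) - ε ≤ (μ (A ∩ ⋂ i, ⇑(T ^ p i n) ⁻¹' A)).toReal} := by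
  intro ε hε
  have hp : IndepPoly.Fam p := ⟨hpoly, hind⟩
  have h := IndepPoly.syndetic_retSet ⟨hT, hT'⟩ hp hzero hA hε
  rwa [Fintype.card_fin] at h
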